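/- arXiv:math/0406165 — 5 statements merged into one kernel-verified Lean document; each statement's English description precedes it below -/
import Mathlib

section
/- Let k be a field, R = k[[y_1,y_2,y_3,y_4]] the formal power series ring in four variables over k, and set x_1 = y_1 y_3, x_2 = y_2 y_4, x_3 = y_1 y_4 + y_2 y_3. Then √((x_1,x_2,x_3)R) = (y_1,y_2)R ∩ (y_3,y_4)R, the local cohomology module H^3_{(x_1,x_2,x_3)R}(R) is isomorphic to E_R(k), and the zero ideal of R belongs to Ass_R(D(H^3_{(x_1,x_2,x_3)R}(R))), although x_1, x_2, x_3 are not part of a system of parameters for R. -/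
open IsLocalRing

/-- The underlying `R`-module of the `i`-th local cohomology of the `R`-module `M`
with support in the ideal `I`. -/
noncomputable abbrev LocalCohomologyModule {R : Type} [CommRing R] (I : Ideal R) (i : ℕ)
    (M : Type) [AddCommGroup M] [Module R M] : ModuleCat R :=
  (localCohomology I i).obj (ModuleCat.of R M)

/-- `E` is an injective hull of the residue field of the local ring `R`. -/
def IsInjectiveHullOfResidueField (R : Type) [CommRing R] [IsLocalRing R]
    (E : Type) [AddCommGroup E] [Module R E] : Prop :=
  Module.Injective R E ∧
    ∃ f : ResidueField R →ₗ[R] E, Function.Injective f ∧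
      ∀ N : Submodule R E, N ≠ ⊥ → N ⊓ LinearMap.range f ≠ ⊥

/-- The images of `x_1,…,x_i` in `R/p` are part of a system of parameters for `R/p`.
(Taking `p = ⊥` this says `x_1,…,x_i` is part of a system of parameters for `R`.) -/
def IsPartOfSystemOfParameters {R : Type} [CommRing R] [IsLocalRing R]
    (p : Ideal R) {i : ℕ} (x : Fin i → R) : Prop :=
  ∃ (n : ℕ) (h : i ≤ n) (y : Fin n → R),
    (∀ j : Fin i, y (Fin.castLE h j) = x j) ∧
    ringKrullDim (R ⧸ p) = n ∧
    (p ⊔ Ideal.span (Set.range y)).radical = maximalIdeal R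

namespace ExtTop

open CategoryTheory Limits Opposite

variable {R : Type} [CommRing R] {Z Z' : ModuleCat.{0} R}

/-- The contravariant functor `Hom(-, M)`. -/
noncomputable abbrev homFunctor (M : ModuleCat.{0} R) : ModuleCat.{0} R ⥤ (ModuleCat.{0} R)ᵒᵖ :=
  ((linearYoneda R (ModuleCat.{0} R)).obj M).rightOp

section TopHomology

variable {A : Type*} [Category* A] [Abelian A]

/-- The inclusion of the homology in the top degree of a chain complex. -/
noncomputable def homologyInclusion (K : ChainComplex A ℕ) (n : ℕ) (hK : IsZero (K.X (n + 1))) :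
    K.homology n ⟶ K.X n :=
  (K.isoHomologyπ (n + 1) n (by simp) (hK.eq_of_src _ _)).inv ≫ K.iCycles n

lemma homologyMap_comp_homologyInclusion {K L : ChainComplex A ℕ} (φ : K ⟶ L) (n : ℕ)
    (hK : IsZero (K.X (n + 1))) (hL : IsZero (L.X (n + 1))) :
    HomologicalComplex.homologyMap φ n ≫ homologyInclusion L n hL =
      homologyInclusion K n hK ≫ φ.f n := by
  rw [← cancel_epi (K.isoHomologyπ (n + 1) n (by simp) (hK.eq_of_src _ _)).hom]
  simp [homologyInclusion]

instance (K : ChainComplex A ℕ) (n : ℕ) (hK : IsZero (K.X (n + 1))) :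
    Mono (homologyInclusion K n hK) := by
  unfold homologyInclusion
  exact mono_comp _ _

lemma homologyInclusion_d (K : ChainComplex A ℕ) (n : ℕ) (hK : IsZero (K.X (n + 2))) :
    homologyInclusion K (n + 1) hK ≫ K.d (n + 1) n = 0 := by
  simp [homologyInclusion]

lemma homologyInclusion_exact (K : ChainComplex A ℕ) (n : ℕ) (hK : IsZero (K.X (n + 2))) :
    (ShortComplex.mk _ _ (homologyInclusion_d K n hK)).Exact := by
  have e : (ShortComplex.mk _ _ (K.iCycles_d (n + 1) n)).Exact :=
    ShortComplex.exact_of_f_is_kernel _ (K.cyclesIsKernel (n + 1) n (by simp))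
  refine (ShortComplex.exact_iff_of_iso ?_).1 e
  exact ShortComplex.isoMk (K.isoHomologyπ (n + 2) (n + 1) (by simp) (hK.eq_of_src _ _))
    (Iso.refl _) (Iso.refl _) (by simp [homologyInclusion]) (by simp)

end TopHomology

/-- The complex `Hom(P, M)`, as a chain complex in the opposite category. -/
noncomputable abbrev homComplex (P : ProjectiveResolution Z) (M : ModuleCat.{0} R) :
    ChainComplex (ModuleCat.{0} R)ᵒᵖ ℕ :=
  ((homFunctor M).mapHomologicalComplex (ComplexShape.down ℕ)).obj P.complex

lemma isZero_homComplex (P : ProjectiveResolution Z) (M : ModuleCat.{0} R) {n : ℕ}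
    (hP : IsZero (P.complex.X n)) : IsZero ((homComplex P M).X n) :=
  (homFunctor M).map_isZero hP

/-- The left derived functor of `Hom(-, M)` as the homology of `Hom(P, M)`. -/
noncomputable def isoHomology (P : ProjectiveResolution Z) (M : ModuleCat.{0} R) (n : ℕ) :
    ((homFunctor M).leftDerived n).obj Z ≅ (homComplex P M).homology n :=
  P.isoLeftDerivedObj (homFunctor M) n

lemma isoHomology_naturality (P : ProjectiveResolution Z) (Q : ProjectiveResolution Z')
    (M : ModuleCat.{0} R) (n : ℕ)
    (f : Z ⟶ Z') (φ : P.complex ⟶ Q.complex) (comm : φ.f 0 ≫ Q.π.f 0 = P.π.f 0 ≫ f) :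
    ((homFunctor M).leftDerived n).map f ≫ (isoHomology Q M n).hom =
      (isoHomology P M n).hom ≫ HomologicalComplex.homologyMap
        (((homFunctor M).mapHomologicalComplex (ComplexShape.down ℕ)).map φ) n :=
  ProjectiveResolution.isoLeftDerivedObj_hom_naturality f P Q φ comm _ n

/-- The inclusion of the top `Ext` in the opposite category. -/
noncomputable def toTop (P : ProjectiveResolution Z) (M : ModuleCat.{0} R) (n : ℕ)
    (hP : IsZero (P.complex.X (n + 1))) :
    ((homFunctor M).leftDerived n).obj Z ⟶ (homComplex P M).X n :=
  (isoHomology P M n).hom ≫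
    homologyInclusion (homComplex P M) n (isZero_homComplex P M hP)

lemma toTop_naturality (P : ProjectiveResolution Z) (Q : ProjectiveResolution Z')
    (M : ModuleCat.{0} R) (n : ℕ)
    (hP : IsZero (P.complex.X (n + 1))) (hQ : IsZero (Q.complex.X (n + 1)))
    (f : Z ⟶ Z') (φ : P.complex ⟶ Q.complex) (comm : φ.f 0 ≫ Q.π.f 0 = P.π.f 0 ≫ f) :
    ((homFunctor M).leftDerived n).map f ≫ toTop Q M n hQ =
      toTop P M n hP ≫
        (((homFunctor M).mapHomologicalComplex (ComplexShape.down ℕ)).map φ).f n := by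
  unfold toTop
  rw [← Category.assoc, isoHomology_naturality P Q M n f φ comm, Category.assoc, Category.assoc,
    homologyMap_comp_homologyInclusion]

instance (P : ProjectiveResolution Z) (M : ModuleCat.{0} R) (n : ℕ)
    (hP : IsZero (P.complex.X (n + 1))) : Mono (toTop P M n hP) := by
  unfold toTop
  exact mono_comp _ _

lemma toTop_d (P : ProjectiveResolution Z) (M : ModuleCat.{0} R) (n : ℕ)
    (hP : IsZero (P.complex.X (n + 2))) :
    toTop P M (n + 1) hP ≫ (homComplex P M).d (n + 1) n = 0 := by
  rw [toTop, Category.assoc, homologyInclusion_d, comp_zero]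

lemma toTop_exact (P : ProjectiveResolution Z) (M : ModuleCat.{0} R) (n : ℕ)
    (hP : IsZero (P.complex.X (n + 2))) :
    (ShortComplex.mk _ _ (toTop_d P M n hP)).Exact := by
  refine (ShortComplex.exact_iff_of_iso ?_).1
    (homologyInclusion_exact (homComplex P M) n (isZero_homComplex P M hP))
  refine ShortComplex.isoMk (isoHomology P M (n + 1)).symm
    (Iso.refl _) (Iso.refl _) ?_ ?_
  · dsimp only [Iso.refl_hom, Iso.symm_hom]
    rw [toTop, Iso.inv_hom_id_assoc, Category.comp_id]
  · dsimp only [Iso.refl_hom]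
    rw [Category.comp_id, Category.id_comp]

/-- If the resolution stops in degree `n + 1`, every map out of its top term
gives an element of the top `Ext`. -/
noncomputable def mk (P : ProjectiveResolution Z) (M : ModuleCat.{0} R) (n : ℕ)
    (hP : IsZero (P.complex.X (n + 1))) :
    ModuleCat.of R (P.complex.X n ⟶ M) ⟶ ((Ext R (ModuleCat.{0} R) n).obj (op Z)).obj M :=
  (toTop P M n hP).unop

lemma mk_surjective (P : ProjectiveResolution Z) (M : ModuleCat.{0} R) (n : ℕ)
    (hP : IsZero (P.complex.X (n + 1))) : Function.Surjective (mk P M n hP) := by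
  rw [← ModuleCat.epi_iff_surjective]
  exact inferInstanceAs (Epi (toTop P M n hP).unop)

lemma mk_eq_zero_iff (P : ProjectiveResolution Z) (M : ModuleCat.{0} R) (n : ℕ)
    (hP : IsZero (P.complex.X (n + 2))) (g : P.complex.X (n + 1) ⟶ M) :
    mk P M (n + 1) hP g = 0 ↔ ∃ h : P.complex.X n ⟶ M, P.complex.d (n + 1) n ≫ h = g := by
  have h1 := (toTop_exact P M n hP).unop
  rw [ShortComplex.ShortExact.moduleCat_exact_iff_function_exact] at h1
  exact h1 g

lemma mk_naturality (P : ProjectiveResolution Z) (Q : ProjectiveResolution Z')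
    (M : ModuleCat.{0} R) (n : ℕ)
    (hP : IsZero (P.complex.X (n + 1))) (hQ : IsZero (Q.complex.X (n + 1)))
    (f : Z ⟶ Z') (φ : P.complex ⟶ Q.complex) (comm : φ.f 0 ≫ Q.π.f 0 = P.π.f 0 ≫ f)
    (g : Q.complex.X n ⟶ M) :
    (((Ext R (ModuleCat.{0} R) n).map f.op).app M) (mk Q M n hQ g) = mk P M n hP (φ.f n ≫ g) := by
  have h := congrArg Quiver.Hom.unop (toTop_naturality P Q M n hP hQ f φ comm)
  exact congrArg (fun t => t.hom g) h

end ExtTop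

namespace ProductResolution

open CategoryTheory Limits Opposite

variable {R : Type} [CommRing R] (a b c d : R)

/-- The first differential: the four products `ac, ad, bc, bd`. -/
def d₁ : (R × R × R × R) →ₗ[R] R where
  toFun r := a * c * r.1 + a * d * r.2.1 + b * c * r.2.2.1 + b * d * r.2.2.2
  map_add' r s := by simp only [Prod.fst_add, Prod.snd_add]; ring
  map_smul' r s := by
    simp only [Prod.smul_fst, Prod.smul_snd, smul_eq_mul, RingHom.id_apply]; ring

/-- The second differential: the linear relations between `ac, ad, bc, bd`. -/
def d₂ : (R × R × R × R) →ₗ[R] (R × R × R × R) where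
  toFun r := (d * r.1 + b * r.2.2.1, -(c * r.1) + b * r.2.2.2, d * r.2.1 - a * r.2.2.1,
    -(c * r.2.1) - a * r.2.2.2)
  map_add' r s := by
    simp only [Prod.fst_add, Prod.snd_add, Prod.mk_add_mk, Prod.mk.injEq]
    refine ⟨?_, ?_, ?_, ?_⟩ <;> ring
  map_smul' r s := by
    simp only [Prod.smul_fst, Prod.smul_snd, smul_eq_mul, RingHom.id_apply, Prod.smul_mk,
      Prod.mk.injEq]
    refine ⟨?_, ?_, ?_, ?_⟩ <;> ring

/-- The third differential. -/
def d₃ : R →ₗ[R] (R × R × R × R) where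
  toFun h := (b * h, -(a * h), -(d * h), c * h)
  map_add' r s := by
    simp only [Prod.mk_add_mk, Prod.mk.injEq]
    refine ⟨?_, ?_, ?_, ?_⟩ <;> ring
  map_smul' r s := by
    simp only [smul_eq_mul, RingHom.id_apply, Prod.smul_mk, Prod.mk.injEq]
    refine ⟨?_, ?_, ?_, ?_⟩ <;> ring

variable (R) in
/-- The terms of the resolution of `R ⧸ (a, b)(c, d)`. -/
abbrev X : ℕ → ModuleCat.{0} R
  | 0 => ModuleCat.of R R
  | 1 => ModuleCat.of R (R × R × R × R)
  | 2 => ModuleCat.of R (R × R × R × R)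
  | 3 => ModuleCat.of R R
  | _ + 4 => ModuleCat.of R PUnit

/-- The differentials of the resolution of `R ⧸ (a, b)(c, d)`. -/
abbrev δ : ∀ n, X R (n + 1) ⟶ X R n
  | 0 => ModuleCat.ofHom (d₁ a b c d)
  | 1 => ModuleCat.ofHom (d₂ a b c d)
  | 2 => ModuleCat.ofHom (d₃ a b c d)
  | _ + 3 => 0

lemma δ_comp : ∀ n, δ a b c d (n + 1) ≫ δ a b c d n = 0
  | 0 => by
    refine ModuleCat.hom_ext (LinearMap.ext fun r => ?_)
    simp only [ModuleCat.hom_comp, ModuleCat.hom_ofHom, LinearMap.comp_apply, d₁, d₂,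
      LinearMap.coe_mk, AddHom.coe_mk, ModuleCat.hom_zero, LinearMap.zero_apply]
    ring
  | 1 => by
    refine ModuleCat.hom_ext (LinearMap.ext fun r => ?_)
    simp only [ModuleCat.hom_comp, ModuleCat.hom_ofHom, LinearMap.comp_apply, d₂, d₃,
      LinearMap.coe_mk, AddHom.coe_mk, ModuleCat.hom_zero, LinearMap.zero_apply, Prod.mk_eq_zero]
    refine ⟨?_, ?_, ?_, ?_⟩ <;> ring
  | 2 => zero_comp
  | _ + 3 => zero_comp

/-- A free complex ending in `R ⧸ (a, b)(c, d)`. -/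
noncomputable abbrev complex : ChainComplex (ModuleCat.{0} R) ℕ :=
  ChainComplex.of (X R) (δ a b c d) (δ_comp a b c d)

lemma complex_d (n : ℕ) : (complex a b c d).d (n + 1) n = δ a b c d n :=
  ChainComplex.of_d _ _ _

/-- The product of the ideals `(a, b)` and `(c, d)`. -/
abbrev ideal : Ideal R := Ideal.span {a, b} * Ideal.span {c, d}

lemma range_d₁ : LinearMap.range (d₁ a b c d) = ideal a b c d := by
  rw [ideal, Ideal.span_pair_mul_span_pair]
  apply le_antisymm
  · rintro _ ⟨r, rfl⟩
    simp only [d₁, LinearMap.coe_mk, AddHom.coe_mk]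
    refine add_mem (add_mem (add_mem ?_ ?_) ?_) ?_ <;>
      exact Ideal.mul_mem_right _ _ (Ideal.subset_span (by simp))
  · rw [Ideal.span_le]
    rintro x (rfl | rfl | rfl | rfl)
    exacts [⟨(1, 0, 0, 0), by simp [d₁]⟩, ⟨(0, 1, 0, 0), by simp [d₁]⟩,
      ⟨(0, 0, 1, 0), by simp [d₁]⟩, ⟨(0, 0, 0, 1), by simp [d₁]⟩]

/-- The hypotheses under which the complex is a resolution. -/
structure IsRegular : Prop where
  left_ne_zero : b ≠ 0
  right_ne_zero : d ≠ 0
  left : ∀ u v, a * u + b * v = 0 → ∃ s, u = b * s ∧ v = -(a * s)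
  right : ∀ u v, c * u + d * v = 0 → ∃ s, u = d * s ∧ v = -(c * s)
  mixed : ∀ u v, d * u + b * v = 0 → ∃ s, u = b * s ∧ v = -(d * s)
  mem : ∀ s, b * s ∈ Ideal.span {c, d} → s ∈ Ideal.span {c, d}

variable {a b c d}

lemma d₃_injective [IsDomain R] (h : IsRegular a b c d) : Function.Injective (d₃ a b c d) := by
  rw [injective_iff_map_eq_zero]
  intro x hx
  have := congrArg Prod.fst hx
  simpa [d₃, h.left_ne_zero] using this

lemma exact_d₃_d₂ [IsDomain R] (h : IsRegular a b c d) :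
    Function.Exact (d₃ a b c d) (d₂ a b c d) := by
  rintro ⟨p, p', q, q'⟩
  constructor
  · intro H
    simp only [d₂, LinearMap.coe_mk, AddHom.coe_mk, Prod.mk_eq_zero] at H
    obtain ⟨h1, h2, h3, h4⟩ := H
    obtain ⟨s, rfl, rfl⟩ := h.mixed _ _ h1
    have e1 : b * (q' - c * s) = 0 := by linear_combination h2
    have e2 : q' = c * s := by
      simpa [h.left_ne_zero, sub_eq_zero] using e1
    subst e2
    refine ⟨s, ?_⟩
    simp only [d₃, LinearMap.coe_mk, AddHom.coe_mk, Prod.mk.injEq, true_and, and_true]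
    have e3 : d * (p' + a * s) = 0 := by linear_combination h3
    have e4 : p' + a * s = 0 := by simpa [h.right_ne_zero] using e3
    linear_combination -e4
  · rintro ⟨s, hs⟩
    rw [← hs]
    simp only [d₂, d₃, LinearMap.coe_mk, AddHom.coe_mk, Prod.mk_eq_zero]
    refine ⟨?_, ?_, ?_, ?_⟩ <;> ring

lemma exact_d₂_d₁ [IsDomain R] (h : IsRegular a b c d) :
    Function.Exact (d₂ a b c d) (d₁ a b c d) := by
  rintro ⟨r₁, r₂, r₃, r₄⟩
  constructor
  · intro H
    simp only [d₁, LinearMap.coe_mk, AddHom.coe_mk] at H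
    obtain ⟨s, h1, h2⟩ := h.left (c * r₁ + d * r₂) (c * r₃ + d * r₄) (by linear_combination H)
    obtain ⟨u, v, huv⟩ := Ideal.mem_span_pair.1
      (h.mem s (Ideal.mem_span_pair.2 ⟨r₁, r₂, by linear_combination h1⟩))
    obtain ⟨w, h3, h4⟩ := h.right (r₁ - b * u) (r₂ - b * v) (by linear_combination h1 - b * huv)
    obtain ⟨w', h5, h6⟩ := h.right (r₃ + a * u) (r₄ + a * v) (by linear_combination h2 + a * huv)
    refine ⟨(w, w', u, v), ?_⟩
    simp only [d₂, LinearMap.coe_mk, AddHom.coe_mk, Prod.mk.injEq]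
    refine ⟨?_, ?_, ?_, ?_⟩
    · linear_combination -h3
    · linear_combination -h4
    · linear_combination -h5
    · linear_combination -h6
  · rintro ⟨s, hs⟩
    rw [← hs]
    simp only [d₁, d₂, LinearMap.coe_mk, AddHom.coe_mk]
    ring

instance (n : ℕ) : Projective ((complex a b c d).X n) := by
  match n with
  | 0 | 3 => exact inferInstanceAs (Projective (ModuleCat.of R R))
  | 1 | 2 => exact inferInstanceAs (Projective (ModuleCat.of R (R × R × R × R)))
  | _ + 4 => exact inferInstanceAs (Projective (ModuleCat.of R PUnit))

variable (a b c d) in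
lemma d₁_mkQ : ModuleCat.ofHom (d₁ a b c d) ≫ ModuleCat.ofHom (ideal a b c d).mkQ = 0 :=
  ModuleCat.hom_ext (LinearMap.ext fun r => (Submodule.Quotient.mk_eq_zero _).2
    (range_d₁ a b c d ▸ LinearMap.mem_range_self _ r))

variable (a b c d) in
/-- The augmentation of the complex. -/
noncomputable abbrev augmentation :
    complex a b c d ⟶ (ChainComplex.single₀ _).obj (ModuleCat.of R (R ⧸ ideal a b c d)) :=
  (ChainComplex.toSingle₀Equiv _ _).symm ⟨ModuleCat.ofHom (ideal a b c d).mkQ,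
    (congrArg (· ≫ ModuleCat.ofHom (ideal a b c d).mkQ) (complex_d a b c d 0)).trans (d₁_mkQ a b c d)⟩

variable (a b c d) in
lemma augmentation_f_zero :
    (augmentation a b c d).f 0 = ModuleCat.ofHom (ideal a b c d).mkQ :=
  ChainComplex.toSingle₀Equiv_symm_apply_f_zero _ _

variable (a b c d) in
lemma d₁_mkQ_exact :
    (ShortComplex.mk _ _ (d₁_mkQ a b c d)).Exact := by
  apply ModuleCat.shortComplex_exact
  intro x
  exact (Submodule.Quotient.mk_eq_zero _).trans (SetLike.ext_iff.1 (range_d₁ a b c d) x).symm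

lemma quasiIso_augmentation [IsDomain R] (h : IsRegular a b c d) :
    QuasiIso (augmentation a b c d) := ⟨fun n => by
  obtain _ | n := n
  · rw [ChainComplex.quasiIsoAt₀_iff, ShortComplex.quasiIso_iff_of_zeros']
    · refine (ShortComplex.exact_and_epi_g_iff_of_iso ?_).1
        ⟨d₁_mkQ_exact a b c d, (ModuleCat.epi_iff_surjective _).2 (Submodule.mkQ_surjective _)⟩
      exact ShortComplex.isoMk (Iso.refl _) (Iso.refl _) (Iso.refl _)
        ((Category.id_comp _).trans ((complex_d a b c d 0).trans (Category.comp_id _).symm))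
        ((Category.id_comp _).trans
          ((ChainComplex.toSingle₀Equiv_symm_apply_f_zero _ _).trans (Category.comp_id _).symm))
    all_goals rfl
  · rw [quasiIsoAt_iff_exactAt']
    · rw [HomologicalComplex.exactAt_iff' _ (n + 1 + 1) (n + 1) n (by simp) (by simp)]
      apply ModuleCat.shortComplex_exact
      change Function.Exact ((complex a b c d).d (n + 1 + 1) (n + 1)) ((complex a b c d).d (n + 1) n)
      rw [complex_d, complex_d]
      match n with
      | 0 => exact exact_d₂_d₁ h
      | 1 => exact exact_d₃_d₂ h
      | 2 =>
        intro x
        exact ⟨fun hx => ⟨0, (d₃_injective h (hx.trans (map_zero _).symm)).symm⟩,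
          fun ⟨_, hy⟩ => hy ▸ map_zero (d₃ a b c d)⟩
      | n + 3 => exact fun x => ⟨fun _ => ⟨0, rfl⟩, fun _ => rfl⟩
    · apply ChainComplex.exactAt_succ_single_obj⟩

/-- The resolution of `R ⧸ (a, b)(c, d)`. -/
noncomputable abbrev resolution [IsDomain R] (h : IsRegular a b c d) :
    ProjectiveResolution (ModuleCat.of R (R ⧸ ideal a b c d)) where
  complex := complex a b c d
  π := augmentation a b c d
  quasiIso := quasiIso_augmentation h

variable (a b c d) in
/-- The components of the comparison map between two resolutions. -/
abbrev comparisonMap (s t u v : R) : ∀ n, X R n ⟶ X R n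
  | 0 => 𝟙 _
  | 1 => ModuleCat.ofHom
      ((LinearMap.lsmul R R (s * u)).prodMap ((LinearMap.lsmul R R (s * v)).prodMap
        ((LinearMap.lsmul R R (t * u)).prodMap (LinearMap.lsmul R R (t * v)))))
  | 2 => ModuleCat.ofHom
      ((LinearMap.lsmul R R (s * u * v)).prodMap ((LinearMap.lsmul R R (t * u * v)).prodMap
        ((LinearMap.lsmul R R (s * t * u)).prodMap (LinearMap.lsmul R R (s * t * v)))))
  | 3 => ModuleCat.ofHom (LinearMap.lsmul R R (s * t * u * v))
  | _ + 4 => 0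

lemma comparisonMap_comm (s t u v : R) : ∀ n,
    comparisonMap s t u v (n + 1) ≫ δ a b c d n =
      δ (a * s) (b * t) (c * u) (d * v) n ≫ comparisonMap s t u v n
  | 0 => by
    refine ModuleCat.hom_ext (LinearMap.ext fun r => ?_)
    simp only [ModuleCat.hom_comp, ModuleCat.hom_ofHom, LinearMap.comp_apply, d₁,
      LinearMap.coe_mk, AddHom.coe_mk, LinearMap.prodMap_apply, LinearMap.lsmul_apply,
      smul_eq_mul, ModuleCat.hom_id, LinearMap.id_apply]
    ring
  | 1 => by
    refine ModuleCat.hom_ext (LinearMap.ext fun r => ?_)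
    simp only [ModuleCat.hom_comp, ModuleCat.hom_ofHom, LinearMap.comp_apply, d₂,
      LinearMap.coe_mk, AddHom.coe_mk, LinearMap.prodMap_apply, LinearMap.lsmul_apply,
      smul_eq_mul, Prod.mk.injEq]
    refine ⟨?_, ?_, ?_, ?_⟩ <;> ring
  | 2 => by
    refine ModuleCat.hom_ext (LinearMap.ext fun r => ?_)
    simp only [ModuleCat.hom_comp, ModuleCat.hom_ofHom, LinearMap.comp_apply, d₃,
      LinearMap.coe_mk, AddHom.coe_mk, LinearMap.prodMap_apply, LinearMap.lsmul_apply,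
      smul_eq_mul, Prod.mk.injEq]
    refine ⟨?_, ?_, ?_, ?_⟩ <;> ring
  | _ + 3 => by simp

variable (a b c d) in
/-- The comparison map between two resolutions. -/
noncomputable abbrev comparison (s t u v : R) :
    complex (a * s) (b * t) (c * u) (d * v) ⟶ complex a b c d :=
  ChainComplex.ofHom (comparisonMap s t u v) fun n => by
    rw [complex_d, complex_d]; exact comparisonMap_comm s t u v n

variable (a b c d) in
lemma isZero_complex_X_four : IsZero ((complex a b c d).X 4) :=
  ModuleCat.isZero_of_subsingleton (ModuleCat.of R PUnit)

/-- The canonical map from multiples of the top generator to `Ext³`. -/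
noncomputable def toExt [IsDomain R] (h : IsRegular a b c d) :
    R →ₗ[R] ((Ext R (ModuleCat.{0} R) 3).obj (op (ModuleCat.of R (R ⧸ ideal a b c d)))).obj
      (ModuleCat.of R R) :=
  (ExtTop.mk (resolution h) (ModuleCat.of R R) 3 (isZero_complex_X_four a b c d)).hom ∘ₗ
    { toFun := fun r => ModuleCat.ofHom (LinearMap.toSpanSingleton R R r)
      map_add' := fun r s => ModuleCat.hom_ext (by ext; simp)
      map_smul' := fun r s => ModuleCat.hom_ext (by ext; simp) }

lemma toExt_surjective [IsDomain R] (h : IsRegular a b c d) : Function.Surjective (toExt h) := by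
  refine (ExtTop.mk_surjective (resolution h) (ModuleCat.of R R) 3
    (isZero_complex_X_four a b c d)).comp fun g => ⟨g.hom (1 : R), ?_⟩
  exact ModuleCat.hom_ext (LinearMap.ext_ring (by simp))

lemma toExt_eq_zero_iff [IsDomain R] (h : IsRegular a b c d) (r : R) :
    toExt h r = 0 ↔ r ∈ Ideal.span {a, b, c, d} := by
  refine (ExtTop.mk_eq_zero_iff (resolution h) (ModuleCat.of R R) 2
    (isZero_complex_X_four a b c d) _).trans ?_
  rw [complex_d]
  constructor
  · rintro ⟨g, hg⟩
    have h1 : g.hom (b * 1, -(a * 1), -(d * 1), c * 1) = (1 : R) • r :=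
      congrArg (fun t => t.hom (1 : R)) hg
    have h2 : ((b * 1, -(a * 1), -(d * 1), c * 1) : R × R × R × R) =
        b • (1, 0, 0, 0) + (-a) • (0, 1, 0, 0) + (-d) • (0, 0, 1, 0) + c • (0, 0, 0, 1) := by
      simp
    rw [h2, map_add, map_add, map_add, map_smul, map_smul, map_smul, map_smul, one_smul] at h1
    rw [← h1]
    have hmem (x y : R) (hx : x ∈ ({a, b, c, d} : Set R)) :
        x • y ∈ Ideal.span ({a, b, c, d} : Set R) :=
      Ideal.mul_mem_right _ _ (Ideal.subset_span hx)
    refine add_mem (add_mem (add_mem (hmem _ _ ?_) ?_) ?_) (hmem _ _ ?_)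
    · simp
    · rw [neg_smul]; exact neg_mem (hmem _ _ (by simp))
    · rw [neg_smul]; exact neg_mem (hmem _ _ (by simp))
    · simp
  · intro hr
    simp only [Ideal.mem_span_insert, Ideal.mem_span_singleton'] at hr
    obtain ⟨w, _, ⟨x, _, ⟨y, _, ⟨z, rfl⟩, rfl⟩, rfl⟩, rfl⟩ := hr
    refine ⟨ModuleCat.ofHom ((LinearMap.lsmul R R x).coprod ((LinearMap.lsmul R R (-w)).coprod
      ((LinearMap.lsmul R R (-z)).coprod (LinearMap.lsmul R R y)))),
      ModuleCat.hom_ext (LinearMap.ext_ring ?_)⟩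
    simp [d₃]
    ring

lemma toExt_naturality [IsDomain R] {s t u v a' b' c' d' : R} (h : IsRegular a b c d)
    (h' : IsRegular a' b' c' d') (hle : ideal a' b' c' d' ≤ ideal a b c d)
    (ha : a' = a * s) (hb : b' = b * t) (hc : c' = c * u) (hd : d' = d * v) (r : R) :
    (((Ext R (ModuleCat.{0} R) 3).map (ModuleCat.ofHom
      (Submodule.mapQ (ideal a' b' c' d') (ideal a b c d) LinearMap.id hle)).op).app _)
        (toExt h r) = toExt h' (s * t * u * v * r) := by
  subst ha hb hc hd
  refine (ExtTop.mk_naturality (resolution h') (resolution h) _ 3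
    (isZero_complex_X_four _ _ _ _) (isZero_complex_X_four _ _ _ _) _
    (comparison a b c d s t u v) ?_ _).trans ?_
  · refine (Category.id_comp _).trans ((augmentation_f_zero _ _ _ _).trans ?_)
    refine Eq.trans ?_ (congrArg
      (· ≫ ModuleCat.ofHom (Submodule.mapQ _ (ideal a b c d) LinearMap.id hle))
      (augmentation_f_zero (a * s) (b * t) (c * u) (d * v))).symm
    exact ModuleCat.hom_ext (LinearMap.ext fun x => rfl)
  · refine congrArg (ExtTop.mk (resolution h') (ModuleCat.of R R) 3
      (isZero_complex_X_four _ _ _ _)) (ModuleCat.hom_ext (LinearMap.ext_ring ?_))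
    change (s * t * u * v * 1) • r = (1 : R) • (s * t * u * v * r)
    simp

end ProductResolution

namespace LocalCohomologyColimit

open CategoryTheory Limits Opposite

open localCohomology

variable {R : Type} [CommRing R] (I : Ideal R) {J : ℕ → Ideal R} (hJ : Antitone J)
  (hI : ∀ n, I ≤ (J n).radical)

/-- A decreasing sequence of ideals whose radicals contain `I`, as a diagram. -/
def sequence : ℕᵒᵖ ⥤ SelfLERadical I :=
  ObjectProperty.lift _
    { obj := fun n => J (unop n)
      map := fun w => homOfLE (hJ (leOfHom w.unop)) } fun n => hI (unop n)

lemma sequence_initial (h : ∀ K : Ideal R, I ≤ K.radical → ∃ n, J n ≤ K) :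
    (sequence I hJ hI).Initial where
  out K := by
    apply +allowSynthFailures zigzag_isConnected
    · obtain ⟨n, hn⟩ := h K.1 K.2
      exact ⟨CostructuredArrow.mk (⟨⟨⟨hn⟩⟩⟩ : (sequence I hJ hI).obj (op n) ⟶ K)⟩
    · intro j₁ j₂
      apply Relation.ReflTransGen.single
      rcases le_total (unop j₁.left) (unop j₂.left) with h | h
      · right; exact ⟨CostructuredArrow.homMk (homOfLE h).op rfl⟩
      · left; exact ⟨CostructuredArrow.homMk (homOfLE h).op rfl⟩

/-- Local cohomology as the colimit of `Ext` along a cofinal sequence of ideals: to identify it with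
`H` it suffices to give a compatible, jointly surjective family of injections. -/
theorem nonempty_linearEquiv [IsNoetherianRing R] (hJ : Antitone J)
    (hI : ∀ n, I ≤ (J n).radical) (h : ∀ K : Ideal R, I ≤ K.radical → ∃ n, J n ≤ K) (i : ℕ)
    (M : ModuleCat.{0} R) (H : Type) [AddCommGroup H] [Module R H]
    (c : ∀ n, ((Ext R (ModuleCat.{0} R) i).obj (op (ModuleCat.of R (R ⧸ J n)))).obj M →ₗ[R] H)
    (hc : ∀ m n (hmn : n ≤ m) x, c m ((((Ext R (ModuleCat.{0} R) i).map (ModuleCat.ofHom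
      (Submodule.mapQ (J m) (J n) LinearMap.id (hJ hmn))).op).app M) x) = c n x)
    (hinj : ∀ n, Function.Injective (c n)) (hsurj : ∀ y, ∃ n x, c n x = y) :
    Nonempty ((localCohomology I i).obj M ≃ₗ[R] H) := by
  have := sequence_initial I hJ hI h
  let D := sequence I hJ hI ⋙ selfLERadicalDiagram I
  let F := diagram D i
  let G : ℕᵒᵖᵒᵖ ⥤ ModuleCat.{0} R := F ⋙ (evaluation _ _).obj M
  let s : Cocone G :=
    { pt := ModuleCat.of R H
      ι :=
        { app := fun n => ModuleCat.ofHom (c n.unop.unop)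
          naturality := fun n m f => by
            refine ModuleCat.hom_ext (LinearMap.ext fun x => ?_)
            exact hc _ _ (leOfHom f.unop.unop) x } }
  have hdesc (n : ℕᵒᵖᵒᵖ) (z : G.obj n) : colimit.desc G s (colimit.ι G n z) = c n.unop.unop z :=
    congrArg (fun f => f.hom z) (colimit.ι_desc s n)
  have hbij : Function.Bijective (colimit.desc G s) := by
    constructor
    · rw [injective_iff_map_eq_zero]
      intro x hx
      obtain ⟨n, z, rfl⟩ := Concrete.colimit_exists_rep G x
      have h1 : c n.unop.unop z = 0 := (hdesc n z).symm.trans hx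
      have h2 : z = 0 := (map_eq_zero_iff _ (hinj n.unop.unop)).1 h1
      exact (congrArg _ h2).trans (map_zero (colimit.ι G n).hom)
    · intro z
      obtain ⟨n, x, rfl⟩ := hsurj z
      exact ⟨colimit.ι G (op (op n)) x, hdesc (op (op n)) x⟩
  let e₁ : (localCohomology I i).obj M ≅ (ofDiagram D i).obj M :=
    ((isoOfFinal (sequence I hJ hI) (selfLERadicalDiagram I) i ≪≫ isoSelfLERadical I i).app M).symm
  let e₂ : (ofDiagram D i).obj M ≅ colimit G := colimitObjIsoColimitCompEvaluation F M
  exact ⟨(e₁ ≪≫ e₂).toLinearEquiv.trans (LinearEquiv.ofBijective (colimit.desc G s).hom hbij)⟩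

end LocalCohomologyColimit

namespace MvPowerSeries

section XPow

variable {σ k : Type*} [CommRing k]

lemma coeff_eq_zero_of_mem_span_X_pow {S : Set σ} {N : ℕ} {f : MvPowerSeries σ k}
    (hf : f ∈ Ideal.span ((fun i => (X i : MvPowerSeries σ k) ^ N) '' S)) (e : σ →₀ ℕ)
    (he : ∀ i ∈ S, e i < N) : coeff e f = 0 := by
  classical
  induction hf using Submodule.span_induction generalizing e with
  | mem x hx =>
    obtain ⟨i, hi, rfl⟩ := hx
    exact X_pow_dvd_iff.1 dvd_rfl e (he i hi)
  | zero => simp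
  | add x y _ _ hx hy => rw [map_add, hx e he, hy e he, add_zero]
  | smul a x _ hx =>
    rw [smul_eq_mul, coeff_mul]
    refine Finset.sum_eq_zero fun p hp => ?_
    rw [hx p.2 fun i hi => ?_, mul_zero]
    have := DFunLike.congr_fun (Finset.HasAntidiagonal.mem_antidiagonal.1 hp) i
    simp only [Finsupp.add_apply] at this
    have := he i hi
    omega

lemma mem_span_X_pow_of_coeff_eq_zero (S : Finset σ) (N : ℕ) (f : MvPowerSeries σ k)
    (hf : ∀ e : σ →₀ ℕ, (∀ i ∈ S, e i < N) → coeff e f = 0) :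
    f ∈ Ideal.span ((fun i => (X i : MvPowerSeries σ k) ^ N) '' S) := by
  classical
  induction S using Finset.induction_on generalizing f with
  | empty =>
    have : f = 0 := ext fun e => by simpa using hf e
    simp [this]
  | insert i S _ ih =>
    let g : MvPowerSeries σ k := fun e => if e i < N then coeff e f else 0
    have hg (e : σ →₀ ℕ) : coeff e g = if e i < N then coeff e f else 0 := rfl
    rw [← sub_add_cancel f g]
    refine add_mem ?_ (Ideal.span_mono (Set.image_mono (by simp)) (ih g fun e he => ?_))
    · refine Ideal.mem_of_dvd _ (X_pow_dvd_iff.2 fun e he => ?_)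
        (Ideal.subset_span ⟨i, by simp, rfl⟩)
      rw [map_sub, hg, if_pos he, sub_self]
    · rw [hg]
      split_ifs with h
      · exact hf e (by simpa [h] using he)
      · rfl

lemma mem_span_X_pow_iff (S : Finset σ) (N : ℕ) (f : MvPowerSeries σ k) :
    f ∈ Ideal.span ((fun i => (X i : MvPowerSeries σ k) ^ N) '' S) ↔
      ∀ e : σ →₀ ℕ, (∀ i ∈ S, e i < N) → coeff e f = 0 :=
  ⟨fun h e he => coeff_eq_zero_of_mem_span_X_pow h e he, mem_span_X_pow_of_coeff_eq_zero S N f⟩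

lemma coeff_add_single_X_pow_mul (i : σ) (N : ℕ) (e : σ →₀ ℕ) (f : MvPowerSeries σ k) :
    coeff (e + Finsupp.single i N) (X i ^ N * f) = coeff e f := by
  rw [X_pow_eq, add_comm e, coeff_add_monomial_mul, one_mul]

lemma X_pow_dvd_of_dvd_X_pow_mul {i j : σ} (hij : i ≠ j) {M N : ℕ} {f : MvPowerSeries σ k}
    (h : X i ^ N ∣ X j ^ M * f) : X i ^ N ∣ f := by
  rw [X_pow_dvd_iff] at h ⊢
  intro e he
  rw [← coeff_add_single_X_pow_mul j M]
  exact h _ (by simpa [Finsupp.single_apply, hij.symm] using he)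

lemma mem_span_X_pow_of_X_pow_mul_mem {S : Finset σ} {j : σ} (hj : j ∉ S) {M N : ℕ}
    {f : MvPowerSeries σ k}
    (h : X j ^ M * f ∈ Ideal.span ((fun i => (X i : MvPowerSeries σ k) ^ N) '' S)) :
    f ∈ Ideal.span ((fun i => (X i : MvPowerSeries σ k) ^ N) '' S) := by
  rw [mem_span_X_pow_iff] at h ⊢
  intro e he
  rw [← coeff_add_single_X_pow_mul j M]
  refine h _ fun i hi => ?_
  have : j ≠ i := fun h => hj (h ▸ hi)
  simpa [Finsupp.single_apply, this] using he i hi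

end XPow

lemma X_ne_zero {σ k : Type*} [CommRing k] [Nontrivial k] (i : σ) :
    (X i : MvPowerSeries σ k) ≠ 0 := by
  classical
  intro h
  simpa [coeff_X] using congrArg (coeff (Finsupp.single i 1)) h

lemma exists_of_X_pow_relation {σ k : Type*} [Field k] {i j : σ} (hij : i ≠ j) {N : ℕ}
    {u v : MvPowerSeries σ k} (h : X i ^ N * u + X j ^ N * v = 0) :
    ∃ s, u = X j ^ N * s ∧ v = -(X i ^ N * s) := by
  obtain ⟨s, rfl⟩ : X j ^ N ∣ u :=
    X_pow_dvd_of_dvd_X_pow_mul hij.symm (M := N) (i := j) (j := i)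
      ⟨-v, by linear_combination h⟩
  refine ⟨s, rfl, ?_⟩
  have h1 : X j ^ N * (v + X i ^ N * s) = 0 := by linear_combination h
  have h2 : (X j : MvPowerSeries σ k) ^ N ≠ 0 := pow_ne_zero _ (X_ne_zero j)
  linear_combination (mul_eq_zero.1 h1).resolve_left h2

lemma isRegular_X_pow (k : Type) [Field k] (N : ℕ) :
    ProductResolution.IsRegular (X 0 ^ N : MvPowerSeries (Fin 4) k) (X 1 ^ N) (X 2 ^ N)
      (X 3 ^ N) where
  left_ne_zero := pow_ne_zero _ (X_ne_zero _)
  right_ne_zero := pow_ne_zero _ (X_ne_zero _)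
  left _ _ h := exists_of_X_pow_relation (by decide) h
  right _ _ h := exists_of_X_pow_relation (by decide) h
  mixed _ _ h := exists_of_X_pow_relation (by decide) h
  mem s h := by
    have e : ({X 2 ^ N, X 3 ^ N} : Set (MvPowerSeries (Fin 4) k)) =
        (fun i => X i ^ N) '' (({2, 3} : Finset (Fin 4)) : Set (Fin 4)) := by
      simp [Set.image_insert_eq]
    rw [e] at h ⊢
    exact mem_span_X_pow_of_X_pow_mul_mem (by decide) h

end MvPowerSeries

namespace MvPowerSeries

/-- The `k`-linear dual of the power series ring. -/
def LinearDual (σ k : Type) [Field k] : Type := MvPowerSeries σ k →ₗ[k] k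

namespace LinearDual

variable {σ k : Type} [Field k]

noncomputable instance : AddCommGroup (LinearDual σ k) :=
  inferInstanceAs (AddCommGroup (MvPowerSeries σ k →ₗ[k] k))

instance : FunLike (LinearDual σ k) (MvPowerSeries σ k) k :=
  inferInstanceAs (FunLike (MvPowerSeries σ k →ₗ[k] k) _ _)

instance : LinearMapClass (LinearDual σ k) k (MvPowerSeries σ k) k :=
  inferInstanceAs (LinearMapClass (MvPowerSeries σ k →ₗ[k] k) k _ _)

@[ext]
lemma ext {φ ψ : LinearDual σ k} (h : ∀ s, φ s = ψ s) : φ = ψ := DFunLike.ext _ _ h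

@[simp]
lemma add_apply (φ ψ : LinearDual σ k) (s : MvPowerSeries σ k) : (φ + ψ) s = φ s + ψ s := rfl

@[simp]
lemma zero_apply (s : MvPowerSeries σ k) : (0 : LinearDual σ k) s = 0 := rfl

noncomputable instance : SMul (MvPowerSeries σ k) (LinearDual σ k) where
  smul r φ := LinearMap.comp (φ : MvPowerSeries σ k →ₗ[k] k) (LinearMap.mulLeft k r)

@[simp]
lemma smul_apply (r : MvPowerSeries σ k) (φ : LinearDual σ k) (s : MvPowerSeries σ k) :
    (r • φ) s = φ (r * s) := rfl

noncomputable instance : Module (MvPowerSeries σ k) (LinearDual σ k) where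
  one_smul φ := by ext; simp
  mul_smul r s φ := by ext t; simp [mul_left_comm, mul_assoc]
  smul_zero r := by ext; simp
  smul_add r φ ψ := by ext; simp
  add_smul r s φ := by ext; simp [add_mul]
  zero_smul φ := by ext; simp

end LinearDual

variable {σ k : Type} [Field k]

variable (σ k) in
/-- The ideal generated by the `N`-th powers of the variables. -/
noncomputable abbrev boxIdeal (N : ℕ) : Ideal (MvPowerSeries σ k) :=
  Ideal.span (Set.range fun i => X i ^ N)

lemma mem_boxIdeal_iff [Fintype σ] (N : ℕ) (f : MvPowerSeries σ k) :
    f ∈ boxIdeal σ k N ↔ ∀ e : σ →₀ ℕ, (∀ i, e i < N) → coeff e f = 0 := by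
  simpa using mem_span_X_pow_iff (k := k) (Finset.univ : Finset σ) N f

lemma boxIdeal_antitone : Antitone (boxIdeal σ k) := fun m n hmn => by
  refine Ideal.span_le.2 ?_
  rintro _ ⟨i, rfl⟩
  exact Ideal.mem_of_dvd _ (pow_dvd_pow _ hmn) (Ideal.subset_span ⟨i, rfl⟩)

variable (σ k) in
/-- The linear forms on the power series ring vanishing on a power of the maximal ideal. -/
def inverseSystem : Submodule (MvPowerSeries σ k) (LinearDual σ k) where
  carrier := {φ | ∃ N, ∀ r ∈ boxIdeal σ k N, φ r = 0}
  add_mem' := by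
    rintro φ ψ ⟨M, hM⟩ ⟨N, hN⟩
    refine ⟨max M N, fun r hr => ?_⟩
    rw [LinearDual.add_apply, hM r (boxIdeal_antitone (le_max_left _ _) hr),
      hN r (boxIdeal_antitone (le_max_right _ _) hr), add_zero]
  zero_mem' := ⟨0, fun _ _ => rfl⟩
  smul_mem' := by
    rintro r φ ⟨N, hN⟩
    exact ⟨N, fun s hs => hN _ (Ideal.mul_mem_left _ _ hs)⟩

lemma coeff_mul_monomial_sub (r : MvPowerSeries σ k) {d e : σ →₀ ℕ} (h : e ≤ d) :
    coeff d (r * monomial (d - e) 1) = coeff e r := by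
  conv_lhs => rw [← add_tsub_cancel_of_le h]
  rw [add_tsub_cancel_left, coeff_add_mul_monomial, mul_one]

lemma inverseSystem.ext {φ ψ : inverseSystem σ k} (h : ∀ s, φ.1 s = ψ.1 s) : φ = ψ :=
  Subtype.ext (LinearDual.ext h)

variable [Fintype σ]

variable (σ) in
/-- The exponent all of whose entries are `n`. -/
noncomputable def constExponent (n : ℕ) : σ →₀ ℕ := Finsupp.equivFunOnFinite.symm fun _ => n

@[simp]
lemma constExponent_apply (n : ℕ) (i : σ) : constExponent σ n i = n := rfl

lemma le_constExponent_iff (e : σ →₀ ℕ) (n : ℕ) : e ≤ constExponent σ n ↔ ∀ i, e i < n + 1 := by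
  simp [Finsupp.le_def]

namespace inverseSystem

/-- The coefficient of the monomial with all exponents equal to `n`. -/
noncomputable def coeffConst (n : ℕ) : inverseSystem σ k :=
  ⟨(coeff (constExponent σ n) : MvPowerSeries σ k →ₗ[k] k), n + 1, fun _ hr =>
    (mem_boxIdeal_iff _ _).1 hr _ ((le_constExponent_iff _ _).1 le_rfl)⟩

lemma coeffConst_apply (n : ℕ) (s : MvPowerSeries σ k) :
    (coeffConst n : inverseSystem σ k).1 s = coeff (constExponent σ n) s := rfl

lemma smul_coeffConst_apply (r : MvPowerSeries σ k) (n : ℕ) (s : MvPowerSeries σ k) :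
    (r • (coeffConst n : inverseSystem σ k)).1 s = coeff (constExponent σ n) (r * s) := rfl

lemma smul_coeffConst_eq_zero_iff (r : MvPowerSeries σ k) (n : ℕ) :
    r • (coeffConst n : inverseSystem σ k) = 0 ↔ r ∈ boxIdeal σ k (n + 1) := by
  constructor
  · intro h
    rw [mem_boxIdeal_iff]
    intro e he
    rw [← coeff_mul_monomial_sub r ((le_constExponent_iff e n).2 he), ← smul_coeffConst_apply, h]
    rfl
  · intro h
    refine ext fun s => ?_
    rw [smul_coeffConst_apply]
    exact (mem_boxIdeal_iff _ _).1 (Ideal.mul_mem_right s _ h) _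
      ((le_constExponent_iff _ _).1 le_rfl)

lemma monomial_smul_coeffConst {m n : ℕ} (h : n ≤ m) :
    monomial (constExponent σ (m - n)) (1 : k) • (coeffConst m : inverseSystem σ k) =
      coeffConst n := by
  refine ext fun s => ?_
  have : constExponent σ m = constExponent σ (m - n) + constExponent σ n := by
    ext i; simp; omega
  rw [smul_coeffConst_apply, coeffConst_apply, this, coeff_add_monomial_mul, one_mul]

lemma exists_smul_coeffConst (φ : inverseSystem σ k) :
    ∃ (n : ℕ) (r : MvPowerSeries σ k), r • coeffConst n = φ := by
  classical
  obtain ⟨φ, N, hφ⟩ := φ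
  have hφ : ∀ r ∈ boxIdeal σ k (N + 1), φ r = 0 := fun r hr =>
    hφ r (boxIdeal_antitone N.le_succ hr)
  let d := constExponent σ N
  let r : MvPowerSeries σ k := fun e => φ (monomial (d - e) 1)
  refine ⟨N, r, ext fun s => ?_⟩
  rw [smul_coeffConst_apply]
  change coeff d (r * s) = φ s
  let t : MvPowerSeries σ k := ∑ e ∈ Finset.Iic d, coeff e s • monomial e 1
  have hst : s - t ∈ boxIdeal σ k (N + 1) := by
    rw [mem_boxIdeal_iff]
    intro e he
    have : e ∈ Finset.Iic d := Finset.mem_Iic.2 ((le_constExponent_iff e N).2 he)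
    simp only [t, map_sub, map_sum, map_smul, coeff_monomial, smul_eq_mul, mul_ite, mul_one,
      mul_zero, Finset.sum_ite_eq, if_pos this, sub_self]
  have h1 : φ s = φ t := by
    rw [← sub_eq_zero, ← map_sub]; exact hφ _ hst
  have h2 : coeff d (r * s) = coeff d (r * t) := by
    rw [← sub_eq_zero, ← map_sub, ← mul_sub]
    exact (mem_boxIdeal_iff _ _).1 (Ideal.mul_mem_left _ r hst) _
      ((le_constExponent_iff _ _).1 le_rfl)
  rw [h1, h2]
  simp only [t, Finset.mul_sum, map_sum, map_smul, mul_smul_comm]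
  refine Finset.sum_congr rfl fun e he => ?_
  congr 1
  have he := Finset.mem_Iic.1 he
  rw [← tsub_tsub_cancel_of_le he, coeff_mul_monomial_sub r tsub_le_self]
  rfl

lemma smul_eq_zero (r : MvPowerSeries σ k) (h : ∀ φ : inverseSystem σ k, r • φ = 0) : r = 0 := by
  refine MvPowerSeries.ext fun e => ?_
  obtain ⟨n, hn⟩ : ∃ n, ∀ i, e i < n + 1 :=
    ⟨∑ i, e i, fun i => Nat.lt_succ_of_le (Finset.single_le_sum (by simp) (Finset.mem_univ i))⟩
  exact (mem_boxIdeal_iff _ _).1 ((smul_coeffConst_eq_zero_iff r n).1 (h _)) e hn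

lemma coeffConst_zero_apply (s : MvPowerSeries σ k) :
    (coeffConst 0 : inverseSystem σ k).1 s = constantCoeff s := by
  have h : constExponent σ 0 = 0 := Finsupp.ext fun _ => rfl
  rw [coeffConst_apply, ← coeff_zero_eq_constantCoeff_apply, h]

/-- The constant coefficient lies in every nonzero submodule. -/
lemma coeffConst_zero_mem {N : Submodule (MvPowerSeries σ k) (inverseSystem σ k)} (hN : N ≠ ⊥) :
    coeffConst 0 ∈ N := by
  classical
  obtain ⟨ψ, hψ, h0⟩ := Submodule.exists_mem_ne_zero_of_ne_bot hN
  obtain ⟨n, r, rfl⟩ := exists_smul_coeffConst ψ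
  let S : Set (σ →₀ ℕ) := {e | e ≤ constExponent σ n ∧ coeff e r ≠ 0}
  have hS : S.Nonempty := by
    by_contra hS
    rw [Set.not_nonempty_iff_eq_empty] at hS
    refine h0 ((smul_coeffConst_eq_zero_iff r n).2 ((mem_boxIdeal_iff _ _).2 fun e he => ?_))
    by_contra h
    exact hS.subset ⟨(le_constExponent_iff e n).2 he, h⟩
  obtain ⟨e, ⟨he, hr⟩, hmin⟩ := WellFounded.has_min (wellFounded_lt (α := σ →₀ ℕ)) S hS
  have key : (C (coeff e r)⁻¹ * monomial (constExponent σ n - e) (1 : k)) •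
      r • (coeffConst n : inverseSystem σ k) = coeffConst 0 := by
    refine ext fun s => ?_
    rw [smul_smul, smul_coeffConst_apply, coeffConst_zero_apply, mul_assoc, mul_assoc, coeff_C_mul,
      mul_left_comm, ← coeff_zero_eq_constantCoeff_apply, mul_comm, mul_comm (monomial _ _),
      ← mul_assoc, coeff_mul_monomial_sub _ he, coeff_mul, Finset.sum_eq_single (e, 0)]
    · field_simp
    · rintro ⟨p, q⟩ hpq hne
      rw [Finset.HasAntidiagonal.mem_antidiagonal] at hpq
      simp only at hpq ⊢
      have hpe : p ≤ e := hpq ▸ le_self_add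
      have hlt : p < e := lt_of_le_of_ne hpe fun h => hne (by subst h; simpa using hpq)
      have : coeff p r = 0 := by
        by_contra h
        exact hmin p ⟨hpe.trans he, h⟩ hlt
      rw [this, zero_mul]
    · simp
  rw [← key]
  exact N.smul_mem _ hψ

end inverseSystem

end MvPowerSeries

namespace MvPowerSeries

/-- If `x` kills the nonzero submodule `S` and every nonzero submodule of `E` meets `S`, then every
element of `E` is killed by a power of `x`. -/
lemma exists_pow_smul_eq_zero {R E : Type*} [CommRing R] [IsNoetherianRing R] [AddCommGroup E]
    [Module R E] (S : Submodule R E) (hS : ∀ N : Submodule R E, N ≠ ⊥ → N ⊓ S ≠ ⊥) (x : R)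
    (hx : ∀ s ∈ S, x • s = 0) (e : E) : ∃ N : ℕ, x ^ N • e = 0 := by
  let a : ℕ →o Ideal R :=
    { toFun := fun n => LinearMap.ker (LinearMap.toSpanSingleton R E (x ^ n • e))
      monotone' := monotone_nat_of_le_succ fun n r hr => by
        simp only [LinearMap.mem_ker, LinearMap.toSpanSingleton_apply] at hr ⊢
        rw [pow_succ', mul_smul, smul_comm, hr, smul_zero] }
  obtain ⟨N, hN⟩ := monotone_stabilizes_iff_noetherian.2 ‹IsNoetherianRing R› a
  refine ⟨N, ?_⟩
  by_contra h
  obtain ⟨s, ⟨hs, hsS⟩, hs0⟩ := Submodule.exists_mem_ne_zero_of_ne_bot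
    (hS (Submodule.span R {x ^ N • e}) (by simpa using h))
  obtain ⟨r, rfl⟩ := Submodule.mem_span_singleton.1 hs
  have h1 : r ∈ a (N + 1) := by
    change r • x ^ (N + 1) • e = 0
    rw [pow_succ', mul_smul, smul_comm]
    exact hx _ hsS
  rw [← hN (N + 1) N.le_succ] at h1
  exact hs0 h1

variable {σ k : Type} [Field k]

lemma X_mem_maximalIdeal (i : σ) : X i ∈ maximalIdeal (MvPowerSeries σ k) := by
  rw [mem_maximalIdeal, mem_nonunits_iff, isUnit_iff_constantCoeff]
  simp

variable [Finite σ] {E : Type} [AddCommGroup E] [Module (MvPowerSeries σ k) E]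

lemma exists_socle_generator (hE : IsInjectiveHullOfResidueField (MvPowerSeries σ k) E) :
    ∃ e : E, e ≠ 0 ∧ (∀ N : Submodule (MvPowerSeries σ k) E, N ≠ ⊥ → e ∈ N) ∧
      ∀ z : E, ∃ N, ∀ r ∈ boxIdeal σ k N, r • z = 0 := by
  obtain ⟨-, f, hf, hN⟩ := hE
  have hkill (r : MvPowerSeries σ k) (hr : r ∈ maximalIdeal _) (s) (hs : s ∈ LinearMap.range f) :
      r • s = 0 := by
    obtain ⟨a, rfl⟩ := hs
    have : r • a = 0 := by
      rw [Algebra.smul_def, ResidueField.algebraMap_eq, (residue_eq_zero_iff r).2 hr, zero_mul]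
    rw [← map_smul, this, map_zero]
  refine ⟨f 1, (map_ne_zero_iff f hf).2 one_ne_zero, fun N h => ?_, fun z => ?_⟩
  · obtain ⟨s, ⟨hs, a, rfl⟩, hs0⟩ := Submodule.exists_mem_ne_zero_of_ne_bot (hN N h)
    have ha : a ≠ 0 := fun h => hs0 (by rw [h, map_zero])
    obtain ⟨b, hb⟩ := residue_surjective a⁻¹
    have h1 : b • a = 1 := by
      rw [Algebra.smul_def, ResidueField.algebraMap_eq, hb, inv_mul_cancel₀ ha]
    rw [← h1, map_smul]
    exact N.smul_mem b hs
  · choose n hn using fun i : σ => exists_pow_smul_eq_zero (LinearMap.range f) hN (X i)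
      (hkill _ (X_mem_maximalIdeal i)) z
    have := Fintype.ofFinite σ
    refine ⟨∑ i, n i, fun r hr => ?_⟩
    have hle : boxIdeal σ k (∑ i, n i) ≤
        LinearMap.ker (LinearMap.toSpanSingleton (MvPowerSeries σ k) E z) := by
      refine Ideal.span_le.2 ?_
      rintro _ ⟨i, rfl⟩
      have h : n i ≤ ∑ i, n i := Finset.single_le_sum (by simp) (Finset.mem_univ i)
      have hz : (X i : MvPowerSeries σ k) ^ (∑ i, n i) • z = 0 := by
        rw [← Nat.sub_add_cancel h, pow_add, mul_smul, hn, smul_zero]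
      exact hz
    exact hle hr

theorem nonempty_linearEquiv_inverseSystem
    (hE : IsInjectiveHullOfResidueField (MvPowerSeries σ k) E) :
    Nonempty (inverseSystem σ k ≃ₗ[MvPowerSeries σ k] E) := by
  have := Fintype.ofFinite σ
  obtain ⟨e₀, he₀, hmem, hnil⟩ := exists_socle_generator hE
  let _ : Module k E := Module.compHom E (algebraMap k (MvPowerSeries σ k))
  have : IsScalarTower k (MvPowerSeries σ k) E := IsScalarTower.of_algebraMap_smul fun _ _ => rfl
  obtain ⟨π, hπ⟩ := Module.Projective.exists_dual_eq_one k he₀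
  let Ψ : E →ₗ[MvPowerSeries σ k] inverseSystem σ k :=
    { toFun := fun e => ⟨π ∘ₗ (LinearMap.toSpanSingleton (MvPowerSeries σ k) E e).restrictScalars k,
        (hnil e).imp fun N h r hr => (congrArg π (h r hr)).trans (map_zero π)⟩
      map_add' := fun e e' => inverseSystem.ext fun s =>
        (congrArg π (smul_add s e e')).trans (map_add π _ _)
      map_smul' := fun r e => inverseSystem.ext fun s =>
        congrArg π ((smul_smul s r e).trans (by rw [mul_comm]; rfl)) }
  have hΨ : Function.Injective Ψ := by
    rw [← LinearMap.ker_eq_bot]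
    by_contra h
    have h1 : (Ψ e₀).1 1 = 0 := by rw [LinearMap.mem_ker.1 (hmem _ h)]; rfl
    have h2 : (Ψ e₀).1 1 = 1 := (congrArg π (one_smul _ e₀)).trans hπ
    exact one_ne_zero (h2.symm.trans h1)
  obtain ⟨h, hh⟩ := hE.1.out Ψ hΨ LinearMap.id
  have hinj : Function.Injective h := by
    rw [← LinearMap.ker_eq_bot]
    by_contra hker
    have hrange : LinearMap.range Ψ ≠ ⊥ := fun hr =>
      he₀ (hΨ ((LinearMap.congr_fun (LinearMap.range_eq_bot.1 hr) e₀).trans (map_zero Ψ).symm))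
    obtain ⟨e, he⟩ := inverseSystem.coeffConst_zero_mem hrange
    have h1 : e = 0 := by
      rw [← LinearMap.id_apply (R := MvPowerSeries σ k) e, ← hh e, he]
      exact inverseSystem.coeffConst_zero_mem hker
    have h2 : (inverseSystem.coeffConst 0 : inverseSystem σ k).1 1 = 1 := by
      rw [inverseSystem.coeffConst_zero_apply, map_one]
    rw [← he, h1, map_zero] at h2
    exact zero_ne_one h2
  exact ⟨LinearEquiv.ofBijective h ⟨hinj, fun e => ⟨Ψ e, hh e⟩⟩⟩

end MvPowerSeries

namespace MvPowerSeries

section Variables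

variable {σ k : Type*} [Field k]

lemma mem_span_X_iff (S : Finset σ) (f : MvPowerSeries σ k) :
    f ∈ Ideal.span ((fun i => (X i : MvPowerSeries σ k)) '' S) ↔
      ∀ e : σ →₀ ℕ, (∀ i ∈ S, e i = 0) → coeff e f = 0 := by
  simpa using mem_span_X_pow_iff S 1 f

lemma exists_sub_mem_span_X (S : Finset σ) (f : MvPowerSeries σ k) :
    ∃ g : MvPowerSeries σ k, f - g ∈ Ideal.span ((fun i => (X i : MvPowerSeries σ k)) '' S) ∧
      ∀ e : σ →₀ ℕ, (¬ ∀ i ∈ S, e i = 0) → coeff e g = 0 := by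
  classical
  let g : MvPowerSeries σ k := fun e => if ∀ i ∈ S, e i = 0 then coeff e f else 0
  have hg (e : σ →₀ ℕ) : coeff e g = if ∀ i ∈ S, e i = 0 then coeff e f else 0 := rfl
  refine ⟨g, (mem_span_X_iff S _).2 fun e he => ?_, fun e he => ?_⟩
  · rw [map_sub, hg, if_pos he, sub_self]
  · rw [hg, if_neg he]

lemma eq_zero_of_mem_span_X {S : Finset σ} {f : MvPowerSeries σ k}
    (hf : f ∈ Ideal.span ((fun i => (X i : MvPowerSeries σ k)) '' S))
    (h : ∀ e : σ →₀ ℕ, (¬ ∀ i ∈ S, e i = 0) → coeff e f = 0) : f = 0 :=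
  MvPowerSeries.ext fun e => by
    by_cases he : ∀ i ∈ S, e i = 0
    · exact (mem_span_X_iff S f).1 hf e he
    · exact h e he

lemma X_mem_span_X_iff (S : Finset σ) (i : σ) :
    (X i : MvPowerSeries σ k) ∈ Ideal.span ((fun i => (X i : MvPowerSeries σ k)) '' S) ↔
      i ∈ S := by
  classical
  refine ⟨fun h => ?_, fun h => Ideal.subset_span ⟨i, h, rfl⟩⟩
  by_contra hi
  have := (mem_span_X_iff S _).1 h (Finsupp.single i 1) fun j hj => by
    rw [Finsupp.single_eq_of_ne]
    exact fun h => hi (h ▸ hj)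
  simp [coeff_X] at this

instance isPrime_span_X (S : Finset σ) :
    (Ideal.span ((fun i => (X i : MvPowerSeries σ k)) '' S)).IsPrime := by
  classical
  set P := Ideal.span ((fun i => (X i : MvPowerSeries σ k)) '' S)
  refine ⟨fun h => ?_, fun {f g} hfg => ?_⟩
  · have := (mem_span_X_iff S _).1 (h ▸ Submodule.mem_top : (1 : MvPowerSeries σ k) ∈ P) 0 (by simp)
    simp at this
  · obtain ⟨f', hf, hf'⟩ := exists_sub_mem_span_X S f
    obtain ⟨g', hg, hg'⟩ := exists_sub_mem_span_X S g
    have h1 : f' * g' ∈ P := by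
      have : f' * g' = f * g - ((f - f') * g + f' * (g - g')) := by ring
      rw [this]
      exact sub_mem hfg (add_mem (P.mul_mem_right _ hf) (P.mul_mem_left _ hg))
    have h2 : f' * g' = 0 := by
      refine eq_zero_of_mem_span_X h1 fun e he => ?_
      rw [coeff_mul]
      refine Finset.sum_eq_zero fun p hp => ?_
      rw [← Finset.HasAntidiagonal.mem_antidiagonal.1 hp] at he
      by_cases hp1 : ∀ i ∈ S, p.1 i = 0
      · rw [hg' p.2 fun hp2 => he fun i hi => by simp [hp1 i hi, hp2 i hi], mul_zero]
      · rw [hf' p.1 hp1, zero_mul]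
    rcases mul_eq_zero.1 h2 with rfl | rfl
    · left; simpa using hf
    · right; simpa using hg

lemma card_le_height_span_X (S : Finset σ) :
    (S.card : ℕ∞) ≤ (Ideal.span ((fun i => (X i : MvPowerSeries σ k)) '' S)).height := by
  classical
  induction S using Finset.induction_on with
  | empty => simp
  | insert i S hi ih =>
    have hlt : Ideal.span ((fun i => (X i : MvPowerSeries σ k)) '' S) <
        Ideal.span ((fun i => (X i : MvPowerSeries σ k)) '' (insert i S : Finset σ)) := by
      refine SetLike.lt_iff_le_and_exists.2 ⟨Ideal.span_mono (Set.image_mono (by simp)), X i,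
        (X_mem_span_X_iff _ i).2 (by simp), fun h => hi ((X_mem_span_X_iff S i).1 h)⟩
    rw [Finset.card_insert_of_notMem hi, Nat.cast_add, Nat.cast_one]
    exact (add_le_add_left ih 1).trans (Ideal.height_add_one_le_of_lt_of_isPrime hlt)

lemma span_X_univ [Fintype σ] :
    Ideal.span ((fun i => (X i : MvPowerSeries σ k)) '' (Finset.univ : Finset σ)) =
      maximalIdeal (MvPowerSeries σ k) := by
  ext f
  rw [mem_span_X_iff, mem_maximalIdeal, mem_nonunits_iff, isUnit_iff_constantCoeff,
    isUnit_iff_ne_zero, not_not, ← coeff_zero_eq_constantCoeff_apply]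
  refine ⟨fun h => h 0 (by simp), fun h e he => ?_⟩
  have : e = 0 := Finsupp.ext fun i => he i (Finset.mem_univ i)
  rw [this, h]

lemma mem_minimalPrimes_of_le_radical {R : Type*} [CommRing R] [IsLocalRing R] {I : Ideal R}
    (hI : I ≤ maximalIdeal R) (h : maximalIdeal R ≤ I.radical) :
    maximalIdeal R ∈ I.minimalPrimes :=
  ⟨⟨inferInstance, hI⟩, fun _ hq _ => h.trans (hq.1.radical_le_iff.2 hq.2)⟩

lemma height_maximalIdeal (k : Type*) [Field k] :
    (maximalIdeal (MvPowerSeries (Fin 4) k)).height = 4 := by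
  apply le_antisymm
  · have h := Ideal.height_le_card_of_mem_minimalPrimes_span
      (s := (fun i => (X i : MvPowerSeries (Fin 4) k)) '' (Finset.univ : Finset (Fin 4)))
      (Set.toFinite _) (mem_minimalPrimes_of_le_radical span_X_univ.le
        (span_X_univ.ge.trans Ideal.le_radical))
    refine h.trans ?_
    exact_mod_cast (Set.ncard_image_le (Set.toFinite _)).trans (by simp)
  · rw [← span_X_univ]
    simpa using card_le_height_span_X (k := k) (Finset.univ : Finset (Fin 4))

end Variables

section FourVariables

open CategoryTheory Opposite

lemma _root_.LinearMap.exists_injective_factorization {R A B D : Type*} [CommRing R]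
    [AddCommGroup A] [AddCommGroup B] [AddCommGroup D] [Module R A] [Module R B] [Module R D]
    (f : A →ₗ[R] B) (hf : Function.Surjective f) (g : A →ₗ[R] D) (h : ∀ a, f a = 0 ↔ g a = 0) :
    ∃ c : B →ₗ[R] D, Function.Injective c ∧ ∀ a, c (f a) = g a := by
  have hker : LinearMap.ker f ≤ LinearMap.ker g := fun a ha => (h a).1 ha
  let c := (LinearMap.ker f).liftQ g hker ∘ₗ (f.quotKerEquivOfSurjective hf).symm.toLinearMap
  have hc (a : A) : c (f a) = g a := by
    have : (f.quotKerEquivOfSurjective hf).symm (f a) = Submodule.Quotient.mk a :=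
      (LinearEquiv.symm_apply_eq _).2 rfl
    simp [c, this]
  refine ⟨c, (injective_iff_map_eq_zero c).2 fun b hb => ?_, hc⟩
  obtain ⟨a, rfl⟩ := hf b
  exact (h a).2 ((hc a).symm.trans hb)

variable (k : Type) [Field k]

instance : IsDomain (MvPowerSeries (Fin 4) k) := NoZeroDivisors.to_isDomain _

/-- The ideal `(y₁, y₂)`. -/
noncomputable abbrev leftPlane : Ideal (MvPowerSeries (Fin 4) k) := Ideal.span {X 0, X 1}

/-- The ideal `(y₃, y₄)`. -/
noncomputable abbrev rightPlane : Ideal (MvPowerSeries (Fin 4) k) := Ideal.span {X 2, X 3}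

/-- The ideal `(y₁y₃, y₂y₄, y₁y₄ + y₂y₃)`. -/
noncomputable abbrev threeGenerated : Ideal (MvPowerSeries (Fin 4) k) :=
  Ideal.span {X 0 * X 2, X 1 * X 3, X 0 * X 3 + X 1 * X 2}

/-- The ideal `(y₁ ^ N, y₂ ^ N)(y₃ ^ N, y₄ ^ N)`. -/
noncomputable abbrev productIdeal (N : ℕ) : Ideal (MvPowerSeries (Fin 4) k) :=
  ProductResolution.ideal (X 0 ^ N) (X 1 ^ N) (X 2 ^ N) (X 3 ^ N)

instance : (leftPlane k).IsPrime := by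
  have h := isPrime_span_X (k := k) ({0, 1} : Finset (Fin 4))
  simpa [Set.image_insert_eq] using h

instance : (rightPlane k).IsPrime := by
  have h := isPrime_span_X (k := k) ({2, 3} : Finset (Fin 4))
  simpa [Set.image_insert_eq] using h

variable {k} in
lemma productIdeal_le_iff {N : ℕ} {K : Ideal (MvPowerSeries (Fin 4) k)} :
    productIdeal k N ≤ K ↔ (X 0 * X 2) ^ N ∈ K ∧ (X 0 * X 3) ^ N ∈ K ∧ (X 1 * X 2) ^ N ∈ K ∧
      (X 1 * X 3) ^ N ∈ K := by
  change Ideal.span {X 0 ^ N, X 1 ^ N} * Ideal.span {X 2 ^ N, X 3 ^ N} ≤ K ↔ _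
  rw [Ideal.span_pair_mul_span_pair, Ideal.span_le]
  simp [Set.insert_subset_iff, mul_pow]

lemma productIdeal_one : productIdeal k 1 = leftPlane k * rightPlane k := by
  change Ideal.span {X 0 ^ 1, X 1 ^ 1} * Ideal.span {X 2 ^ 1, X 3 ^ 1} = _
  simp only [pow_one]

lemma productIdeal_antitone : Antitone (productIdeal k) := fun M N h => by
  obtain ⟨h1, h2, h3, h4⟩ := productIdeal_le_iff.1 (le_refl (productIdeal k M))
  exact productIdeal_le_iff.2 ⟨Ideal.pow_mem_of_pow_mem _ h1 h, Ideal.pow_mem_of_pow_mem _ h2 h,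
    Ideal.pow_mem_of_pow_mem _ h3 h, Ideal.pow_mem_of_pow_mem _ h4 h⟩

lemma productIdeal_one_le_radical : productIdeal k 1 ≤ (threeGenerated k).radical := by
  have h1 : X 0 * X 2 ∈ threeGenerated k := Ideal.subset_span (by simp)
  have h2 : X 1 * X 3 ∈ threeGenerated k := Ideal.subset_span (by simp)
  have h3 : X 0 * X 3 + X 1 * X 2 ∈ threeGenerated k := Ideal.subset_span (by simp)
  rw [productIdeal_le_iff]
  simp only [pow_one]
  refine ⟨Ideal.le_radical h1, ⟨2, ?_⟩, ⟨2, ?_⟩, Ideal.le_radical h2⟩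
  · have : (X 0 * X 3 : MvPowerSeries (Fin 4) k) ^ 2 =
        X 0 * X 3 * (X 0 * X 3 + X 1 * X 2) - X 0 * X 2 * (X 1 * X 3) := by ring
    rw [this]
    exact sub_mem (Ideal.mul_mem_left _ _ h3) (Ideal.mul_mem_left _ _ h2)
  · have : (X 1 * X 2 : MvPowerSeries (Fin 4) k) ^ 2 =
        X 1 * X 2 * (X 0 * X 3 + X 1 * X 2) - X 0 * X 2 * (X 1 * X 3) := by ring
    rw [this]
    exact sub_mem (Ideal.mul_mem_left _ _ h3) (Ideal.mul_mem_left _ _ h2)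

lemma threeGenerated_le_radical_productIdeal (N : ℕ) :
    threeGenerated k ≤ (productIdeal k N).radical := by
  obtain ⟨h1, h2, h3, h4⟩ := productIdeal_le_iff.1 (le_refl (productIdeal k N))
  rw [Ideal.span_le]
  rintro _ (rfl | rfl | rfl)
  · exact ⟨N, h1⟩
  · exact ⟨N, h4⟩
  · exact add_mem ⟨N, h2⟩ ⟨N, h3⟩

lemma threeGenerated_le_leftPlane : threeGenerated k ≤ leftPlane k := by
  have h0 : X 0 ∈ leftPlane k := Ideal.subset_span (by simp)
  have h1 : X 1 ∈ leftPlane k := Ideal.subset_span (by simp)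
  rw [Ideal.span_le]
  rintro _ (rfl | rfl | rfl)
  · exact Ideal.mul_mem_right _ _ h0
  · exact Ideal.mul_mem_right _ _ h1
  · exact add_mem (Ideal.mul_mem_right _ _ h0) (Ideal.mul_mem_right _ _ h1)

lemma threeGenerated_le_rightPlane : threeGenerated k ≤ rightPlane k := by
  have h2 : X 2 ∈ rightPlane k := Ideal.subset_span (by simp)
  have h3 : X 3 ∈ rightPlane k := Ideal.subset_span (by simp)
  rw [Ideal.span_le]
  rintro _ (rfl | rfl | rfl)
  · exact Ideal.mul_mem_left _ _ h2
  · exact Ideal.mul_mem_left _ _ h3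
  · exact add_mem (Ideal.mul_mem_left _ _ h3) (Ideal.mul_mem_left _ _ h2)

theorem radical_threeGenerated :
    (threeGenerated k).radical = leftPlane k ⊓ rightPlane k := by
  apply le_antisymm
  · exact le_inf ((Ideal.IsPrime.radical_le_iff inferInstance).2 (threeGenerated_le_leftPlane k))
      ((Ideal.IsPrime.radical_le_iff inferInstance).2 (threeGenerated_le_rightPlane k))
  · rintro f ⟨hf, hf'⟩
    rw [← Ideal.radical_idem]
    refine ⟨2, productIdeal_one_le_radical k ?_⟩
    rw [productIdeal_one, sq]
    exact Ideal.mul_mem_mul hf hf'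

lemma exists_productIdeal_le (K : Ideal (MvPowerSeries (Fin 4) k))
    (hK : threeGenerated k ≤ K.radical) : ∃ n, productIdeal k (n + 1) ≤ K := by
  have h : productIdeal k 1 ≤ K.radical := by
    refine (productIdeal_one_le_radical k).trans ?_
    rwa [Ideal.radical_le_radical_iff]
  obtain ⟨n, hn⟩ := Ideal.exists_pow_le_of_le_radical_of_fg h (IsNoetherian.noetherian _)
  refine ⟨n, (productIdeal_antitone k n.le_succ).trans (le_trans ?_ hn)⟩
  obtain ⟨h1, h2, h3, h4⟩ := productIdeal_le_iff.1 (le_refl (productIdeal k 1))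
  simp only [pow_one] at h1 h2 h3 h4
  exact productIdeal_le_iff.2 ⟨Ideal.pow_mem_pow h1 n, Ideal.pow_mem_pow h2 n,
    Ideal.pow_mem_pow h3 n, Ideal.pow_mem_pow h4 n⟩

lemma X_pow_mul_eq_monomial (j : ℕ) :
    (X 0 ^ j * X 1 ^ j * X 2 ^ j * X 3 ^ j : MvPowerSeries (Fin 4) k) =
      monomial (constExponent (Fin 4) j) 1 := by
  simp only [X_pow_eq, monomial_mul_monomial, mul_one]
  congr 2
  ext i
  fin_cases i <;> simp

lemma span_eq_boxIdeal (N : ℕ) :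
    Ideal.span {X 0 ^ N, X 1 ^ N, X 2 ^ N, X 3 ^ N} = boxIdeal (Fin 4) k N := by
  congr 1
  ext f
  simp [Fin.exists_fin_succ, eq_comm]

theorem nonempty_localCohomology_linearEquiv_inverseSystem :
    Nonempty (LocalCohomologyModule (threeGenerated k) 3 (MvPowerSeries (Fin 4) k)
      ≃ₗ[MvPowerSeries (Fin 4) k] inverseSystem (Fin 4) k) := by
  have hreg (n : ℕ) := isRegular_X_pow k (n + 1)
  have hanti : Antitone fun n => productIdeal k (n + 1) :=
    (productIdeal_antitone k).comp_monotone fun _ _ h => Nat.succ_le_succ h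
  choose c hinj hc using fun n => LinearMap.exists_injective_factorization
    (ProductResolution.toExt (hreg n)) (ProductResolution.toExt_surjective (hreg n))
    (LinearMap.toSpanSingleton _ (inverseSystem (Fin 4) k) (inverseSystem.coeffConst n))
    fun r => by
      rw [ProductResolution.toExt_eq_zero_iff, LinearMap.toSpanSingleton_apply,
        inverseSystem.smul_coeffConst_eq_zero_iff, span_eq_boxIdeal]
  refine LocalCohomologyColimit.nonempty_linearEquiv (threeGenerated k) hanti
    (fun n => threeGenerated_le_radical_productIdeal k (n + 1)) (exists_productIdeal_le k) 3
    _ _ c (fun m n hmn x => ?_) hinj fun φ => ?_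
  · obtain ⟨r, rfl⟩ := ProductResolution.toExt_surjective (hreg n) x
    have hpow (i : Fin 4) :
        (X i : MvPowerSeries (Fin 4) k) ^ (m + 1) = X i ^ (n + 1) * X i ^ (m - n) := by
      rw [← pow_add]; congr 1; omega
    rw [ProductResolution.toExt_naturality (hreg n) (hreg m) (hanti hmn) (hpow 0) (hpow 1)
      (hpow 2) (hpow 3), hc, hc, LinearMap.toSpanSingleton_apply, LinearMap.toSpanSingleton_apply,
      X_pow_mul_eq_monomial, mul_comm, mul_smul, inverseSystem.monomial_smul_coeffConst hmn]
  · obtain ⟨n, r, rfl⟩ := inverseSystem.exists_smul_coeffConst φ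
    exact ⟨n, _, hc n r⟩

theorem bot_mem_associatedPrimes {R M E : Type*} [CommRing R] [IsDomain R] [IsNoetherianRing R]
    [AddCommGroup M] [Module R M] [AddCommGroup E] [Module R E] (f : M →ₗ[R] E)
    (hf : ∀ r : R, r • f = 0 → r = 0) : (⊥ : Ideal R) ∈ associatedPrimes R (M →ₗ[R] E) := by
  rw [AssociatedPrimes.mem_iff, isAssociatedPrime_iff]
  refine ⟨Ideal.isPrime_bot, f, ?_⟩
  ext r
  rw [Submodule.mem_colon_singleton]
  exact ⟨fun h => by simp [(Submodule.mem_bot R).1 h], fun h => hf r h⟩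

theorem not_isPartOfSystemOfParameters :
    ¬ IsPartOfSystemOfParameters (⊥ : Ideal (MvPowerSeries (Fin 4) k))
      ![X 0 * X 2, X 1 * X 3, X 0 * X 3 + X 1 * X 2] := by
  rintro ⟨n, h, y, hy, hdim, hrad⟩
  have hn : n = 4 := by
    rw [ringKrullDim_eq_of_ringEquiv (RingEquiv.quotientBot _),
      ← maximalIdeal_height_eq_ringKrullDim, height_maximalIdeal] at hdim
    exact_mod_cast hdim.symm
  subst hn
  rw [bot_sup_eq] at hrad
  let T : Ideal (MvPowerSeries (Fin 4) k) := Ideal.span {X 0, X 1, y 3}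
  have hP : leftPlane k ≤ T := Ideal.span_mono (by intro; simp; tauto)
  have hx (f) (hf : f ∈ threeGenerated k) : f ∈ T := hP (threeGenerated_le_leftPlane k hf)
  have hyT : Ideal.span (Set.range y) ≤ T := by
    rw [Ideal.span_le]
    rintro _ ⟨j, rfl⟩
    fin_cases j
    · exact (hy 0).symm ▸ hx _ (Ideal.subset_span (by simp))
    · exact (hy 1).symm ▸ hx _ (Ideal.subset_span (by simp))
    · exact (hy 2).symm ▸ hx _ (Ideal.subset_span (by simp))
    · exact Ideal.subset_span (by simp)
  have hTm : T ≤ maximalIdeal _ := by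
    rw [Ideal.span_le]
    rintro _ (rfl | rfl | rfl)
    · exact X_mem_maximalIdeal _
    · exact X_mem_maximalIdeal _
    · exact hrad ▸ Ideal.le_radical (Ideal.subset_span ⟨3, rfl⟩)
  have h1 := Ideal.height_le_card_of_mem_minimalPrimes_span (Set.toFinite _)
    (mem_minimalPrimes_of_le_radical hTm (hrad.ge.trans (Ideal.radical_mono hyT)))
  have h2 : ({X 0, X 1, y 3} : Set (MvPowerSeries (Fin 4) k)).ncard ≤ 3 :=
    (Set.ncard_insert_le _ _).trans (Nat.succ_le_succ
      ((Set.ncard_insert_le _ _).trans (Nat.succ_le_succ (Set.ncard_singleton _).le)))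
  rw [height_maximalIdeal] at h1
  have h3 : 4 ≤ ({X 0, X 1, y 3} : Set (MvPowerSeries (Fin 4) k)).ncard := by exact_mod_cast h1
  omega

end FourVariables

end MvPowerSeries

/-- Remark 2.2.4 (ii): Let `k` be a field, `R = k[[y_1,y_2,y_3,y_4]]`,
`x_1 = y_1y_3`, `x_2 = y_2y_4`, `x_3 = y_1y_4 + y_2y_3`.  Then
`√((x_1,x_2,x_3)R) = (y_1,y_2)R ∩ (y_3,y_4)R`, the module `H^3_{(x_1,x_2,x_3)R}(R)` is
isomorphic to `E_R(k)`, and `{0} ∈ Ass_R(D(H^3_{(x_1,x_2,x_3)R}(R)))`, although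
`x_1, x_2, x_3` is not part of a system of parameters for `R`. -/
theorem stmt12 (k : Type) [Field k]
    (y : Fin 4 → MvPowerSeries (Fin 4) k) (hy : y = fun j => MvPowerSeries.X j)
    (x₁ x₂ x₃ : MvPowerSeries (Fin 4) k)
    (hx₁ : x₁ = y 0 * y 2) (hx₂ : x₂ = y 1 * y 3) (hx₃ : x₃ = y 0 * y 3 + y 1 * y 2)
    (E : Type) [AddCommGroup E] [Module (MvPowerSeries (Fin 4) k) E]
    (hE : IsInjectiveHullOfResidueField (MvPowerSeries (Fin 4) k) E) :
    (Ideal.span {x₁, x₂, x₃}).radical = Ideal.span {y 0, y 1} ⊓ Ideal.span {y 2, y 3} ∧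
    Nonempty ((LocalCohomologyModule (Ideal.span {x₁, x₂, x₃}) 3 (MvPowerSeries (Fin 4) k))
        ≃ₗ[MvPowerSeries (Fin 4) k] E) ∧
    (⊥ : Ideal (MvPowerSeries (Fin 4) k)) ∈
      associatedPrimes (MvPowerSeries (Fin 4) k)
        (LocalCohomologyModule (Ideal.span {x₁, x₂, x₃}) 3 (MvPowerSeries (Fin 4) k)
          →ₗ[MvPowerSeries (Fin 4) k] E) ∧
    ¬ IsPartOfSystemOfParameters (⊥ : Ideal (MvPowerSeries (Fin 4) k)) ![x₁, x₂, x₃] := by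
  subst hy hx₁ hx₂ hx₃
  obtain ⟨e⟩ := MvPowerSeries.nonempty_localCohomology_linearEquiv_inverseSystem k
  obtain ⟨e'⟩ := MvPowerSeries.nonempty_linearEquiv_inverseSystem hE
  refine ⟨MvPowerSeries.radical_threeGenerated k, ⟨e.trans e'⟩,
    MvPowerSeries.bot_mem_associatedPrimes (e.trans e').toLinearMap fun r hr => ?_,
    MvPowerSeries.not_isPartOfSystemOfParameters k⟩
  refine MvPowerSeries.inverseSystem.smul_eq_zero r fun φ => e'.injective ?_
  have h := LinearMap.congr_fun hr (e.symm φ)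
  simpa using h
end

section
/- Let (R,m) be a noetherian local ring, i ≥ 1, x_1,…,x_i ∈ R, and let p ⊆ q be prime ideals of R. If H^i_{(x_1,…,x_i)R}(R/q) ≠ 0, then H^i_{(x_1,…,x_i)R}(R/p) ≠ 0; that is, the set Z_1 := { p ∈ Spec(R) : H^i_{(x_1,…,x_i)R}(R/p) ≠ 0 } is stable under generalization. -/
noncomputable section

open CategoryTheory Opposite

universe u v w

/-- A morphism `f` annihilates `Ext^n` if precomposition with `f` kills every class of
degree `n`. -/
def AnnihilatesExt {C : Type v} [Category.{w} C] [Abelian C] [HasExt.{u} C] {X Y : C}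
    (f : X ⟶ Y) (n : ℕ) : Prop :=
  ∀ (M : C) (e : Abelian.Ext Y M n), (Abelian.Ext.mk₀ f).comp e (zero_add n) = 0

namespace AnnihilatesExt

variable {C : Type v} [Category.{w} C] [Abelian C] [HasExt.{u} C] {X Y Z : C} {n : ℕ}

lemma comp_left {g : Y ⟶ Z} (hg : AnnihilatesExt g n) (f : X ⟶ Y) :
    AnnihilatesExt (f ≫ g) n := fun M e => by
  rw [← Abelian.Ext.mk₀_comp_mk₀_assoc, hg M e, Abelian.Ext.comp_zero]

lemma comp_right {f : X ⟶ Y} (hf : AnnihilatesExt f n) (g : Y ⟶ Z) :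
    AnnihilatesExt (f ≫ g) n := fun M e => by
  rw [← Abelian.Ext.mk₀_comp_mk₀_assoc, hf M]

lemma of_shortExact {S T : ShortComplex C} (hS : S.ShortExact) (hT : T.ShortExact)
    (φ : S ⟶ T) {g : T.X₃ ⟶ Z} (hg : AnnihilatesExt (T.g ≫ g) (n + 1))
    (hφ : AnnihilatesExt φ.τ₁ n) : AnnihilatesExt (φ.τ₃ ≫ g) (n + 1) := by
  intro M e
  obtain ⟨u, hu⟩ := Abelian.Ext.contravariant_sequence_exact₃ hT M
    ((Abelian.Ext.mk₀ g).comp e (zero_add _))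
    (by rw [Abelian.Ext.mk₀_comp_mk₀_assoc, hg M e]) (add_comm 1 n)
  rw [← Abelian.Ext.mk₀_comp_mk₀_assoc, ← hu,
    ← Abelian.Ext.comp_assoc _ _ _ (zero_add 1) _ (by omega),
    ← ShortComplex.ShortExact.extClass_naturality hS,
    Abelian.Ext.comp_assoc _ _ _ (add_zero 1) (zero_add n) (by omega), hφ M u,
    Abelian.Ext.comp_zero]

end AnnihilatesExt

namespace Ideal

variable {R : Type u} [CommRing R]

/-- The map `R ⧸ I ⟶ R ⧸ J` induced by multiplication by `a`. -/
def quotientMulHom (I J : Ideal R) (a : R) (h : ∀ r ∈ I, a * r ∈ J) :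
    ModuleCat.of R (R ⧸ I) ⟶ ModuleCat.of R (R ⧸ J) :=
  ModuleCat.ofHom (Submodule.mapQ I J (LinearMap.mulLeft R a) h)

/-- The canonical projection `R ⧸ I ⟶ R ⧸ J` for `I ≤ J`. -/
def quotientProj {I J : Ideal R} (h : I ≤ J) :
    ModuleCat.of R (R ⧸ I) ⟶ ModuleCat.of R (R ⧸ J) :=
  quotientMulHom I J 1 (by simpa using! h)

lemma quotientProj_mk {I J : Ideal R} (h : I ≤ J) (r : R) :
    quotientProj h (Ideal.Quotient.mk I r) = Ideal.Quotient.mk J r :=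
  congrArg _ (one_mul r)

lemma quotientMulHom_comp {I J K : Ideal R} {a b c : R} (ha : ∀ r ∈ I, a * r ∈ J)
    (hb : ∀ r ∈ J, b * r ∈ K) (hc : ∀ r ∈ I, c * r ∈ K) (h : b * a = c) :
    quotientMulHom I J a ha ≫ quotientMulHom J K b hb = quotientMulHom I K c hc := by
  subst h
  refine ModuleCat.hom_ext (LinearMap.ext fun r => ?_)
  obtain ⟨r, rfl⟩ := Ideal.Quotient.mk_surjective r
  exact congrArg (Ideal.Quotient.mk K) (mul_assoc b a r).symm

lemma quotientProj_comp {I J K : Ideal R} (h : I ≤ J) (h' : J ≤ K) :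
    quotientProj h ≫ quotientProj h' = quotientProj (h.trans h') :=
  quotientMulHom_comp _ _ _ (by simp)

/-- The sequence `R ⧸ (K : a) ⟶ R ⧸ K ⟶ R ⧸ (K + (a))` given by multiplication by `a`
and the canonical projection. -/
def colonComplex (K : Ideal R) (a : R) : ShortComplex (ModuleCat.{u} R) where
  X₁ := ModuleCat.of R (R ⧸ (Submodule.comap (LinearMap.mulLeft R a) K : Ideal R))
  X₂ := ModuleCat.of R (R ⧸ K)
  X₃ := ModuleCat.of R (R ⧸ K ⊔ span {a})
  f := quotientMulHom _ _ a fun _ hr => hr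
  g := quotientProj le_sup_left
  zero := by
    refine ModuleCat.hom_ext (LinearMap.ext fun r => ?_)
    obtain ⟨r, rfl⟩ := Ideal.Quotient.mk_surjective r
    refine (quotientProj_mk le_sup_left (a * r)).trans (Ideal.Quotient.eq_zero_iff_mem.mpr ?_)
    exact mul_mem_right r _ (mem_sup_right (mem_span_singleton_self a))

lemma colonComplex_shortExact (K : Ideal R) (a : R) : (colonComplex K a).ShortExact where
  exact := by
    rw [ShortComplex.moduleCat_exact_iff]
    intro y hy
    obtain ⟨y, rfl⟩ := Ideal.Quotient.mk_surjective y
    have hy' : y ∈ K ⊔ span {a} :=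
      Ideal.Quotient.eq_zero_iff_mem.mp ((quotientProj_mk le_sup_left y).symm.trans hy)
    obtain ⟨k, hk, _, hb, rfl⟩ := Submodule.mem_sup.mp hy'
    obtain ⟨c, rfl⟩ := mem_span_singleton'.mp hb
    refine ⟨Ideal.Quotient.mk _ c, Ideal.Quotient.eq.mpr ?_⟩
    simpa [mul_comm] using hk
  mono_f := by
    rw [ModuleCat.mono_iff_injective]
    refine (injective_iff_map_eq_zero (colonComplex K a).f.hom).mpr fun y hy => ?_
    obtain ⟨y, rfl⟩ := Ideal.Quotient.mk_surjective y
    have hy' : Ideal.Quotient.mk K (a * y) = 0 := hy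
    exact Ideal.Quotient.eq_zero_iff_mem.mpr (Ideal.Quotient.eq_zero_iff_mem.mp hy' : a * y ∈ K)
  epi_g := by
    rw [ModuleCat.epi_iff_surjective]
    intro y
    obtain ⟨y, rfl⟩ := Ideal.Quotient.mk_surjective y
    exact ⟨Ideal.Quotient.mk K y, quotientProj_mk le_sup_left y⟩

/-- The morphism `colonComplex K' (a * b) ⟶ colonComplex K a` which is multiplication by `b`
on the left-hand terms and the canonical projection on the others. -/
def colonComplexMap {K' K : Ideal R} (h : K' ≤ K) (a b : R) :
    colonComplex K' (a * b) ⟶ colonComplex K a where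
  τ₁ := quotientMulHom _ _ b fun r hr => by
    simpa [mul_assoc] using h hr
  τ₂ := quotientProj h
  τ₃ := quotientProj (sup_le_sup h (span_singleton_le_span_singleton.mpr (Dvd.intro b rfl)))
  comm₁₂ := by
    have hc : ∀ r ∈ (Submodule.comap (LinearMap.mulLeft R (a * b)) K' : Ideal R),
        a * b * r ∈ K := fun r hr => h hr
    exact (quotientMulHom_comp _ _ hc rfl).trans (quotientMulHom_comp _ _ hc (one_mul _)).symm
  comm₂₃ := (quotientProj_comp h le_sup_left).trans (quotientProj_comp le_sup_left
    (sup_le_sup h (span_singleton_le_span_singleton.mpr (Dvd.intro b rfl)))).symm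

lemma annihilatesExt_quotientProj_sup {K K₁ K₂ : Ideal R} (h₁ : K₁ ≤ K) (h₂ : K₂ ≤ K₁) {a b : R}
    (ha : a ∈ K) (hb : ∀ r, a * b * r ∈ K₂ → b * r ∈ K₂) {n : ℕ}
    (H₁ : AnnihilatesExt (quotientProj h₁) (n + 1)) (H₂ : AnnihilatesExt (quotientProj h₂) n)
    (h : K₂ ⊔ span {a * b} ≤ K) :
    AnnihilatesExt (quotientProj h) (n + 1) := by
  have h₁' : K₁ ⊔ span {a} ≤ K := sup_le h₁ (by simpa using ha)
  have hb' : ∀ r ∈ (Submodule.comap (LinearMap.mulLeft R (a * b)) K₂ : Ideal R), b * r ∈ K₂ := hb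
  let φ := colonComplexMap h₂ a b
  have hg : AnnihilatesExt ((colonComplex K₁ a).g ≫ quotientProj h₁') (n + 1) := by
    have := quotientProj_comp (le_sup_left : K₁ ≤ K₁ ⊔ span {a}) h₁'
    exact this ▸ H₁
  have hφ : AnnihilatesExt φ.τ₁ n := by
    have : φ.τ₁ = (quotientMulHom _ K₂ b hb' ≫ quotientProj h₂) ≫
        quotientProj (fun r hr => K₁.mul_mem_left a hr) :=
      ((congrArg (· ≫ _) (quotientMulHom_comp _ _ (fun r hr => h₂ (hb' r hr)) (one_mul b))).trans
        (quotientMulHom_comp _ _ _ (one_mul b))).symm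
    rw [this]
    exact (H₂.comp_left _).comp_right _
  have := AnnihilatesExt.of_shortExact (colonComplex_shortExact K₂ (a * b))
    (colonComplex_shortExact K₁ a) φ hg hφ
  exact (quotientProj_comp (sup_le_sup h₂ (span_singleton_le_span_singleton.mpr
    (Dvd.intro b rfl))) h₁') ▸ this

lemma exists_annihilatesExt_quotientProj [IsNoetherianRing R] (s : List R) (K : Ideal R)
    (hK : span {x | x ∈ s} ≤ K.radical) :
    ∃ (K' : Ideal R) (h : K' ≤ K), span {x | x ∈ s} ≤ K'.radical ∧
      ∀ n, s.length < n → AnnihilatesExt (quotientProj h) n := by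
  induction s generalizing K with
  | nil =>
    refine ⟨⊥, bot_le, by simp, fun n hn M e => ?_⟩
    obtain ⟨n, rfl⟩ : ∃ m, n = m + 1 := ⟨n - 1, by simp at hn; omega⟩
    have : Projective (ModuleCat.of R (R ⧸ (⊥ : Ideal R))) := by
      have : Module.Projective R (R ⧸ (⊥ : Ideal R)) :=
        Module.Projective.of_equiv (Submodule.quotEquivOfEqBot (⊥ : Ideal R) rfl).symm
      exact (IsProjective.iff_projective _).mp this
    exact Abelian.Ext.eq_zero_of_projective _
  | cons x s ih =>
    have hs : span {x | x ∈ s} ≤ span {y | y ∈ x :: s} :=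
      span_mono fun y hy => List.mem_cons_of_mem x hy
    obtain ⟨t, ht⟩ : x ∈ K.radical := hK (subset_span (by simp))
    obtain ⟨K₁, h₁, hK₁, H₁⟩ := ih K (hs.trans hK)
    obtain ⟨K₂, h₂, hK₂, H₂⟩ := ih K₁ hK₁
    let F : ℕ →o Ideal R :=
      { toFun := fun m => Submodule.comap (LinearMap.mulLeft R (x ^ m)) K₂
        monotone' := fun m m' hm r hr => by
          have := K₂.mul_mem_left (x ^ (m' - m)) hr
          simpa [← mul_assoc, ← pow_add, Nat.sub_add_cancel hm] using this }
    obtain ⟨m, hm⟩ := monotone_stabilizes_iff_noetherian.mpr ‹IsNoetherianRing R› F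
    have hle : K₂ ⊔ span {x ^ t * x ^ m} ≤ K :=
      sup_le (h₂.trans h₁) (by simpa using K.mul_mem_right _ ht)
    refine ⟨K₂ ⊔ span {x ^ t * x ^ m}, hle, ?_, fun n hn => ?_⟩
    · rw [span_le]
      intro y hy
      rcases List.mem_cons.mp hy with rfl | hy
      · exact ⟨t + m, mem_sup_right (by rw [pow_add]; exact mem_span_singleton_self _)⟩
      · exact radical_mono le_sup_left (hK₂ (subset_span hy))
    · obtain ⟨n, rfl⟩ : ∃ m, n = m + 1 := ⟨n - 1, by omega⟩
      rw [List.length_cons] at hn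
      refine annihilatesExt_quotientProj_sup h₁ h₂ ht (fun r hr => ?_) (H₁ _ (by omega))
        (H₂ _ (by omega)) _
      have : r ∈ F (m + t) := by
        change x ^ (m + t) * r ∈ K₂
        rwa [add_comm, pow_add]
      rw [← hm (m + t) (by omega)] at this
      exact this

end Ideal

namespace HomologicalComplex

open Limits

variable {C : Type*} [Category* C] [Abelian C] {K L : ChainComplex C ℕ} {n : ℕ} {A : C}

/-- A morphism `φ` on the chains of degree `n` which vanishes on boundaries, restricted to the
homology. -/
def homologyDesc (φ : K.X n ⟶ A) (hφ : K.d (n + 1) n ≫ φ = 0) : K.homology n ⟶ A :=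
  K.homologyι n ≫ K.descOpcycles φ (n + 1) (by simp) hφ

lemma homologyMap_comp_homologyDesc (f : K ⟶ L) (φ : L.X n ⟶ A) (hφ : L.d (n + 1) n ≫ φ = 0) :
    homologyMap f n ≫ homologyDesc φ hφ =
      homologyDesc (f.f n ≫ φ) (by rw [← f.comm_assoc, hφ, comp_zero]) := by
  rw [homologyDesc, homologyι_naturality_assoc, homologyDesc]
  congr 1
  simp

lemma homologyDesc_surjective [Injective A] (ε : K.homology n ⟶ A) :
    ∃ (φ : K.X n ⟶ A) (hφ : K.d (n + 1) n ≫ φ = 0), homologyDesc φ hφ = ε := by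
  refine ⟨K.pOpcycles n ≫ Injective.factorThru ε (K.homologyι n), by simp, ?_⟩
  conv_rhs => rw [← Injective.comp_factorThru ε (K.homologyι n)]
  rw [homologyDesc]
  congr 1
  simp [← cancel_epi (K.pOpcycles n)]

end HomologicalComplex

namespace CategoryTheory.ProjectiveResolution
variable {R : Type u} [CommRing R] {X X' : ModuleCat.{u} R}

open HomologicalComplex

/-- The contravariant functor `Hom(-, Y)`. -/
abbrev homFunctor (Y : ModuleCat.{u} R) : ModuleCat.{u} R ⥤ (ModuleCat.{u} R)ᵒᵖ :=
  ((linearYoneda R (ModuleCat.{u} R)).obj Y).rightOp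

/-- A morphism `X ⟶ Y`, viewed as a morphism `R ⟶ Hom(X, Y)` in the opposite category. -/
def pointHom {X Y : ModuleCat.{u} R} (g : X ⟶ Y) :
    (homFunctor Y).obj X ⟶ op (ModuleCat.of R R) :=
  Quiver.Hom.op (ModuleCat.ofHom (LinearMap.toSpanSingleton R (X ⟶ Y) g))

lemma exists_eq_pointHom {X Y : ModuleCat.{u} R} (φ : (homFunctor Y).obj X ⟶ op (ModuleCat.of R R)) :
    ∃ g : X ⟶ Y, φ = pointHom g :=
  ⟨φ.unop.hom (1 : R), Quiver.Hom.unop_inj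
    (ModuleCat.hom_ext (LinearMap.ext_ring (one_smul R _).symm))⟩

lemma pointHom_ext {M : ModuleCat.{u} R} {φ ψ : op M ⟶ op (ModuleCat.of R R)}
    (h : φ.unop.hom (1 : R) = ψ.unop.hom (1 : R)) : φ = ψ :=
  Quiver.Hom.unop_inj (ModuleCat.hom_ext (LinearMap.ext_ring h))

lemma map_comp_pointHom {X X' Y : ModuleCat.{u} R} (f : X' ⟶ X) (g : X ⟶ Y) :
    (homFunctor Y).map f ≫ pointHom g = pointHom (f ≫ g) :=
  pointHom_ext ((congrArg (f ≫ ·) (one_smul R g)).trans (one_smul R (f ≫ g)).symm)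

lemma app_comp_pointHom {X Y Y' : ModuleCat.{u} R} (φ : Y ⟶ Y') (g : X ⟶ Y) :
    (NatTrans.rightOp ((linearYoneda R (ModuleCat.{u} R)).map φ)).app X ≫ pointHom g =
      pointHom (g ≫ φ) :=
  pointHom_ext ((congrArg (· ≫ φ) (one_smul R g)).trans (one_smul R (g ≫ φ)).symm)

lemma pointHom_zero {X Y : ModuleCat.{u} R} : pointHom (0 : X ⟶ Y) = 0 :=
  pointHom_ext (one_smul R (0 : X ⟶ Y))

lemma pointHom_eq_zero {X Y : ModuleCat.{u} R} {g : X ⟶ Y} (h : pointHom g = 0) : g = 0 :=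
  (one_smul R g).symm.trans (congrArg (fun φ => φ.unop.hom (1 : R)) h)

lemma map_comp_pointHom_eq_zero {X X' Y : ModuleCat.{u} R} {f : X' ⟶ X} {g : X ⟶ Y}
    (h : f ≫ g = 0) : (homFunctor Y).map f ≫ pointHom g = 0 :=
  (map_comp_pointHom f g).trans ((congrArg pointHom h).trans pointHom_zero)

/-- The class in `Ext` of a cocycle of a projective resolution. -/
def cocycleClass (P : ProjectiveResolution X) {Y : ModuleCat.{u} R} {n : ℕ}
    (g : P.complex.X n ⟶ Y) (hg : P.complex.d (n + 1) n ≫ g = 0) :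
    ((Ext R (ModuleCat.{u} R) n).obj (op X)).obj Y :=
  ((P.isoLeftDerivedObj (homFunctor Y) n).hom ≫
    homologyDesc (K := ((homFunctor Y).mapHomologicalComplex _).obj P.complex) (pointHom g)
      (map_comp_pointHom_eq_zero hg)).unop.hom (1 : R)

lemma cocycleClass_surjective (P : ProjectiveResolution X) {Y : ModuleCat.{u} R} {n : ℕ}
    (e : ((Ext R (ModuleCat.{u} R) n).obj (op X)).obj Y) :
    ∃ (g : P.complex.X n ⟶ Y) (hg : P.complex.d (n + 1) n ≫ g = 0), P.cocycleClass g hg = e := by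
  let ε : ((homFunctor Y).leftDerived n).obj X ⟶ op (ModuleCat.of R R) :=
    Quiver.Hom.op (ModuleCat.ofHom (LinearMap.toSpanSingleton R _ e))
  have : Projective (ModuleCat.of R R) := (IsProjective.iff_projective _).mp inferInstance
  obtain ⟨φ, hφ, h⟩ := homologyDesc_surjective ((P.isoLeftDerivedObj (homFunctor Y) n).inv ≫ ε)
  obtain ⟨g, rfl⟩ := exists_eq_pointHom φ
  have hg : P.complex.d (n + 1) n ≫ g = 0 :=
    pointHom_eq_zero ((map_comp_pointHom _ _).symm.trans hφ)
  refine ⟨g, hg, ?_⟩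
  exact (congrArg (fun ψ => ψ.unop.hom (1 : R))
    ((congrArg ((P.isoLeftDerivedObj (homFunctor Y) n).hom ≫ ·) h).trans
      (Iso.hom_inv_id_assoc _ _))).trans (one_smul R e)

lemma map_cocycleClass (P : ProjectiveResolution X) {Y Y' : ModuleCat.{u} R} (φ : Y ⟶ Y') {n : ℕ}
    (g : P.complex.X n ⟶ Y) (hg : P.complex.d (n + 1) n ≫ g = 0) :
    ((Ext R (ModuleCat.{u} R) n).obj (op X)).map φ (P.cocycleClass g hg) =
      P.cocycleClass (g ≫ φ) (by rw [← Category.assoc, hg, Limits.zero_comp]) := by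
  have h := P.leftDerived_app_eq (NatTrans.rightOp ((linearYoneda R (ModuleCat.{u} R)).map φ)) n
  rw [← Category.assoc, Iso.eq_comp_inv] at h
  have h' := homologyMap_comp_homologyDesc ((NatTrans.mapHomologicalComplex
    (NatTrans.rightOp ((linearYoneda R (ModuleCat.{u} R)).map φ)) _).app P.complex) (pointHom g)
      (map_comp_pointHom_eq_zero hg)
  have h'' := app_comp_pointHom φ g
  refine congrArg (fun ψ => ψ.unop.hom (1 : R)) ((Category.assoc _ _ _).symm.trans
    ((congrArg (· ≫ _) h).trans ((Category.assoc _ _ _).trans (congrArg (_ ≫ ·) (h'.trans ?_)))))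
  congr 1

lemma map_op_cocycleClass (P : ProjectiveResolution X) (P' : ProjectiveResolution X')
    {f : X' ⟶ X} (ψ : Hom P' P f) {Y : ModuleCat.{u} R} {n : ℕ}
    (g : P.complex.X n ⟶ Y) (hg : P.complex.d (n + 1) n ≫ g = 0) :
    ((Ext R (ModuleCat.{u} R) n).map f.op).app Y (P.cocycleClass g hg) =
      P'.cocycleClass (ψ.hom.f n ≫ g) (by rw [← ψ.hom.comm_assoc, hg, Limits.comp_zero]) := by
  have h := isoLeftDerivedObj_hom_naturality f P' P ψ.hom
    ψ.hom_f_zero_comp_π_f_zero (homFunctor Y) n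
  have h' := homologyMap_comp_homologyDesc (((homFunctor Y).mapHomologicalComplex _).map ψ.hom)
    (pointHom g) (map_comp_pointHom_eq_zero hg)
  refine congrArg (fun ψ => ψ.unop.hom (1 : R)) ((Category.assoc _ _ _).symm.trans
    ((congrArg (· ≫ _) h).trans ((Category.assoc _ _ _).trans (congrArg (_ ≫ ·) (h'.trans ?_)))))
  congr 1

end CategoryTheory.ProjectiveResolution

namespace CategoryTheory

/-- If `f : X' ⟶ X` annihilates `Ext^(i+1)`, then the pullback along `f` of any class in
`Ext^i(X, N)` lifts along an epimorphism `M ⟶ N`. -/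
lemma Ext_exists_map_eq_of_annihilatesExt {R : Type u} [CommRing R] {X X' M N : ModuleCat.{u} R}
    {f : X' ⟶ X} {i : ℕ} (hf : AnnihilatesExt f (i + 1)) (π : M ⟶ N) [Epi π]
    (e : ((Ext R (ModuleCat.{u} R) i).obj (op X)).obj N) :
    ∃ e' : ((Ext R (ModuleCat.{u} R) i).obj (op X')).obj M,
      ((Ext R (ModuleCat.{u} R) i).obj (op X')).map π e' =
        ((Ext R (ModuleCat.{u} R) i).map f.op).app N e := by
  let P := projectiveResolution X
  let P' := projectiveResolution X'
  let ψ : ProjectiveResolution.Hom P' P f :=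
    ⟨ProjectiveResolution.lift f P' P,
      (ProjectiveResolution.lift_commutes_zero f P' P).trans (by simp)⟩
  obtain ⟨g, hg, rfl⟩ := P.cocycleClass_surjective e
  let g' := Projective.factorThru g π
  have hg' : g' ≫ π = g := Projective.factorThru_comp g π
  let c := Limits.kernel.lift π (P.complex.d (i + 1) i ≫ g') (by rw [Category.assoc, hg', hg])
  have hc : c ≫ Limits.kernel.ι π = P.complex.d (i + 1) i ≫ g' := Limits.kernel.lift_ι _ _ _
  have hdc : P.complex.d (i + 2) (i + 1) ≫ c = 0 := by
    rw [← cancel_mono (Limits.kernel.ι π), Category.assoc, hc]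
    simp
  have h := (ProjectiveResolution.mk₀_comp_extMk c (i + 2) rfl hdc ψ).symm.trans (hf _ _)
  rw [ProjectiveResolution.extMk_eq_zero_iff _ _ _ _ _ i rfl] at h
  obtain ⟨k, hk⟩ := h
  refine ⟨P'.cocycleClass (ψ.hom.f i ≫ g' - k ≫ Limits.kernel.ι π) ?_, ?_⟩
  · rw [Preadditive.comp_sub, reassoc_of% hk, hc, ← ψ.hom.comm_assoc, sub_self]
  · rw [ProjectiveResolution.map_cocycleClass, ProjectiveResolution.map_op_cocycleClass P P' ψ]
    congr 1
    simp [hg']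

end CategoryTheory

namespace localCohomology

variable {R : Type u} [CommRing R]

lemma ringModIdeals_map_eq_quotientProj {D : Type v} [SmallCategory D] (I : D ⥤ Ideal R)
    {s t : D} (w : s ⟶ t) :
    (ringModIdeals I).map w = Ideal.quotientProj (leOfHom (I.map w)) := by
  refine ModuleCat.hom_ext (LinearMap.ext fun x => ?_)
  obtain ⟨r, rfl⟩ := Ideal.Quotient.mk_surjective x
  exact (Ideal.quotientProj_mk _ r).symm

lemma exists_rep (J : Ideal R) (i : ℕ) (M : ModuleCat.{u} R) (z : (localCohomology J i).obj M) :
    ∃ (t : ℕᵒᵖᵒᵖ) (e : ((diagram (idealPowersDiagram J) i).obj t).obj M),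
      (Limits.colimit.ι (diagram (idealPowersDiagram J) i) t).app M e = z :=
  have := Limits.preservesFilteredColimitsOfSize_shrink.{0, u, 0, u} (forget (ModuleCat.{u} R))
  Limits.Concrete.isColimit_exists_rep _
    (Limits.isColimitOfPreserves ((evaluation _ _).obj M)
      (Limits.colimit.isColimit (diagram (idealPowersDiagram J) i))) z

/-- The `i`-th local cohomology with support in an ideal generated by at most `i` elements
preserves epimorphisms. -/
theorem map_surjective [IsNoetherianRing R] (s : List R) {i : ℕ} (hi : s.length ≤ i)
    {M N : ModuleCat.{u} R} (π : M ⟶ N) [Epi π] :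
    Function.Surjective ((localCohomology (Ideal.span {x | x ∈ s}) i).map π) := by
  set J := Ideal.span {x | x ∈ s}
  intro z
  obtain ⟨t, e, he⟩ := exists_rep J i N z
  obtain ⟨K', h, hK', hann⟩ := Ideal.exists_annihilatesExt_quotientProj s (J ^ t.unop.unop)
    (fun x hx => ⟨t.unop.unop, Ideal.pow_mem_pow hx _⟩)
  obtain ⟨m, hm⟩ := Ideal.exists_pow_le_of_le_radical_of_fg hK' (IsNoetherian.noetherian J)
  let l := max m t.unop.unop
  let w : t ⟶ op (op l) := (homOfLE (le_max_right m t.unop.unop)).op.op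
  have hw : AnnihilatesExt ((ringModIdeals (idealPowersDiagram J)).map w.unop) (i + 1) := by
    rw [ringModIdeals_map_eq_quotientProj]
    have h' := (hann (i + 1) (by lia)).comp_left
      (Ideal.quotientProj ((Ideal.pow_le_pow_right (le_max_left _ _)).trans hm : J ^ l ≤ K'))
    rwa [Ideal.quotientProj_comp] at h'
  obtain ⟨e', he'⟩ := Ext_exists_map_eq_of_annihilatesExt hw π e
  refine ⟨(Limits.colimit.ι (diagram (idealPowersDiagram J) i) (op (op l))).app M e', ?_⟩
  have h₁ := (Limits.colimit.ι (diagram (idealPowersDiagram J) i) (op (op l))).naturality π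
  have h₂ := NatTrans.congr_app (Limits.colimit.w (diagram (idealPowersDiagram J) i) w) N
  exact (ConcreteCategory.congr_hom h₁ e').symm.trans
    ((congrArg _ he').trans ((ConcreteCategory.congr_hom h₂ e).trans he))

end localCohomology

end

/-- Remark 2.2.4 (iii), for `Z₁`: Let `(R,m)` be a noetherian local ring,
`i ≥ 1`, `x_1,…,x_i ∈ R` and `p ⊆ q` primes of `R`.  If `H^i_{(x_1,…,x_i)R}(R/q) ≠ 0`
then `H^i_{(x_1,…,x_i)R}(R/p) ≠ 0`; i.e. the set
`Z₁ = { p ∈ Spec R | H^i_{(x_1,…,x_i)R}(R/p) ≠ 0 }` is stable under generalization. -/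
theorem stmt13 (R : Type) [CommRing R] [IsLocalRing R] [IsNoetherianRing R]
    (i : ℕ) (hi : 1 ≤ i) (x : Fin i → R)
    (p q : Ideal R) (hp : p.IsPrime) (hq : q.IsPrime) (hpq : p ≤ q)
    (h : Nontrivial (LocalCohomologyModule (Ideal.span (Set.range x)) i (R ⧸ q))) :
    Nontrivial (LocalCohomologyModule (Ideal.span (Set.range x)) i (R ⧸ p)) := by
  have : CategoryTheory.Epi (ModuleCat.ofHom (Submodule.factor hpq)) :=
    (ModuleCat.epi_iff_surjective _).mpr (Submodule.factor_surjective hpq)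
  have hx : {y | y ∈ List.ofFn x} = Set.range x := Set.ext fun y => List.mem_ofFn' x y
  rw [← hx] at h ⊢
  exact (localCohomology.map_surjective (List.ofFn x) (List.length_ofFn (f := x)).le
    (ModuleCat.ofHom (Submodule.factor hpq))).nontrivial
end

section
/- Let (R,m) be a noetherian local equicharacteristic complete domain with coefficient field k. Then the zero ideal of R belongs to Ass_R(Hom_k(R,k)), where Hom_k(R,k) is the R-module of k-linear maps from R to k with R acting by (r·φ)(s) = φ(rs). -/
set_option synthInstance.maxHeartbeats 1000000

/-- Scalar action of `R` on `M →ₗ[R₀] N` through the domain: `(r • φ) m = φ (r • m)`. -/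
noncomputable instance LinearMap.smulDomAct {R R₀ M N : Type*} [CommRing R] [Semiring R₀]
    [AddCommGroup M] [Module R M] [Module R₀ M] [SMulCommClass R₀ R M]
    [AddCommMonoid N] [Module R₀ N] : SMul R (M →ₗ[R₀] N) :=
  ⟨fun r φ => φ.comp
    (⟨⟨fun m => r • m, smul_add r⟩, fun c m => (smul_comm c r m).symm⟩ : M →ₗ[R₀] M)⟩

theorem LinearMap.smulDomAct_apply {R R₀ M N : Type*} [CommRing R] [Semiring R₀]
    [AddCommGroup M] [Module R M] [Module R₀ M] [SMulCommClass R₀ R M]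
    [AddCommMonoid N] [Module R₀ N] (r : R) (φ : M →ₗ[R₀] N) (m : M) :
    (r • φ) m = φ (r • m) := rfl

/-- The `R`-module structure on `M →ₗ[R₀] N` given by the action of `R` on the domain,
`(r • φ) m = φ (r • m)`. -/
noncomputable instance LinearMap.moduleDomAct {R R₀ M N : Type*} [CommRing R] [Semiring R₀]
    [AddCommGroup M] [Module R M] [Module R₀ M] [SMulCommClass R₀ R M]
    [AddCommMonoid N] [Module R₀ N] : Module R (M →ₗ[R₀] N) where
  smul := (· • ·)
  one_smul φ := LinearMap.ext fun m => by
    rw [LinearMap.smulDomAct_apply, one_smul]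
  mul_smul r s φ := LinearMap.ext fun m => by
    rw [LinearMap.smulDomAct_apply, LinearMap.smulDomAct_apply, LinearMap.smulDomAct_apply,
      ← mul_smul, mul_comm]
  smul_zero r := LinearMap.ext fun m => by
    rw [LinearMap.smulDomAct_apply, LinearMap.zero_apply, LinearMap.zero_apply]
  smul_add r φ ψ := LinearMap.ext fun m => by
    rw [LinearMap.smulDomAct_apply, LinearMap.add_apply, LinearMap.add_apply,
      LinearMap.smulDomAct_apply, LinearMap.smulDomAct_apply]
  add_smul r s φ := LinearMap.ext fun m => by
    rw [LinearMap.smulDomAct_apply, LinearMap.add_apply, LinearMap.smulDomAct_apply,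
      LinearMap.smulDomAct_apply, add_smul, map_add]
  zero_smul φ := LinearMap.ext fun m => by
    rw [LinearMap.smulDomAct_apply, LinearMap.zero_apply, zero_smul, map_zero]


open IsLocalRing

/-- Transfinite choice of a linearly independent transversal: if the dimension of each subspace
`W i` exceeds the number of predecessors of `i`, then one can choose linearly independent vectors
`w i ∈ W i`. -/
theorem exists_linearIndependent_forall_mem.{u, v} {K : Type v} {V ι : Type u} [DivisionRing K]
    [AddCommGroup V] [Module K V] [LinearOrder ι] [WellFoundedLT ι] (W : ι → Submodule K V)
    (hW : ∀ i, Cardinal.mk (Set.Iio i) < Module.rank K (W i)) :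
    ∃ w : ι → V, (∀ i, w i ∈ W i) ∧ LinearIndependent K w := by
  have step : ∀ (i : ι) (f : Set.Iio i → V),
      ∃ v ∈ W i, v ∉ Submodule.span K (Set.range f) := by
    intro i f
    by_contra! h
    have h_le : W i ≤ Submodule.span K (Set.range f) := h
    exact absurd (hW i) (not_lt.2 (((Submodule.rank_mono h_le).trans (rank_span_le _)).trans
      Cardinal.mk_range_le))
  choose g hgW hg using step
  let w : ι → V := (wellFounded_lt (α := ι)).fix fun i f => g i fun j => f j.1 j.2
  have hw : ∀ i, w i = g i fun j => w j.1 := fun i => WellFounded.fix_eq _ _ i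
  refine ⟨w, fun i => hw i ▸ hgW i _, linearIndependent_iff'.2 fun s c hc => ?_⟩
  by_contra! hne
  obtain ⟨i₀, hi₀, hc₀⟩ := hne
  classical
  obtain ⟨m, hm, hmax⟩ := (s.filter (c · ≠ 0)).exists_max_image id ⟨i₀, by simp [hi₀, hc₀]⟩
  rw [Finset.mem_filter] at hm
  refine hg m (fun j => w j.1) ?_
  rw [← hw, ← Submodule.smul_mem_iff _ hm.2]
  rw [← Finset.add_sum_erase _ _ hm.1] at hc
  rw [eq_neg_of_add_eq_zero_left hc]
  refine Submodule.neg_mem _ (Submodule.sum_mem _ fun j hj => ?_)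
  rw [Finset.mem_erase] at hj
  by_cases hcj : c j = 0
  · simp [hcj]
  · have hjm : j < m := lt_of_le_of_ne (hmax j (by simp [hj.2, hcj])) hj.1
    exact Submodule.smul_mem _ _ (Submodule.subset_span ⟨⟨j, hjm⟩, rfl⟩)

/-- If the `k`-dimension of a domain `R` is at least its cardinality, some linear form on `R`
vanishes on no nonzero ideal. -/
theorem exists_linearForm_of_mk_le_rank.{u, v} {k : Type v} {R : Type u} [Field k] [CommRing R]
    [IsDomain R] [Algebra k R] (h : Cardinal.mk R ≤ Module.rank k R) :
    ∃ φ : R →ₗ[k] k, ∀ r : R, r ≠ 0 → ∃ s, φ (r * s) ≠ 0 := by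
  obtain ⟨e⟩ : Nonempty ((Cardinal.mk R).ord.ToType ≃ R) := Cardinal.eq.1 (by simp)
  have key : ∃ w : {i // e i ≠ 0} → R, (∀ i, w i ∈ LinearMap.range (LinearMap.mulLeft k (e i.1))) ∧
      LinearIndependent k w := by
    refine exists_linearIndependent_forall_mem
      (fun i : {i // e i ≠ 0} => LinearMap.range (LinearMap.mulLeft k (e i.1))) fun i => ?_
    rw [← (LinearEquiv.ofInjective (LinearMap.mulLeft k (e i.1))
      (mul_right_injective₀ i.2)).rank_eq]
    refine (lt_of_le_of_lt ?_ (Cardinal.mk_Iio_lt i.1 (by simp))).trans_le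
      ((Cardinal.mk_ord_toType _).trans_le h)
    exact Cardinal.mk_le_of_injective (f := fun j => ⟨j.1.1, j.2⟩)
      fun a b hab => Subtype.ext (Subtype.ext (Subtype.mk.inj hab))
  obtain ⟨w, hwW, hw⟩ := key
  obtain ⟨g, hg⟩ := LinearMap.exists_leftInverse_of_injective _
    (LinearMap.ker_eq_bot.2 hw)
  refine ⟨(Finsupp.linearCombination k fun _ => (1 : k)) ∘ₗ g, fun r hr => ?_⟩
  obtain ⟨s, hs⟩ := hwW ⟨e.symm r, by simpa using hr⟩
  refine ⟨s, ?_⟩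
  have h1 := LinearMap.congr_fun hg (Finsupp.single ⟨e.symm r, by simpa using hr⟩ 1)
  simp only [LinearMap.comp_apply, Finsupp.linearCombination_single, one_smul, ← hs,
    LinearMap.id_apply, LinearMap.mulLeft_apply, Equiv.apply_symm_apply] at h1
  simp [h1]

/-- A local domain containing a field `k`, and not itself a field, has `k`-dimension equal to its
cardinality. -/
theorem mk_le_rank_of_not_isField.{u} {k R : Type u} [Field k] [CommRing R] [IsLocalRing R]
    [IsDomain R] [Algebra k R] (h : ¬ IsField R) : Cardinal.mk R ≤ Module.rank k R := by
  obtain ⟨x, hxm, hx0⟩ := Submodule.exists_mem_ne_zero_of_ne_bot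
    (mt isField_iff_maximalIdeal_eq.2 h)
  have hxu : ¬ IsUnit x := (mem_maximalIdeal x).1 hxm
  have hx : Transcendental k x := fun ha => hxu
    (IsArtinianRing.isUnit_of_isIntegral_of_nonZeroDivisor ha.isIntegral
      (mem_nonZeroDivisors_of_ne_zero hx0))
  have h_aleph : Cardinal.aleph0 ≤ Module.rank k R := by
    by_contra! hlt
    have : Module.Finite k R := Module.rank_lt_aleph0_iff.1 hlt
    exact hx (Algebra.IsAlgebraic.isAlgebraic x)
  have h_unit : ∀ a : k, IsUnit (1 - algebraMap k R a * x) := fun a =>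
    (isUnit_or_isUnit_one_sub_self (algebraMap k R a * x)).resolve_left
      fun hu => hxu (isUnit_of_mul_isUnit_right hu)
  have h_li : LinearIndependent k fun a : k => x * ((h_unit a).unit⁻¹ : Rˣ) := by
    let F := FractionRing R
    have hxF : Transcendental k (algebraMap R F x)⁻¹ := fun ha =>
      hx ((isAlgebraic_algebraMap_iff (IsFractionRing.injective R F)).1 (IsAlgebraic.inv_iff.1 ha))
    refine LinearIndependent.of_comp (IsScalarTower.toAlgHom k R F).toLinearMap ?_
    convert hxF.linearIndependent_sub_inv using 1
    funext a
    have hx0' : algebraMap R F x ≠ 0 := by simpa using hx0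
    have hu : algebraMap R F (1 - algebraMap k R a * x) *
        algebraMap R F ((h_unit a).unit⁻¹ : Rˣ) = 1 := by
      rw [← map_mul, IsUnit.mul_val_inv, map_one]
    have e1 : (algebraMap R F x)⁻¹ - algebraMap k F a =
        algebraMap R F (1 - algebraMap k R a * x) * (algebraMap R F x)⁻¹ := by
      rw [map_sub, map_mul, map_one, ← IsScalarTower.algebraMap_apply k R F,
        sub_mul, one_mul, mul_inv_cancel_right₀ hx0']
    rw [e1, eq_comm]
    refine inv_eq_of_mul_eq_one_right ?_
    simp only [Function.comp_apply, AlgHom.toLinearMap_apply, IsScalarTower.coe_toAlgHom', map_mul]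
    rw [mul_assoc, inv_mul_cancel_left₀ hx0', hu]
  let b := Module.Free.chooseBasis k R
  have hb : Module.rank k R = Cardinal.mk (Module.Free.ChooseBasisIndex k R) :=
    b.mk_eq_rank''.symm
  have : Infinite (Module.Free.ChooseBasisIndex k R) := Cardinal.infinite_iff.2 (hb ▸ h_aleph)
  rw [Cardinal.mk_congr b.repr.toEquiv, Cardinal.mk_finsupp_of_infinite, ← hb]
  exact max_le le_rfl h_li.cardinal_le_rank

/-- A local domain containing a field `k` has a `k`-linear form vanishing on no nonzero ideal. -/
theorem exists_linearForm_vanishing_on_no_ideal.{u} {k R : Type u} [Field k] [CommRing R]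
    [IsLocalRing R] [IsDomain R] [Algebra k R] : ∃ φ : R →ₗ[k] k, ∀ r : R, r ≠ 0 → ∃ s, φ (r * s) ≠ 0 := by
  by_cases h : IsField R
  · obtain ⟨φ, hφ⟩ := not_forall.1
      (mt (Module.forall_dual_apply_eq_zero_iff k (1 : R)).1 one_ne_zero)
    refine ⟨φ, fun r hr => ?_⟩
    obtain ⟨s, hs⟩ := h.mul_inv_cancel hr
    exact ⟨s, hs ▸ hφ⟩
  · exact exists_linearForm_of_mk_le_rank (mk_le_rank_of_not_isField h)

/-- Remark 2.3.1: Let `(R,m)` be a noetherian local equicharacteristic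
complete domain with coefficient field `k` (i.e. `k → R → R/m` is bijective).  Then the
zero ideal of `R` belongs to `Ass_R(Hom_k(R,k))`, where `Hom_k(R,k)` is the `R`-module of
`k`-linear maps `R → k` with `R` acting on the domain, `(r • φ) s = φ (r * s)`. -/
theorem stmt16 (R k : Type) [CommRing R] [IsLocalRing R] [IsNoetherianRing R] [IsDomain R]
    [IsAdicComplete (maximalIdeal R) R]
    [Field k] [Algebra k R]
    (hk : Function.Bijective ((residue R).comp (algebraMap k R))) :
    (⊥ : Ideal R) ∈ associatedPrimes R (R →ₗ[k] k) := by
  obtain ⟨φ, hφ⟩ := exists_linearForm_vanishing_on_no_ideal (k := k) (R := R)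
  refine AssociatedPrimes.mem_iff.2 (isAssociatedPrime_iff.2 ⟨Ideal.isPrime_bot, φ, ?_⟩)
  refine (eq_bot_iff.2 fun r hr => ?_).symm
  rw [Submodule.mem_colon_singleton, Submodule.mem_bot] at hr
  by_contra h0
  obtain ⟨s, hs⟩ := hφ r h0
  exact hs (LinearMap.congr_fun hr s)
end

section
/- Let k be a field, R_0 = k[[x_1,…,x_n]] the formal power series ring in n variables over k, and R = R_0[[x]] = k[[x_1,…,x_n,x]] the formal power series ring in one further variable. Then the zero ideal of R belongs to Ass_R(Hom_{R_0}(R, R_0)), where Hom_{R_0}(R,R_0) is the R-module of R_0-linear maps from R to R_0 with R acting by (r·φ)(s) = φ(rs). -/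
set_option synthInstance.maxHeartbeats 1000000

/-- There is a linear functional on `k⟦X⟧` whose kernel contains no nonzero ideal. -/
theorem PowerSeries.exists_linearMap_forall_exists_apply_mul_ne_zero (k : Type*) [Field k] :
    ∃ l : PowerSeries k →ₗ[k] k, ∀ f : PowerSeries k, f ≠ 0 → ∃ s, l (f * s) ≠ 0 := by
  obtain ⟨g, hg⟩ := LinearMap.exists_leftInverse_of_injective
    (Polynomial.coeToPowerSeries.algHom (R := k) k).toLinearMap
    (LinearMap.ker_eq_bot.mpr fun p q h => by
      simpa [Polynomial.coeToPowerSeries.algHom_apply] using h)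
  refine ⟨(Polynomial.leval 1).comp g, fun f hf =>
    ⟨PowerSeries.Inv_divided_by_X_pow_order hf, ?_⟩⟩
  have hX : f * PowerSeries.Inv_divided_by_X_pow_order hf = PowerSeries.X ^ f.order.toNat := by
    conv_lhs => enter [1]; rw [← PowerSeries.X_pow_order_mul_divXPowOrder (f := f)]
    rw [mul_assoc, PowerSeries.Inv_divided_by_X_pow_order_rightInv, mul_one]
  have hgX := LinearMap.congr_fun hg (Polynomial.X ^ f.order.toNat)
  simp only [LinearMap.comp_apply, AlgHom.toLinearMap_apply,
    Polynomial.coeToPowerSeries.algHom_apply, LinearMap.id_apply, Polynomial.coe_pow,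
    Polynomial.coe_X, Algebra.algebraMap_self, PowerSeries.map_id, id_eq] at hgX
  simp [hX, hgX]

/-- The coefficientwise extension of a `k`-linear functional on `k⟦X⟧` to a linear map from
power series over `R₀ = k⟦σ⟧` to `R₀`. -/
noncomputable def PowerSeries.mvCoeffwise {σ k : Type*} [Field k] (l : PowerSeries k →ₗ[k] k) :
    PowerSeries (MvPowerSeries σ k) →ₗ[MvPowerSeries σ k] MvPowerSeries σ k where
  toFun F := fun a => l (PowerSeries.mk fun m => MvPowerSeries.coeff a (PowerSeries.coeff m F))
  map_add' F G := by
    refine MvPowerSeries.ext fun a => ?_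
    change l _ = l _ + l _
    rw [← map_add]
    congr 1
  map_smul' c F := by
    classical
    refine MvPowerSeries.ext fun a => ?_
    refine Eq.trans ?_ (MvPowerSeries.coeff_mul a c _).symm
    change l _ = ∑ p ∈ Finset.HasAntidiagonal.antidiagonal a, MvPowerSeries.coeff p.1 c * l _
    simp_rw [← smul_eq_mul, ← map_smul, ← map_sum]
    congr 1
    ext m
    simp [MvPowerSeries.coeff_mul]

theorem PowerSeries.coeff_mvCoeffwise_mul_map_C {σ k : Type*} [Field k]
    (l : PowerSeries k →ₗ[k] k) (F : PowerSeries (MvPowerSeries σ k)) (s : PowerSeries k)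
    (a : σ →₀ ℕ) :
    MvPowerSeries.coeff a (PowerSeries.mvCoeffwise l (F * PowerSeries.map MvPowerSeries.C s)) =
      l ((PowerSeries.mk fun m => MvPowerSeries.coeff a (PowerSeries.coeff m F)) * s) := by
  change l _ = _
  congr 1
  ext m
  simp [PowerSeries.coeff_mul]

/-- Lemma 2.3.2: Let `k` be a field, `R₀ = k[[x_1,…,x_n]]` and
`R = R₀[[x]] = k[[x_1,…,x_n,x]]`.  Then `{0} ∈ Ass_R(Hom_{R₀}(R, R₀))`, where
`Hom_{R₀}(R,R₀)` is the `R`-module of `R₀`-linear maps `R → R₀` with `R` acting on the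
domain, `(r • φ) s = φ (r * s)`. -/
theorem stmt17 (k : Type) [Field k] (n : ℕ) :
    (⊥ : Ideal (PowerSeries (MvPowerSeries (Fin n) k))) ∈
      associatedPrimes (PowerSeries (MvPowerSeries (Fin n) k))
        (PowerSeries (MvPowerSeries (Fin n) k) →ₗ[MvPowerSeries (Fin n) k]
          MvPowerSeries (Fin n) k) := by
  obtain ⟨l, hl⟩ := PowerSeries.exists_linearMap_forall_exists_apply_mul_ne_zero k
  have hp : (⊥ : Ideal (PowerSeries (MvPowerSeries (Fin n) k))).IsPrime := Ideal.isPrime_bot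
  refine ⟨hp, PowerSeries.mvCoeffwise l, ?_⟩
  rw [eq_comm, ← hp.radical]
  congr 1
  rw [eq_bot_iff]
  intro F hF
  rw [Submodule.mem_colon_singleton, Submodule.mem_bot] at hF
  by_contra hF0
  obtain ⟨m, a, ha⟩ : ∃ m a, MvPowerSeries.coeff a (PowerSeries.coeff m F) ≠ 0 := by
    by_contra! h
    exact hF0 (PowerSeries.ext fun m => MvPowerSeries.ext fun a => by simpa using h m a)
  obtain ⟨s, hs⟩ := hl (PowerSeries.mk fun m => MvPowerSeries.coeff a (PowerSeries.coeff m F))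
    fun h => ha (by simpa using congrArg (PowerSeries.coeff m) h)
  apply hs
  rw [← PowerSeries.coeff_mvCoeffwise_mul_map_C, ← smul_eq_mul, ← LinearMap.smulDomAct_apply]
  exact congrArg (MvPowerSeries.coeff a) (LinearMap.congr_fun hF _)
end

section
/- Let (R,m) be a noetherian local ring and M a nonzero finitely generated R-module. Then H^{dim_R(M)}_m(M) ≠ 0, where dim_R(M) denotes the Krull dimension of M. -/
open IsLocalRing

universe u

section LocalCohomologyExt

open CategoryTheory Opposite

section OppositeComplex
variable {R : Type u} [CommRing R] {ι : Type*} {c : ComplexShape ι}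

/-- `h` is the homology class of the element `x` of the complex `K` of opposite modules. -/
def IsHomologyClass (K : HomologicalComplex (ModuleCat.{u} R)ᵒᵖ c) (n : ι)
    (x : (K.X n).unop) (h : (K.homology n).unop) : Prop :=
  ∃ z : (K.opcycles n).unop, (K.pOpcycles n).unop z = x ∧ (K.homologyι n).unop z = h

lemma exists_isHomologyClass (K : HomologicalComplex (ModuleCat.{u} R)ᵒᵖ c) {m n : ι}
    (hm : c.prev n = m) (x : (K.X n).unop) (hx : (K.d m n).unop x = 0) :
    ∃ h, IsHomologyClass K n x h := by
  have ex := (ShortComplex.exact_of_g_is_cokernel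
    (ShortComplex.mk (K.d m n) (K.pOpcycles n) (by simp)) (K.opcyclesIsCokernel m n hm)).unop
  rw [ShortComplex.moduleCat_exact_iff] at ex
  obtain ⟨z, hz⟩ := ex x hx
  exact ⟨_, z, hz, rfl⟩

lemma IsHomologyClass.exists_eq_of_zero {K : HomologicalComplex (ModuleCat.{u} R)ᵒᵖ c} {n p : ι}
    (hp : c.next n = p) {x : (K.X n).unop} (h : IsHomologyClass K n x 0) :
    ∃ y : (K.X p).unop, (K.d n p).unop y = x := by
  obtain ⟨z, rfl, hz⟩ := h
  have ex := (ShortComplex.exact_of_f_is_kernel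
    (ShortComplex.mk (K.homologyι n) (K.fromOpcycles n p) (by simp))
      (K.homologyIsKernel n p hp)).unop
  rw [ShortComplex.moduleCat_exact_iff] at ex
  obtain ⟨y, hy⟩ := ex z hz
  refine ⟨y, ?_⟩
  rw [← hy, ← K.p_fromOpcycles n p]
  rfl

lemma IsHomologyClass.map {K L : HomologicalComplex (ModuleCat.{u} R)ᵒᵖ c} (φ : K ⟶ L) {n : ι}
    {x : (L.X n).unop} {h : (L.homology n).unop} (hx : IsHomologyClass L n x h) :
    IsHomologyClass K n ((φ.f n).unop x) ((HomologicalComplex.homologyMap φ n).unop h) := by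
  obtain ⟨z, rfl, rfl⟩ := hx
  refine ⟨(HomologicalComplex.opcyclesMap φ n).unop z, ?_, ?_⟩
  · have := congrArg Quiver.Hom.unop (HomologicalComplex.p_opcyclesMap φ n)
    exact ConcreteCategory.congr_hom this z
  · have := congrArg Quiver.Hom.unop (HomologicalComplex.homologyι_naturality φ n)
    exact (ConcreteCategory.congr_hom this z).symm

end OppositeComplex

section ExtClass
variable {R : Type u} [CommRing R]

/-- `h` is the class in the derived functor `Ext` of the cocycle `f` on a projective resolution. -/
def IsExtClass {X : ModuleCat.{u} R} (P : ProjectiveResolution X) (Y : ModuleCat.{u} R) (n : ℕ)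
    (f : P.complex.X n ⟶ Y) (h : ((Ext R (ModuleCat.{u} R) n).obj (op X)).obj Y) : Prop :=
  IsHomologyClass ((((linearYoneda R (ModuleCat.{u} R)).obj Y).rightOp.mapHomologicalComplex
    (ComplexShape.down ℕ)).obj P.complex) n f
    ((P.isoLeftDerivedObj ((linearYoneda R (ModuleCat.{u} R)).obj Y).rightOp n).inv.unop h)

lemma exists_isExtClass {X : ModuleCat.{u} R} (P : ProjectiveResolution X) (Y : ModuleCat.{u} R)
    (n : ℕ) (f : P.complex.X n ⟶ Y) (hf : P.complex.d (n + 1) n ≫ f = 0) :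
    ∃ h, IsExtClass P Y n f h := by
  obtain ⟨h, hh⟩ := exists_isHomologyClass
    ((((linearYoneda R (ModuleCat.{u} R)).obj Y).rightOp.mapHomologicalComplex
    (ComplexShape.down ℕ)).obj P.complex) (m := n + 1) (n := n) (by simp) f hf
  refine ⟨(P.isoLeftDerivedObj ((linearYoneda R (ModuleCat.{u} R)).obj Y).rightOp n).hom.unop h, ?_⟩
  have := congrArg Quiver.Hom.unop
    (P.isoLeftDerivedObj ((linearYoneda R (ModuleCat.{u} R)).obj Y).rightOp n).inv_hom_id
  have := ConcreteCategory.congr_hom this h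
  exact (congrArg (IsHomologyClass _ n f) this).mpr hh

lemma IsExtClass.extMk_eq_zero {X : ModuleCat.{u} R} {P : ProjectiveResolution X}
    {Y : ModuleCat.{u} R} {n : ℕ} {f : P.complex.X n ⟶ Y} (hf : P.complex.d (n + 1) n ≫ f = 0)
    (h : IsExtClass P Y n f 0) : P.extMk f (n + 1) rfl hf = 0 := by
  obtain ⟨z, hz, hz0⟩ := h
  have h : IsHomologyClass ((((linearYoneda R (ModuleCat.{u} R)).obj
      Y).rightOp.mapHomologicalComplex (ComplexShape.down ℕ)).obj P.complex) n f 0 :=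
    ⟨z, hz, hz0.trans (map_zero
      (P.isoLeftDerivedObj ((linearYoneda R (ModuleCat.{u} R)).obj Y).rightOp n).inv.unop.hom)⟩
  cases n with
  | zero =>
    obtain ⟨y, hy⟩ := h.exists_eq_of_zero rfl
    have hd : P.complex.d 0 ((ComplexShape.down ℕ).next 0) = 0 :=
      P.complex.shape _ _ (by simp)
    have : f = 0 := hy.symm.trans ((congrArg (· ≫ (show P.complex.X _ ⟶ Y from y)) hd).trans
      Limits.zero_comp)
    subst this
    exact P.extMk_zero _ _
  | succ p =>
    obtain ⟨y, hy⟩ := h.exists_eq_of_zero (p := p) (by simp)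
    exact (P.extMk_eq_zero_iff _ _ _ _ p rfl).2 ⟨y, hy⟩

lemma IsExtClass.map {X X' : ModuleCat.{u} R} {P : ProjectiveResolution X}
    {P' : ProjectiveResolution X'} {g : X' ⟶ X} (φ : P'.Hom P g)
    {Y : ModuleCat.{u} R} {n : ℕ} {f : P.complex.X n ⟶ Y}
    {h : ((Ext R (ModuleCat.{u} R) n).obj (op X)).obj Y} (hf : IsExtClass P Y n f h) :
    IsExtClass P' Y n (φ.hom.f n ≫ f) (((Ext R (ModuleCat.{u} R) n).map g.op).app Y h) := by
  have h1 := IsHomologyClass.map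
    ((((linearYoneda R (ModuleCat.{u} R)).obj Y).rightOp.mapHomologicalComplex
    (ComplexShape.down ℕ)).map φ.hom) hf
  have h2 := ProjectiveResolution.isoLeftDerivedObj_inv_naturality g P' P φ.hom
    φ.hom_f_zero_comp_π_f_zero ((linearYoneda R (ModuleCat.{u} R)).obj Y).rightOp n
  have h3 := ConcreteCategory.congr_hom (congrArg Quiver.Hom.unop h2) h
  exact (congrArg (IsHomologyClass _ n _) h3).mpr h1

open Abelian

lemma exists_precomp_eq_zero_of_subsingleton {R : Type} [CommRing R] (J : Ideal R) (n : ℕ)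
    (M : ModuleCat.{0} R) [Subsingleton ((localCohomology J n).obj M)] (t : ℕ)
    (x : Ext.{0} (ModuleCat.of R (R ⧸ J ^ t)) M n) :
    ∃ (s : ℕ) (h : t ≤ s), (Ext.mk₀ (ModuleCat.ofHom
      (Submodule.factor (Ideal.pow_le_pow_right (I := J) h)))).comp x (zero_add n) = 0 := by
  let P (s : ℕ) : ProjectiveResolution (ModuleCat.of R (R ⧸ J ^ s)) := projectiveResolution _
  obtain ⟨f, hf, rfl⟩ := (P t).extMk_surjective x (n + 1) rfl
  obtain ⟨h, hh⟩ := exists_isExtClass (P t) M n f hf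
  let D := localCohomology.diagram (localCohomology.idealPowersDiagram J) n
  let F : ℕᵒᵖᵒᵖ ⥤ ModuleCat.{0} R := D ⋙ (evaluation _ _).obj M
  have e : (localCohomology J n).obj M ≅ Limits.colimit F :=
    Limits.colimitObjIsoColimitCompEvaluation _ _
  have : Subsingleton (Limits.colimit F : ModuleCat.{0} R) :=
    e.toLinearEquiv.symm.toEquiv.subsingleton
  let y : F.obj (op (op t)) := h
  obtain ⟨k, a, b, hab⟩ := (Limits.Concrete.colimit_rep_eq_iff_exists F y
    (0 : F.obj (op (op t)))).1 (Subsingleton.elim _ _)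
  rw [map_zero] at hab
  let s : ℕ := k.unop.unop
  have hts : t ≤ s := a.unop.unop.down.down
  refine ⟨s, hts, ?_⟩
  let g : ModuleCat.of R (R ⧸ J ^ s) ⟶ ModuleCat.of R (R ⧸ J ^ t) :=
    ModuleCat.ofHom (Submodule.factor (Ideal.pow_le_pow_right (I := J) hts))
  let φ : (P s).Hom (P t) g :=
    ⟨ProjectiveResolution.lift g (P s) (P t), by
      have := ProjectiveResolution.lift_commutes g (P s) (P t)
      exact congrArg (fun ψ => HomologicalComplex.Hom.f ψ 0) this⟩
  have h1 := hh.map φ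
  have h2 : ((Ext R (ModuleCat.{0} R) n).map g.op).app M h = 0 := hab
  rw [h2] at h1
  exact (ProjectiveResolution.mk₀_comp_extMk f _ rfl hf φ).trans
    (h1.extMk_eq_zero (by simp [← φ.hom.comm_assoc, hf]))
end ExtClass

end LocalCohomologyExt

section Artinian

lemma exists_forall_ge_eq {P : Type*} [PartialOrder P] [WellFoundedLT P] (f : ℕ → P)
    (hf : Antitone f) : ∃ n, ∀ m ≥ n, f m = f n := by
  obtain ⟨_, ⟨n, rfl⟩, hn⟩ := WellFounded.has_min (wellFounded_lt (α := P)) (Set.range f)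
    ⟨_, 0, rfl⟩
  exact ⟨n, fun m hm => (hf hm).eq_of_not_lt (hn _ ⟨m, rfl⟩)⟩

lemma exists_forall_ge_forall_eq {P : Type*} [PartialOrder P] [WellFoundedLT P] (f : ℕ → ℕ → P)
    (h₁ : ∀ k, Antitone (fun j => f j k)) (h₂ : ∀ j, Antitone (f j)) :
    ∃ n, ∀ m ≥ n, ∀ k, f m k = f n k := by
  obtain ⟨N, hN⟩ := exists_forall_ge_eq (fun n => f n n)
    (fun a b hab => (h₁ b hab).trans (h₂ a hab))
  choose n hn using fun k => exists_forall_ge_eq (fun j => f j k) (h₁ k)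
  have key : ∀ j k, N ≤ j → N ≤ k → f j k = f N N := fun j k hj hk =>
    le_antisymm ((h₁ k hj).trans (h₂ N hk))
      ((hN (max j k) (hj.trans (le_max_left _ _))).ge.trans
        ((h₁ _ (le_max_left _ _)).trans (h₂ _ (le_max_right _ _))))
  refine ⟨max N ((Finset.range N).sup n), fun m hm k => ?_⟩
  rcases le_or_gt N k with hk | hk
  · rw [key _ _ ((le_max_left _ _).trans hm) hk, key _ _ (le_max_left _ _) hk]
  · have h : n k ≤ max N ((Finset.range N).sup n) :=
      (Finset.le_sup (Finset.mem_range.2 hk)).trans (le_max_right _ _)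
    exact (hn k _ (h.trans hm)).trans (hn k _ h).symm

/-- A module all of whose elements are killed by powers of `x` is Artinian as soon as the
kernel of multiplication by `x` is. -/
lemma isArtinian_of_ker_lsmul {R N : Type*} [CommRing R] [AddCommGroup N] [Module R N] (x : R)
    (hN : ∀ n : N, ∃ t : ℕ, x ^ t • n = 0)
    [IsArtinian R (LinearMap.ker (LinearMap.lsmul R N x))] : IsArtinian R N := by
  rw [← monotone_stabilizes_iff_artinian]
  intro A
  let S (B : Submodule R N) (k : ℕ) : Submodule R (LinearMap.ker (LinearMap.lsmul R N x)) :=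
    ((B ⊓ LinearMap.ker (LinearMap.lsmul R N (x ^ (k + 1)))).map
      (LinearMap.lsmul R N (x ^ k))).comap (Submodule.subtype _)
  have mem (B : Submodule R N) (k : ℕ) (y : LinearMap.ker (LinearMap.lsmul R N x)) :
      y ∈ S B k ↔ ∃ b ∈ B, x ^ (k + 1) • b = 0 ∧ x ^ k • b = y := by
    simp only [S, Submodule.mem_comap, Submodule.mem_map, Submodule.mem_inf, LinearMap.mem_ker,
      LinearMap.lsmul_apply, Submodule.subtype_apply, and_assoc]
  have anti (B : Submodule R N) : Antitone (S B) := by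
    refine antitone_nat_of_succ_le (fun k y hy => ?_)
    rw [mem] at hy ⊢
    obtain ⟨b, hb, h1, h2⟩ := hy
    exact ⟨x • b, B.smul_mem x hb, by rw [smul_smul, ← pow_succ]; exact h1,
      by rw [smul_smul, ← pow_succ]; exact h2⟩
  have mono (k : ℕ) {B C : Submodule R N} (h : B ≤ C) : S B k ≤ S C k := by
    intro y hy
    rw [mem] at hy ⊢
    obtain ⟨b, hb, h1⟩ := hy
    exact ⟨b, h hb, h1⟩
  have eq_of {B C : Submodule R N} (h : B ≤ C) (hS : ∀ k, S B k = S C k) : B = C := by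
    refine le_antisymm h ?_
    have aux : ∀ (k : ℕ), ∀ c ∈ C, x ^ k • c = 0 → c ∈ B := by
      intro k
      induction k with
      | zero => intro c _ hc; rw [pow_zero, one_smul] at hc; rw [hc]; exact B.zero_mem
      | succ k ih =>
        intro c hc hk
        have hker : x ^ k • c ∈ LinearMap.ker (LinearMap.lsmul R N x) := by
          rw [LinearMap.mem_ker, LinearMap.lsmul_apply, smul_smul, ← pow_succ']
          exact hk
        have h1 : (⟨_, hker⟩ : LinearMap.ker (LinearMap.lsmul R N x)) ∈ S B k := by
          rw [hS, mem]
          exact ⟨c, hc, hk, rfl⟩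
        rw [mem] at h1
        obtain ⟨b, hb, _, hbc⟩ := h1
        have h2 := ih (c - b) (C.sub_mem hc (h hb)) (by rw [smul_sub, hbc, sub_self])
        simpa using B.add_mem h2 hb
    intro c hc
    obtain ⟨t, ht⟩ := hN c
    exact aux t c hc ht
  obtain ⟨n, hn⟩ := exists_forall_ge_forall_eq (fun j k => S (OrderDual.ofDual (A j)) k)
    (fun k i j hij => mono k (A.monotone hij)) (fun j => anti _)
  exact ⟨n, fun m hm => (eq_of (A.monotone hm) (fun k => hn m hm k)).symm⟩

lemma isArtinian_of_pow_maximalIdeal_smul_eq_zero {R T : Type*} [CommRing R] [IsLocalRing R]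
    [IsNoetherianRing R] [AddCommGroup T] [Module R T] [Module.Finite R T] {s : ℕ}
    (hT : ∀ a ∈ maximalIdeal R ^ s, ∀ x : T, a • x = 0) : IsArtinian R T := by
  have hT' : Module.IsTorsionBySet R T (maximalIdeal R ^ (s + 1) : Ideal R) := fun x a =>
    hT a (Ideal.pow_le_pow_right (Nat.le_succ s) a.2) x
  have : IsArtinianRing (R ⧸ maximalIdeal R ^ (s + 1)) := by
    apply IsLocalRing.quotient_artinian_of_mem_minimalPrimes_of_isLocalRing
    refine ⟨⟨inferInstance, Ideal.pow_le_self (by omega)⟩, fun q hq _ => ?_⟩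
    have := hq.1
    exact this.le_of_pow_le hq.2
  let := hT'.module
  have : IsScalarTower R (R ⧸ maximalIdeal R ^ (s + 1)) T := hT'.isScalarTower
  have : Module.Finite (R ⧸ maximalIdeal R ^ (s + 1)) T :=
    Module.Finite.of_restrictScalars_finite R _ _
  have : IsArtinian (R ⧸ maximalIdeal R ^ (s + 1)) T := isArtinian_of_fg_of_artinian'
  exact isArtinian_of_surjective_algebraMap (R := R ⧸ maximalIdeal R ^ (s + 1)) (S := R) (M := T)
    Ideal.Quotient.mk_surjective

end Artinian

section Secondary

variable {R N : Type*} [CommRing R] [AddCommGroup N] [Module R N]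

lemma map_lsmul_one (P : Submodule R N) : P.map (LinearMap.lsmul R N 1) = P := by
  ext x
  simp

lemma map_lsmul_mul (P : Submodule R N) (a b : R) : P.map (LinearMap.lsmul R N (a * b)) =
    (P.map (LinearMap.lsmul R N b)).map (LinearMap.lsmul R N a) := by
  ext x
  simp [mul_smul]

lemma isPrime_radical_annihilator {P : Submodule R N} (hP : P ≠ ⊥)
    (h : ∀ r : R, r ∉ P.annihilator.radical → P.map (LinearMap.lsmul R N r) = P) :
    P.annihilator.radical.IsPrime := by
  have hne : P.annihilator.radical ≠ ⊤ := by
    rw [Ne, Ideal.radical_eq_top, Submodule.annihilator_eq_top_iff]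
    exact hP
  refine ⟨hne, fun {a b} hab => ?_⟩
  by_contra! hcon
  have hmul : P.map (LinearMap.lsmul R N (a * b)) = P := by
    rw [map_lsmul_mul, h b hcon.2, h a hcon.1]
  have hpow : ∀ k : ℕ, P.map (LinearMap.lsmul R N ((a * b) ^ k)) = P := by
    intro k
    induction k with
    | zero => rw [pow_zero, map_lsmul_one]
    | succ k ih => rw [pow_succ, map_lsmul_mul, hmul, ih]
  obtain ⟨k, hk⟩ := hab
  apply hP
  rw [← hpow k, eq_bot_iff]
  rintro _ ⟨x, hx, rfl⟩
  exact Submodule.mem_annihilator.1 hk x hx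

lemma exists_lt_sup_eq [IsArtinian R N] {P : Submodule R N} {r : R}
    (hr : r ∉ P.annihilator.radical) (hr' : P.map (LinearMap.lsmul R N r) ≠ P) :
    ∃ A B : Submodule R N, A < P ∧ B < P ∧ A ⊔ B = P := by
  have hle : ∀ k : ℕ, P.map (LinearMap.lsmul R N (r ^ k)) ≤ P := by
    rintro k _ ⟨x, hx, rfl⟩
    exact P.smul_mem _ hx
  obtain ⟨n, hn⟩ := exists_forall_ge_eq (fun k => P.map (LinearMap.lsmul R N (r ^ k)))
    (antitone_nat_of_succ_le (fun k => by
      rw [pow_succ, map_lsmul_mul]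
      refine Submodule.map_mono ?_
      have := hle 1
      rwa [pow_one] at this))
  refine ⟨P.map (LinearMap.lsmul R N (r ^ n)), P ⊓ LinearMap.ker (LinearMap.lsmul R N (r ^ n)),
    (hle n).lt_of_ne ?_, inf_le_left.lt_of_ne ?_, le_antisymm (sup_le (hle n) inf_le_left) ?_⟩
  · intro h
    apply hr'
    have h1 := hn (n + 1) (Nat.le_succ n)
    beta_reduce at h1
    rw [pow_succ', map_lsmul_mul, h] at h1
    exact h1
  · intro h
    refine hr ⟨n, Submodule.mem_annihilator.2 fun x hx => ?_⟩
    rw [← h] at hx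
    exact hx.2
  · intro x hx
    have h1 : r ^ n • x ∈ P.map (LinearMap.lsmul R N (r ^ (n + n))) := by
      have h2 := hn (n + n) (Nat.le_add_left n n)
      beta_reduce at h2
      rw [h2]
      exact ⟨x, hx, rfl⟩
    obtain ⟨y, hy, hxy⟩ := h1
    rw [LinearMap.lsmul_apply, pow_add, mul_smul] at hxy
    refine Submodule.mem_sup.2 ⟨r ^ n • y, ⟨y, hy, rfl⟩, x - r ^ n • y,
      ⟨P.sub_mem hx (P.smul_mem _ hy), ?_⟩, by abel⟩
    rw [SetLike.mem_coe, LinearMap.mem_ker, LinearMap.lsmul_apply, smul_sub, hxy, sub_self]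

lemma exists_finite_primes_aux [IsLocalRing R] [IsNoetherianRing R] [IsArtinian R N]
    (P : Submodule R N) : ∃ T : Set (Ideal R), T.Finite ∧
      (∀ p ∈ T, p.IsPrime ∧ p ≠ maximalIdeal R) ∧ ∀ r : R, (∀ p ∈ T, r ∉ p) →
        ∃ k : ℕ, ∀ a ∈ maximalIdeal R ^ k, ∀ x ∈ P, ∃ y ∈ P, a • x = r • y := by
  induction P using WellFoundedLT.induction with
  | _ P ih =>
  by_cases h : ∀ r : R, r ∉ P.annihilator.radical → P.map (LinearMap.lsmul R N r) = P
  · by_cases hP : P = ⊥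
    · refine ⟨∅, Set.finite_empty, by simp, fun r _ => ⟨0, fun a _ x hx => ⟨0, P.zero_mem, ?_⟩⟩⟩
      rw [hP, Submodule.mem_bot] at hx
      rw [hx, smul_zero, smul_zero]
    have hp := isPrime_radical_annihilator hP h
    by_cases hm : P.annihilator.radical = maximalIdeal R
    · obtain ⟨k, hk⟩ := Ideal.exists_radical_pow_le_of_fg P.annihilator
        (IsNoetherian.noetherian _)
      rw [hm] at hk
      refine ⟨∅, Set.finite_empty, by simp, fun r _ => ⟨k, fun a ha x hx => ⟨0, P.zero_mem, ?_⟩⟩⟩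
      rw [smul_zero, Submodule.mem_annihilator.1 (hk ha) x hx]
    · refine ⟨{P.annihilator.radical}, Set.finite_singleton _, by simp [hp, hm],
        fun r hr => ⟨0, fun a _ x hx => ?_⟩⟩
      have hx' : a • x ∈ P.map (LinearMap.lsmul R N r) := by
        rw [h r (hr _ rfl)]
        exact P.smul_mem a hx
      obtain ⟨y, hy, hxy⟩ := hx'
      exact ⟨y, hy, hxy.symm⟩
  · push Not at h
    obtain ⟨r, hr, hr'⟩ := h
    obtain ⟨A, B, hA, hB, hAB⟩ := exists_lt_sup_eq hr hr'
    obtain ⟨T, hT, hT', h1⟩ := ih A hA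
    obtain ⟨U, hU, hU', h2⟩ := ih B hB
    refine ⟨T ∪ U, hT.union hU, fun p hp => hp.elim (hT' p) (hU' p), fun s hs => ?_⟩
    obtain ⟨k, hk⟩ := h1 s (fun p hp => hs p (Or.inl hp))
    obtain ⟨l, hl⟩ := h2 s (fun p hp => hs p (Or.inr hp))
    refine ⟨max k l, fun a ha x hx => ?_⟩
    rw [← hAB] at hx
    obtain ⟨b, hb, c, hc, rfl⟩ := Submodule.mem_sup.1 hx
    obtain ⟨y, hy, hby⟩ := hk a (Ideal.pow_le_pow_right (le_max_left k l) ha) b hb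
    obtain ⟨z, hz, hcz⟩ := hl a (Ideal.pow_le_pow_right (le_max_right k l) ha) c hc
    exact ⟨y + z, P.add_mem (hA.le hy) (hB.le hz), by rw [smul_add, smul_add, hby, hcz]⟩

variable (R N) in
/-- For an Artinian module `N`, multiplication by an element avoiding finitely many nonmaximal
primes has a cokernel killed by a power of the maximal ideal. -/
lemma exists_finite_primes [IsLocalRing R] [IsNoetherianRing R] [IsArtinian R N] :
    ∃ T : Set (Ideal R), T.Finite ∧
      (∀ p ∈ T, p.IsPrime ∧ p ≠ maximalIdeal R) ∧ ∀ r : R, (∀ p ∈ T, r ∉ p) →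
        ∃ k : ℕ, ∀ a ∈ maximalIdeal R ^ k, ∀ x : N, ∃ y : N, a • x = r • y := by
  obtain ⟨T, hT, hT', h⟩ := exists_finite_primes_aux (⊤ : Submodule R N)
  refine ⟨T, hT, hT', fun r hr => ?_⟩
  obtain ⟨k, hk⟩ := h r hr
  refine ⟨k, fun a ha x => ?_⟩
  obtain ⟨y, -, hy⟩ := hk a ha x Submodule.mem_top
  exact ⟨y, hy⟩

end Secondary

section ColimExtBasic

open CategoryTheory Abelian

variable {R : Type u} [CommRing R] (J : Ideal R)

/-- The projection `R ⧸ J ^ t ⟶ R ⧸ J ^ s` for `s ≤ t`. -/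
noncomputable abbrev powProj {s t : ℕ} (h : s ≤ t) :
    ModuleCat.of R (R ⧸ J ^ t) ⟶ ModuleCat.of R (R ⧸ J ^ s) :=
  ModuleCat.ofHom (Submodule.factor (Ideal.pow_le_pow_right (I := J) h))

lemma powProj_comp {s t r : ℕ} (h : s ≤ t) (h' : t ≤ r) :
    powProj J h' ≫ powProj J h = powProj J (h.trans h') := by
  ext
  rfl

lemma powProj_rfl (s : ℕ) : powProj J (le_refl s) = 𝟙 _ := by
  ext
  rfl

/-- The transition map `Ext (R ⧸ J ^ s) M n → Ext (R ⧸ J ^ t) M n` for `s ≤ t`. -/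
noncomputable def extTransition (n : ℕ) (M : ModuleCat.{u} R) (s t : ℕ) (h : s ≤ t) :
    Ext.{u} (ModuleCat.of R (R ⧸ J ^ s)) M n →ₗ[R] Ext.{u} (ModuleCat.of R (R ⧸ J ^ t)) M n :=
  (Ext.mk₀ (powProj J h)).precompOfLinear R M (zero_add n)

lemma extTransition_apply (n : ℕ) (M : ModuleCat.{u} R) (s t : ℕ) (h : s ≤ t)
    (x : Ext.{u} (ModuleCat.of R (R ⧸ J ^ s)) M n) :
    extTransition J n M s t h x = (Ext.mk₀ (powProj J h)).comp x (zero_add n) := rfl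

instance (n : ℕ) (M : ModuleCat.{u} R) :
    DirectedSystem (fun t : ℕ => Ext.{u} (ModuleCat.of R (R ⧸ J ^ t)) M n)
      (fun s t h => extTransition J n M s t h) where
  map_self s x := by
    rw [extTransition_apply, powProj_rfl, Ext.mk₀_id_comp]
  map_map r s t hrs hst x := by
    rw [extTransition_apply, extTransition_apply, extTransition_apply, Ext.mk₀_comp_mk₀_assoc,
      powProj_comp]

/-- The modules `Ext (R ⧸ J ^ t) M n`. -/
abbrev ExtFamily (n : ℕ) (M : ModuleCat.{u} R) (t : ℕ) : Type u :=
  Ext.{u} (ModuleCat.of R (R ⧸ J ^ t)) M n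

/-- The local cohomology of `M` at `J` as the colimit of the modules `Ext (R ⧸ J ^ t) M n`. -/
def ColimExt (n : ℕ) (M : ModuleCat.{u} R) : Type u :=
  Module.DirectLimit (ExtFamily J n M) (extTransition J n M)

noncomputable instance (n : ℕ) (M : ModuleCat.{u} R) : AddCommGroup (ColimExt J n M) :=
  inferInstanceAs (AddCommGroup (Module.DirectLimit (ExtFamily J n M) (extTransition J n M)))

noncomputable instance (n : ℕ) (M : ModuleCat.{u} R) : Module R (ColimExt J n M) :=
  inferInstanceAs (Module R (Module.DirectLimit (ExtFamily J n M) (extTransition J n M)))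

namespace ColimExt

/-- The canonical map `Ext (R ⧸ J ^ t) M n → ColimExt J n M`. -/
noncomputable def of (n : ℕ) (M : ModuleCat.{u} R) (t : ℕ) :
    Ext.{u} (ModuleCat.of R (R ⧸ J ^ t)) M n →ₗ[R] ColimExt J n M :=
  Module.DirectLimit.of R ℕ (ExtFamily J n M) (extTransition J n M) t

variable {J}

lemma of_precomp {n : ℕ} {M : ModuleCat.{u} R} {s t : ℕ} (h : s ≤ t)
    (x : Ext.{u} (ModuleCat.of R (R ⧸ J ^ s)) M n) :
    of J n M t ((Ext.mk₀ (powProj J h)).comp x (zero_add n)) = of J n M s x :=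
  Module.DirectLimit.of_f (f := extTransition J n M) (hij := h) (x := x)

lemma exists_of {n : ℕ} {M : ModuleCat.{u} R} (z : ColimExt J n M) :
    ∃ t x, of J n M t x = z :=
  Module.DirectLimit.exists_of (G := ExtFamily J n M) (f := extTransition J n M) z

lemma of_eq_zero {n : ℕ} {M : ModuleCat.{u} R} {t : ℕ}
    {x : Ext.{u} (ModuleCat.of R (R ⧸ J ^ t)) M n} (h : of J n M t x = 0) :
    ∃ (s : ℕ) (h : t ≤ s), (Ext.mk₀ (powProj J h)).comp x (zero_add n) = 0 :=
  Module.DirectLimit.of.zero_exact (G := ExtFamily J n M) (f := extTransition J n M) h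

variable (J) in
/-- The map `ColimExt J n Y → ColimExt J (n + k) Z` given by a class in `Ext Y Z k`. -/
noncomputable def map {Y Z : ModuleCat.{u} R} {k : ℕ} (β : Ext.{u} Y Z k) {n m : ℕ}
    (h : n + k = m) : ColimExt J n Y →ₗ[R] ColimExt J m Z :=
  Module.DirectLimit.map (G := ExtFamily J n Y) (f := extTransition J n Y)
    (G' := ExtFamily J m Z) (f' := extTransition J m Z)
    (fun t => β.postcompOfLinear R (ModuleCat.of R (R ⧸ J ^ t)) h) (fun i j hij => by
      ext x
      exact Ext.comp_assoc (Ext.mk₀ (powProj J hij)) x β (zero_add n) h (by omega))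

lemma map_of {Y Z : ModuleCat.{u} R} {k : ℕ} (β : Ext.{u} Y Z k) {n m : ℕ}
    (h : n + k = m) {t : ℕ} (x : Ext.{u} (ModuleCat.of R (R ⧸ J ^ t)) Y n) :
    map J β h (of J n Y t x) = of J m Z t (x.comp β h) :=
  Module.DirectLimit.map_apply_of (G := ExtFamily J n Y) (f := extTransition J n Y)
    (G' := ExtFamily J m Z) (f' := extTransition J m Z)
    (fun t => β.postcompOfLinear R (ModuleCat.of R (R ⧸ J ^ t)) h) _ x

lemma map_map {X Y Z : ModuleCat.{u} R} {k l : ℕ} (α : Ext.{u} X Y k) (β : Ext.{u} Y Z l)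
    {n m r p : ℕ} (h : n + k = m) (h' : m + l = r) (hp : k + l = p) (z : ColimExt J n X) :
    map J β h' (map J α h z) = map J (α.comp β hp) (by omega : n + p = r) z := by
  obtain ⟨t, x, rfl⟩ := exists_of z
  simp only [map_of]
  rw [Ext.comp_assoc]
  omega

lemma map_zero_class {Y Z : ModuleCat.{u} R} {k : ℕ} {n m : ℕ} (h : n + k = m)
    (z : ColimExt J n Y) :
    map J (0 : Ext.{u} Y Z k) h z = 0 := by
  obtain ⟨t, x, rfl⟩ := exists_of z
  simp [map_of]

lemma map_smul_id {Y : ModuleCat.{u} R} {n : ℕ} (r : R) (z : ColimExt J n Y) :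
    map J (Ext.mk₀ (r • 𝟙 Y)) (add_zero n) z = r • z := by
  obtain ⟨t, x, rfl⟩ := exists_of z
  rw [map_of, ← Ext.smul_eq_comp_mk₀, map_smul]

lemma map_exact {A B C : ModuleCat.{u} R} {k l n m p : ℕ} (α : Ext.{u} A B k) (β : Ext.{u} B C l)
    (h : n + k = m) (h' : m + l = p)
    (H : ∀ (X : ModuleCat.{u} R) (x : Ext.{u} X B m), x.comp β h' = 0 →
      ∃ y : Ext.{u} X A n, y.comp α h = x)
    (z : ColimExt J m B) (hz : map J β h' z = 0) : ∃ w, map J α h w = z := by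
  obtain ⟨t, x, rfl⟩ := exists_of z
  rw [map_of] at hz
  obtain ⟨s, hs, e⟩ := of_eq_zero hz
  rw [← Ext.comp_assoc _ _ _ (zero_add m) h' (by omega)] at e
  obtain ⟨y, hy⟩ := H _ _ e
  refine ⟨of J n A s y, ?_⟩
  rw [map_of, hy, of_precomp]

variable {S : ShortComplex (ModuleCat.{u} R)}

lemma map_g_map_f {n : ℕ} (z : ColimExt J n S.X₁) :
    map J (Ext.mk₀ S.g) (add_zero n) (map J (Ext.mk₀ S.f) (add_zero n) z) = 0 := by
  rw [map_map _ _ _ _ (add_zero 0), Ext.mk₀_comp_mk₀, S.zero, Ext.mk₀_zero, map_zero_class]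

lemma exact_two (hS : S.ShortExact) {n : ℕ} (z : ColimExt J n S.X₂)
    (hz : map J (Ext.mk₀ S.g) (add_zero n) z = 0) :
    ∃ w, map J (Ext.mk₀ S.f) (add_zero n) w = z :=
  map_exact _ _ _ _ (fun X x hx => Ext.covariant_sequence_exact₂ X hS x hx) z hz

lemma exact_three (hS : S.ShortExact) {n : ℕ} (z : ColimExt J n S.X₃)
    (hz : map J hS.extClass rfl z = 0) :
    ∃ w, map J (Ext.mk₀ S.g) (add_zero n) w = z :=
  map_exact _ _ _ _ (fun X x hx => Ext.covariant_sequence_exact₃ X hS x rfl hx) z hz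

lemma exact_one (hS : S.ShortExact) {n : ℕ} (z : ColimExt J (n + 1) S.X₁)
    (hz : map J (Ext.mk₀ S.f) (add_zero (n + 1)) z = 0) :
    ∃ w, map J hS.extClass rfl w = z :=
  map_exact _ _ _ _ (fun X x hx => Ext.covariant_sequence_exact₁ X hS x hx rfl) z hz

lemma map_extClass_map_g (hS : S.ShortExact) {n : ℕ} (z : ColimExt J n S.X₂) :
    map J hS.extClass rfl (map J (Ext.mk₀ S.g) (add_zero n) z) = 0 := by
  rw [map_map _ _ _ _ (zero_add 1), hS.comp_extClass, map_zero_class]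

end ColimExt

end ColimExtBasic

section ColimExtZero

open CategoryTheory Abelian

variable {R : Type u} [CommRing R] {J : Ideal R}

namespace ColimExt

variable (J) in
/-- An element is `J`-power torsion if some power of `J` kills it. -/
def IsPowTorsion {M : Type*} [AddCommGroup M] [Module R M] (x : M) : Prop :=
  ∃ t : ℕ, ∀ a ∈ J ^ t, a • x = 0

lemma isPowTorsion {n : ℕ} {M : ModuleCat.{u} R} (z : ColimExt J n M) : IsPowTorsion J z := by
  obtain ⟨t, x, rfl⟩ := exists_of z
  refine ⟨t, fun a ha => ?_⟩
  have h : a • 𝟙 (ModuleCat.of R (R ⧸ J ^ t)) = 0 := by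
    ext
    change a • (Ideal.Quotient.mk (J ^ t) 1) = 0
    rw [← Ideal.Quotient.mkₐ_eq_mk R, ← map_smul, Ideal.Quotient.mkₐ_eq_mk,
      Ideal.Quotient.eq_zero_iff_mem]
    simpa using ha
  rw [← map_smul]
  have e : a • x = 0 := by
    have := Ext.smul_comp (Ext.mk₀ (𝟙 (ModuleCat.of R (R ⧸ J ^ t)))) x (zero_add n) a
    rw [← Ext.mk₀_smul, h, Ext.mk₀_zero, Ext.zero_comp, Ext.mk₀_id_comp] at this
    exact this.symm
  rw [e, LinearMap.map_zero]

/-- The map `R ⧸ J ^ t ⟶ M` sending `1` to `x`. -/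
noncomputable def elemHom {M : ModuleCat.{u} R} {t : ℕ} (x : M) (hx : ∀ a ∈ J ^ t, a • x = 0) :
    ModuleCat.of R (R ⧸ J ^ t) ⟶ M :=
  ModuleCat.ofHom (Submodule.liftQ (J ^ t) (LinearMap.toSpanSingleton R M x) hx)

lemma elemHom_one {M : ModuleCat.{u} R} {t : ℕ} (x : M) (hx : ∀ a ∈ J ^ t, a • x = 0) :
    elemHom x hx (Ideal.Quotient.mk (J ^ t) 1) = x :=
  one_smul R x

lemma quotient_hom_ext {M : ModuleCat.{u} R} {t : ℕ} {f g : ModuleCat.of R (R ⧸ J ^ t) ⟶ M}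
    (h : f (Ideal.Quotient.mk (J ^ t) 1) = g (Ideal.Quotient.mk (J ^ t) 1)) : f = g := by
  ext
  exact h

lemma smul_apply_one {M : ModuleCat.{u} R} {t : ℕ} (f : ModuleCat.of R (R ⧸ J ^ t) ⟶ M)
    {a : R} (ha : a ∈ J ^ t) : a • f (Ideal.Quotient.mk (J ^ t) 1) = 0 := by
  have e : a • (Ideal.Quotient.mk (J ^ t) 1) = 0 := by
    rw [← Ideal.Quotient.mkₐ_eq_mk R, ← map_smul, Ideal.Quotient.mkₐ_eq_mk,
      Ideal.Quotient.eq_zero_iff_mem]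
    simpa using ha
  exact (map_smul f.hom a _).symm.trans ((congrArg f.hom e).trans (map_zero f.hom))

lemma exists_of_mk₀ {M : ModuleCat.{u} R} (z : ColimExt J 0 M) :
    ∃ (t : ℕ) (f : ModuleCat.of R (R ⧸ J ^ t) ⟶ M), of J 0 M t (Ext.mk₀ f) = z := by
  obtain ⟨t, x, rfl⟩ := exists_of z
  obtain ⟨f, rfl⟩ := (Ext.mk₀_bijective _ _).2 x
  exact ⟨t, f, rfl⟩

lemma eq_zero_of_of_mk₀ {M : ModuleCat.{u} R} {t : ℕ} {f : ModuleCat.of R (R ⧸ J ^ t) ⟶ M}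
    (h : of J 0 M t (Ext.mk₀ f) = 0) : f = 0 := by
  obtain ⟨s, hs, e⟩ := of_eq_zero h
  rw [Ext.mk₀_comp_mk₀] at e
  have e' : powProj J hs ≫ f = 0 := (Ext.mk₀_bijective _ _).1 (e.trans (Ext.mk₀_zero _ _).symm)
  refine quotient_hom_ext ?_
  exact congrArg (fun g : _ ⟶ M => g (Ideal.Quotient.mk (J ^ s) 1)) e'

lemma eq_zero_of_isSMulRegular {M : ModuleCat.{u} R} {r : R} (hr : r ∈ J)
    (h : IsSMulRegular M r) (z : ColimExt J 0 M) : z = 0 := by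
  obtain ⟨t, f, rfl⟩ := exists_of_mk₀ z
  have e : f = 0 := quotient_hom_ext
    ((h.pow t).right_eq_zero_of_smul (smul_apply_one f (Ideal.pow_mem_pow hr t)))
  rw [e, Ext.mk₀_zero, LinearMap.map_zero]

lemma map_surjective_of_isPowTorsion {B C : ModuleCat.{u} R} (g : B ⟶ C)
    (hg : Function.Surjective g) (hB : ∀ b : B, IsPowTorsion J b) :
    Function.Surjective (map J (Ext.mk₀ g) (add_zero 0)) := by
  intro z
  obtain ⟨t, f, rfl⟩ := exists_of_mk₀ z
  obtain ⟨b, hb⟩ := hg (f (Ideal.Quotient.mk (J ^ t) 1))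
  obtain ⟨s, hs⟩ := hB b
  have hb' : ∀ a ∈ J ^ (max s t), a • b = 0 :=
    fun a ha => hs a (Ideal.pow_le_pow_right (le_max_left s t) ha)
  refine ⟨of J 0 B (max s t) (Ext.mk₀ (elemHom b hb')), ?_⟩
  rw [map_of, Ext.mk₀_comp_mk₀, ← of_precomp (le_max_right s t), Ext.mk₀_comp_mk₀]
  congr 2
  refine quotient_hom_ext ?_
  exact (congrArg g (elemHom_one b hb')).trans hb

/-- The map from a module killed by a power of `J` to its zeroth local cohomology. -/
noncomputable def ofElem (M : ModuleCat.{u} R) {s : ℕ} (hM : ∀ a ∈ J ^ s, ∀ x : M, a • x = 0) :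
    M →ₗ[R] ColimExt J 0 M where
  toFun x := of J 0 M s (Ext.mk₀ (elemHom x (fun a ha => hM a ha x)))
  map_add' x y := by
    rw [← map_add, ← Ext.mk₀_add]
    congr 2
    refine quotient_hom_ext ?_
    exact smul_add (1 : R) x y
  map_smul' r x := by
    rw [RingHom.id_apply, ← map_smul, ← Ext.mk₀_smul]
    congr 2
    refine quotient_hom_ext ?_
    exact smul_comm (1 : R) r x

lemma ofElem_injective (M : ModuleCat.{u} R) {s : ℕ}
    (hM : ∀ a ∈ J ^ s, ∀ x : M, a • x = 0) : Function.Injective (ofElem M hM) := by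
  rw [injective_iff_map_eq_zero]
  intro x hx
  rw [← elemHom_one x (fun a ha => hM a ha x), eq_zero_of_of_mk₀ hx]
  rfl

lemma ofElem_surjective (M : ModuleCat.{u} R) {s : ℕ}
    (hM : ∀ a ∈ J ^ s, ∀ x : M, a • x = 0) : Function.Surjective (ofElem M hM) := by
  intro z
  obtain ⟨t, f, rfl⟩ := exists_of_mk₀ z
  refine ⟨f (Ideal.Quotient.mk (J ^ t) 1), ?_⟩
  change of J 0 M s _ = _
  rw [← of_precomp (le_max_left s t), ← of_precomp (le_max_right s t), Ext.mk₀_comp_mk₀,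
    Ext.mk₀_comp_mk₀]
  congr 2
  refine quotient_hom_ext ?_
  exact one_smul R _

lemma eq_zero_of_injective {E : ModuleCat.{u} R} [Injective E] {n : ℕ}
    (z : ColimExt J (n + 1) E) : z = 0 := by
  obtain ⟨t, x, rfl⟩ := exists_of z
  rw [Ext.eq_zero_of_injective x, LinearMap.map_zero]

end ColimExt

end ColimExtZero

section ColimExtTorsion

open CategoryTheory Abelian

variable {R : Type u} [CommRing R] {J : Ideal R}

namespace ColimExt

variable (J) in
/-- The submodule of `J`-power torsion elements. -/
def powTorsion (M : Type*) [AddCommGroup M] [Module R M] : Submodule R M where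
  carrier := {x | IsPowTorsion J x}
  zero_mem' := ⟨0, fun a _ => smul_zero a⟩
  add_mem' := by
    rintro x y ⟨s, hs⟩ ⟨t, ht⟩
    refine ⟨max s t, fun a ha => ?_⟩
    rw [smul_add, hs a (Ideal.pow_le_pow_right (le_max_left s t) ha),
      ht a (Ideal.pow_le_pow_right (le_max_right s t) ha), add_zero]
  smul_mem' := by
    rintro r x ⟨s, hs⟩
    exact ⟨s, fun a ha => by rw [smul_comm, hs a ha, smul_zero]⟩

lemma mem_powTorsion {M : Type*} [AddCommGroup M] [Module R M] {x : M} :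
    x ∈ powTorsion J M ↔ IsPowTorsion J x := Iff.rfl

lemma IsPowTorsion.map {M N : Type*} [AddCommGroup M] [Module R M] [AddCommGroup N] [Module R N]
    {x : M} (h : IsPowTorsion J x) (f : M →ₗ[R] N) : IsPowTorsion J (f x) := by
  obtain ⟨t, ht⟩ := h
  exact ⟨t, fun a ha => by rw [← map_smul, ht a ha, map_zero]⟩

lemma IsPowTorsion.of_map {M N : Type*} [AddCommGroup M] [Module R M] [AddCommGroup N]
    [Module R N] {x : M} (f : M →ₗ[R] N) (hf : Function.Injective f)
    (h : IsPowTorsion J (f x)) : IsPowTorsion J x := by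
  obtain ⟨t, ht⟩ := h
  exact ⟨t, fun a ha => hf (by rw [map_smul, ht a ha, map_zero])⟩

lemma exists_pow_smul_eq_zero {M : Type*} [AddCommGroup M] [Module R M] [Module.Finite R M]
    (h : ∀ x : M, IsPowTorsion J x) : ∃ t : ℕ, ∀ a ∈ J ^ t, ∀ x : M, a • x = 0 := by
  obtain ⟨s, hs⟩ := (Module.Finite.fg_top : (⊤ : Submodule R M).FG)
  choose t ht using h
  refine ⟨s.sup t, fun a ha x => ?_⟩
  have : (⊤ : Submodule R M) ≤ LinearMap.ker (LinearMap.lsmul R M a) := by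
    rw [← hs, Submodule.span_le]
    intro y hy
    exact ht y a (Ideal.pow_le_pow_right (Finset.le_sup hy) ha)
  exact this (Submodule.mem_top (x := x))

lemma exists_hom_extending [IsNoetherianRing R] {E : Type u} [AddCommGroup E] [Module R E]
    [Module.Injective R E] (I : Ideal R) (g : I →ₗ[R] powTorsion J E) :
    ∃ h : R →ₗ[R] powTorsion J E, ∀ (x : R) (hx : x ∈ I), h x = g ⟨x, hx⟩ := by
  obtain ⟨t, ht⟩ := exists_pow_smul_eq_zero (J := J) (M := LinearMap.range g) (by
    rintro ⟨_, y, rfl⟩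
    exact IsPowTorsion.of_map (LinearMap.range g).subtype Subtype.val_injective
      (IsPowTorsion.of_map (powTorsion J E).subtype Subtype.val_injective (g y).2))
  obtain ⟨k, hk⟩ := Ideal.exists_pow_inf_eq_pow_smul J (M := R) I
  have hk' : J ^ (t + k) ⊓ I ≤ J ^ t • I := by
    have := hk (t + k) (by omega)
    rw [Ideal.smul_eq_mul, Ideal.mul_top, Nat.add_sub_cancel] at this
    rw [this]
    exact Submodule.smul_mono le_rfl inf_le_right
  have hz : ∀ x ∈ J ^ t • I, ∀ hx : x ∈ I, g ⟨x, hx⟩ = 0 := by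
    intro x hx
    refine Submodule.smul_induction_on' (p := fun x _ => ∀ hx : x ∈ I, g ⟨x, hx⟩ = 0) hx ?_ ?_
    · intro r hr n hn hx
      have : (⟨r • n, hx⟩ : I) = r • ⟨n, hn⟩ := rfl
      rw [this, map_smul]
      exact congrArg Subtype.val (ht r hr ⟨g ⟨n, hn⟩, ⟨n, hn⟩, rfl⟩)
    · intro x hx y hy h1 h2 hxy
      have hx' := Ideal.mul_le_right hx
      have hy' := Ideal.mul_le_right hy
      have : (⟨x + y, hxy⟩ : I) = ⟨x, hx'⟩ + ⟨y, hy'⟩ := rfl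
      rw [this, map_add, h1, h2, add_zero]
  let i : (I ⧸ Submodule.comap I.subtype (J ^ (t + k))) →ₗ[R] (R ⧸ J ^ (t + k)) :=
    Submodule.mapQ _ (J ^ (t + k)) I.subtype le_rfl
  have hi : Function.Injective i := by
    rw [← LinearMap.ker_eq_bot, Submodule.ker_mapQ]
    simp
  let g' : (I ⧸ Submodule.comap I.subtype (J ^ (t + k))) →ₗ[R] E :=
    Submodule.liftQ _ ((powTorsion J E).subtype ∘ₗ g) (by
      rintro ⟨x, hx⟩ hx'
      have := hz x (hk' ⟨hx', hx⟩) hx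
      rw [LinearMap.mem_ker, LinearMap.comp_apply, this, map_zero])
  obtain ⟨h, hh⟩ := Module.Injective.out i hi g'
  refine ⟨(h ∘ₗ Submodule.mkQ _).codRestrict _ ?_, ?_⟩
  · intro x
    refine IsPowTorsion.map ⟨t + k, fun a ha => ?_⟩ h
    rw [← map_smul, Submodule.mkQ_apply, Submodule.Quotient.mk_eq_zero]
    exact Ideal.mul_mem_right _ _ ha
  · intro x hx
    exact Subtype.ext (hh (Submodule.Quotient.mk ⟨x, hx⟩))

/-- Over a Noetherian ring, the torsion submodule of an injective module is injective. -/
lemma injective_powTorsion [IsNoetherianRing R] (E : Type u) [AddCommGroup E] [Module R E]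
    [Module.Injective R E] : Module.Injective R (powTorsion J E) :=
  Module.Baer.injective (fun I g => exists_hom_extending I g)

lemma shortExact_of_linearMap {A B C : Type u} [AddCommGroup A] [Module R A] [AddCommGroup B]
    [Module R B] [AddCommGroup C] [Module R C] (f : A →ₗ[R] B) (g : B →ₗ[R] C)
    (hf : Function.Injective f) (hg : Function.Surjective g) (hfg : Function.Exact f g) :
    (ShortComplex.mk (ModuleCat.ofHom f) (ModuleCat.ofHom g) (by
      ext x; exact hfg.apply_apply_eq_zero x)).ShortExact where
  exact := (ShortComplex.moduleCat_exact_iff _).2 (fun x hx => (hfg x).1 hx)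
  mono_f := (ModuleCat.mono_iff_injective _).2 hf
  epi_g := (ModuleCat.epi_iff_surjective _).2 hg

lemma exists_injective_isPowTorsion [IsNoetherianRing R] (T : Type u) [AddCommGroup T]
    [Module R T] (hT : ∀ x : T, IsPowTorsion J x) :
    ∃ (E : Type u) (_ : AddCommGroup E) (_ : Module R E) (f : T →ₗ[R] E),
      Function.Injective f ∧ Module.Injective R E ∧ ∀ x : E, IsPowTorsion J x := by
  let E := Injective.under (ModuleCat.of R T)
  have : Module.Injective R E := (Module.injective_iff_injective_object R E).2
    (inferInstanceAs (Injective (Injective.under (ModuleCat.of R T))))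
  refine ⟨powTorsion J E, inferInstance, inferInstance,
    (Injective.ι (ModuleCat.of R T)).hom.codRestrict _ (fun x => (hT x).map _), ?_,
    injective_powTorsion E, fun x =>
      IsPowTorsion.of_map (powTorsion J E).subtype Subtype.val_injective x.2⟩
  intro x y hxy
  exact (ModuleCat.mono_iff_injective (Injective.ι (ModuleCat.of R T))).1 inferInstance
    (congrArg Subtype.val hxy)

/-- Power torsion modules have no higher local cohomology. -/
lemma eq_zero_of_isPowTorsion [IsNoetherianRing R] (n : ℕ) :
    ∀ (T : Type u) [AddCommGroup T] [Module R T], (∀ x : T, IsPowTorsion J x) →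
      ∀ z : ColimExt J (n + 1) (ModuleCat.of R T), z = 0 := by
  induction n with
  | zero =>
    intro T _ _ hT z
    obtain ⟨E, _, _, f, hf, hE, hE'⟩ := exists_injective_isPowTorsion T hT
    have hS := shortExact_of_linearMap f (LinearMap.range f).mkQ hf
      (Submodule.mkQ_surjective _) (LinearMap.exact_map_mkQ_range f)
    have := (Module.injective_iff_injective_object R E).1 hE
    obtain ⟨w, rfl⟩ := exact_one hS z (eq_zero_of_injective (E := ModuleCat.of R E) _)
    obtain ⟨v, rfl⟩ := map_surjective_of_isPowTorsion
      (ModuleCat.ofHom (LinearMap.range f).mkQ) (Submodule.mkQ_surjective _) hE' w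
    exact map_extClass_map_g hS v
  | succ n ih =>
    intro T _ _ hT z
    obtain ⟨E, _, _, f, hf, hE, hE'⟩ := exists_injective_isPowTorsion T hT
    have hS := shortExact_of_linearMap f (LinearMap.range f).mkQ hf
      (Submodule.mkQ_surjective _) (LinearMap.exact_map_mkQ_range f)
    have := (Module.injective_iff_injective_object R E).1 hE
    obtain ⟨w, rfl⟩ := exact_one hS z (eq_zero_of_injective (E := ModuleCat.of R E) _)
    have hw : w = 0 := ih (E ⧸ LinearMap.range f) (fun x => by
      obtain ⟨y, rfl⟩ := Submodule.mkQ_surjective _ x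
      exact (hE' y).map _) w
    rw [hw, LinearMap.map_zero]

end ColimExt

end ColimExtTorsion

section ColimExtArtinian

open CategoryTheory Abelian

variable {R : Type u} [CommRing R] {J : Ideal R}

namespace ColimExt

lemma powTorsion_quotient_eq_zero [IsNoetherianRing R] {M : Type*} [AddCommGroup M] [Module R M]
    [Module.Finite R M] (x : M ⧸ powTorsion J M) (hx : IsPowTorsion J x) : x = 0 := by
  obtain ⟨x, rfl⟩ := Submodule.mkQ_surjective _ x
  obtain ⟨s, hs⟩ := exists_pow_smul_eq_zero (J := J) (M := powTorsion J M)
    (fun y => IsPowTorsion.of_map (powTorsion J M).subtype Subtype.val_injective y.2)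
  obtain ⟨t, ht⟩ := hx
  rw [Submodule.mkQ_apply, Submodule.Quotient.mk_eq_zero]
  refine ⟨s + t, fun a ha => ?_⟩
  rw [pow_add] at ha
  refine Submodule.mul_induction_on ha (fun b hb c hc => ?_) (fun b c hb hc => ?_)
  · have h : c • x ∈ powTorsion J M := by
      rw [← Submodule.Quotient.mk_eq_zero, Submodule.Quotient.mk_smul]
      exact ht c hc
    rw [mul_smul]
    exact congrArg Subtype.val (hs b hb ⟨_, h⟩)
  · rw [add_smul, hb, hc, add_zero]

lemma map_smulShortComplex_f {M : ModuleCat.{u} R} (r : R) {n : ℕ} (z : ColimExt J n M) :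
    map J (Ext.mk₀ (M.smulShortComplex r).f) (add_zero n) z = r • z :=
  map_smul_id r z

lemma shortExact_powTorsion (M : Type u) [AddCommGroup M] [Module R M] :
    (ShortComplex.mk (ModuleCat.ofHom (powTorsion J M).subtype)
      (ModuleCat.ofHom (powTorsion J M).mkQ) (by ext x; simp)).ShortExact :=
  shortExact_of_linearMap _ _ Subtype.val_injective (Submodule.mkQ_surjective _)
    (LinearMap.exact_subtype_mkQ _)

lemma isPowTorsion_powTorsion {M : Type*} [AddCommGroup M] [Module R M] (x : powTorsion J M) :
    IsPowTorsion J x :=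
  IsPowTorsion.of_map (powTorsion J M).subtype Subtype.val_injective x.2

variable [IsLocalRing R] [IsNoetherianRing R]

/-- Prime avoidance: a torsion-free module has regular elements in any power of the maximal ideal,
which can be chosen outside of a given finite set of nonmaximal primes. -/
lemma exists_isSMulRegular_mem_pow {M : Type*} [AddCommGroup M] [Module R M] [Module.Finite R M]
    (hM : ∀ x : M, IsPowTorsion (maximalIdeal R) x → x = 0) {T : Set (Ideal R)} (hT : T.Finite)
    (hT' : ∀ p ∈ T, p.IsPrime ∧ p ≠ maximalIdeal R) (k : ℕ) :
    ∃ r ∈ maximalIdeal R ^ k, IsSMulRegular M r ∧ ∀ p ∈ T, r ∉ p := by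
  by_contra! hcon
  have hprime : ∀ p ∈ T ∪ associatedPrimes R M, p.IsPrime := by
    rintro p (hp | hp)
    · exact (hT' p hp).1
    · exact hp.1
  have hsub : ((maximalIdeal R ^ k : Ideal R) : Set R) ⊆ ⋃ p ∈ T ∪ associatedPrimes R M, p := by
    intro r hr
    rw [Set.biUnion_union]
    by_cases h : IsSMulRegular M r
    · obtain ⟨p, hp, hrp⟩ := hcon r hr h
      exact Or.inl (Set.mem_biUnion hp hrp)
    · rw [biUnion_associatedPrimes_eq_compl_regular]
      exact Or.inr h
  obtain ⟨p, hp, hle⟩ := (Ideal.subset_union_prime_finite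
    (hT.union (associatedPrimes.finite R M)) (f := id) ⊥ ⊥ (fun i hi _ _ => hprime i hi)).1 hsub
  have hpp := hprime p hp
  have hpm : p = maximalIdeal R :=
    le_antisymm (le_maximalIdeal hpp.ne_top) (hpp.le_of_pow_le hle)
  rcases hp with hp | hp
  · exact (hT' p hp).2 hpm
  · obtain ⟨_, x, hx⟩ := isAssociatedPrime_iff.1 hp
    have h0 : x = 0 := hM x ⟨1, fun a ha => by
      rw [pow_one, ← hpm, hx, Submodule.mem_colon_singleton, Submodule.mem_bot] at ha
      exact ha⟩
    apply hpp.ne_top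
    rw [hx, h0, Ideal.eq_top_iff_one, Submodule.mem_colon_singleton, smul_zero]
    exact Submodule.zero_mem _

lemma isArtinian_zero {T : Type u} [AddCommGroup T] [Module R T] [Module.Finite R T]
    (hT : ∀ x : T, IsPowTorsion (maximalIdeal R) x) :
    IsArtinian R (ColimExt (maximalIdeal R) 0 (ModuleCat.of R T)) := by
  obtain ⟨s, hs⟩ := exists_pow_smul_eq_zero hT
  have := isArtinian_of_pow_maximalIdeal_smul_eq_zero hs
  exact isArtinian_of_surjective _ (ofElem (ModuleCat.of R T) hs) (ofElem_surjective _ hs)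

/-- Local cohomology of finite modules at the maximal ideal is Artinian. -/
lemma isArtinian (n : ℕ) : ∀ (M : Type u) [AddCommGroup M] [Module R M] [Module.Finite R M],
    IsArtinian R (ColimExt (maximalIdeal R) n (ModuleCat.of R M)) := by
  induction n with
  | zero =>
    intro M _ _ _
    have h1 := isArtinian_zero (R := R) (T := powTorsion (maximalIdeal R) M)
      isPowTorsion_powTorsion
    obtain ⟨r, hr, hreg, -⟩ := exists_isSMulRegular_mem_pow (R := R)
      (M := M ⧸ powTorsion (maximalIdeal R) M) powTorsion_quotient_eq_zero Set.finite_empty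
      (by simp) 1
    rw [pow_one] at hr
    refine isArtinian_of_surjective _ (map (maximalIdeal R)
      (Ext.mk₀ (ModuleCat.ofHom (powTorsion (maximalIdeal R) M).subtype)) (add_zero 0)) ?_
    intro z
    exact exact_two (shortExact_powTorsion M) z (eq_zero_of_isSMulRegular hr hreg _)
  | succ n ih =>
    intro M _ _ _
    obtain ⟨r, hr, hreg, -⟩ := exists_isSMulRegular_mem_pow (R := R)
      (M := M ⧸ powTorsion (maximalIdeal R) M) powTorsion_quotient_eq_zero Set.finite_empty
      (by simp) 1
    rw [pow_one] at hr
    let M' := M ⧸ powTorsion (maximalIdeal R) M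
    have h1 : IsArtinian R (ColimExt (maximalIdeal R) (n + 1) (ModuleCat.of R M')) := by
      have hS := IsSMulRegular.smulShortComplex_shortExact (M := ModuleCat.of R M') hreg
      have := ih (QuotSMulTop r M')
      let δ : ColimExt (maximalIdeal R) n (ModuleCat.of R (QuotSMulTop r M')) →ₗ[R]
          ColimExt (maximalIdeal R) (n + 1) (ModuleCat.of R M') :=
        map (maximalIdeal R) hS.extClass rfl
      have hker : LinearMap.ker (LinearMap.lsmul R
          (ColimExt (maximalIdeal R) (n + 1) (ModuleCat.of R M')) r) ≤ LinearMap.range δ := by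
        intro z hz
        exact exact_one hS z ((map_smulShortComplex_f r z).trans hz)
      have h2 : IsArtinian R (LinearMap.range δ) := isArtinian_range _
      have h3 := isArtinian_of_le hker
      refine isArtinian_of_ker_lsmul r (fun z => ?_)
      obtain ⟨t, ht⟩ := isPowTorsion z
      exact ⟨t, ht _ (Ideal.pow_mem_pow hr t)⟩
    refine isArtinian_of_injective (map (maximalIdeal R)
      (Ext.mk₀ (ModuleCat.ofHom (powTorsion (maximalIdeal R) M).mkQ)) (add_zero (n + 1))) ?_
    rw [injective_iff_map_eq_zero]
    intro z hz
    obtain ⟨w, rfl⟩ := exact_two (shortExact_powTorsion M) z hz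
    rw [eq_zero_of_isPowTorsion n _ isPowTorsion_powTorsion w, LinearMap.map_zero]

end ColimExt

end ColimExtArtinian

section ColimExtNonvanishing

open CategoryTheory Abelian

variable {R : Type u} [CommRing R]

namespace ColimExt
variable [IsLocalRing R]

lemma support_subset_of_isPowTorsion {T : Type*} [AddCommGroup T] [Module R T]
    (hT : ∀ x : T, IsPowTorsion (maximalIdeal R) x) : Module.support R T ⊆ {closedPoint R} := by
  intro p hp
  obtain ⟨x, hx⟩ := Module.mem_support_iff_exists_annihilator.1 hp
  obtain ⟨s, hs⟩ := hT x
  have h1 : maximalIdeal R ≤ p.asIdeal := by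
    refine p.2.le_of_pow_le (n := s) (le_trans (fun a ha => ?_) hx)
    rw [Submodule.mem_annihilator_span_singleton]
    exact hs a ha
  exact PrimeSpectrum.ext (le_antisymm (le_maximalIdeal p.2.ne_top) h1)

lemma supportDim_eq_zero_of_isPowTorsion {T : Type*} [AddCommGroup T] [Module R T] [Nontrivial T]
    (hT : ∀ x : T, IsPowTorsion (maximalIdeal R) x) : Module.supportDim R T = 0 := by
  have h := support_subset_of_isPowTorsion hT
  have : Subsingleton (Module.support R T) :=
    ⟨fun a b => Subtype.ext ((h a.2).trans (h b.2).symm)⟩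
  have : Nonempty (Module.support R T) := ⟨_, closedPoint_mem_support R T⟩
  exact Order.krullDim_eq_zero

lemma nontrivial_quotient_powTorsion {M : Type*} [AddCommGroup M] [Module R M] {d : ℕ}
    (h : Module.supportDim R M = (d + 1 : ℕ)) : Nontrivial (M ⧸ powTorsion (maximalIdeal R) M) := by
  rw [Submodule.Quotient.nontrivial_iff]
  intro htop
  have hM : Nontrivial M := by
    by_contra hM
    rw [not_nontrivial_iff_subsingleton, ← Module.supportDim_eq_bot_iff_subsingleton R M, h] at hM
    exact absurd hM (WithBot.coe_ne_bot (a := ((d + 1 : ℕ) : ℕ∞)))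
  have h0 := supportDim_eq_zero_of_isPowTorsion (R := R) (T := M)
    (fun x => mem_powTorsion.1 (htop ▸ Submodule.mem_top))
  rw [h] at h0
  exact absurd (by exact_mod_cast h0 : d + 1 = 0) (Nat.succ_ne_zero d)

lemma supportDim_quotient_powTorsion {M : Type*} [AddCommGroup M] [Module R M]
    [Nontrivial (M ⧸ powTorsion (maximalIdeal R) M)] :
    Module.supportDim R (M ⧸ powTorsion (maximalIdeal R) M) = Module.supportDim R M := by
  have h := Module.support_of_exact (LinearMap.exact_subtype_mkQ (powTorsion (maximalIdeal R) M))
    Subtype.val_injective (Submodule.mkQ_surjective _)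
  rw [Set.union_eq_right.2 ((support_subset_of_isPowTorsion isPowTorsion_powTorsion).trans
    (Set.singleton_subset_iff.2 (closedPoint_mem_support R _)))] at h
  rw [Module.supportDim, Module.supportDim, h]

lemma exists_map_mkQ_eq_smul {M : Type u} [AddCommGroup M] [Module R M] {n k : ℕ}
    (hk : ∀ a ∈ maximalIdeal R ^ k,
      ∀ z : ColimExt (maximalIdeal R) (n + 1) (ModuleCat.of R M), a • z = 0)
    {r : R} (hr : IsSMulRegular M r) {a : R} (ha : a ∈ maximalIdeal R ^ k)
    (z : ColimExt (maximalIdeal R) n (ModuleCat.of R (QuotSMulTop r M))) :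
    ∃ w, map (maximalIdeal R) (Ext.mk₀ ((ModuleCat.of R M).smulShortComplex r).g) (add_zero n) w =
      a • z := by
  have hS := IsSMulRegular.smulShortComplex_shortExact (M := ModuleCat.of R M) hr
  refine exact_three hS (a • z) ?_
  exact (map_smul (map (maximalIdeal R) hS.extClass rfl) a z).trans (hk a ha _)

lemma map_mkQ_smul {M : Type u} [AddCommGroup M] [Module R M] {n : ℕ} (r : R)
    (w : ColimExt (maximalIdeal R) n (ModuleCat.of R M)) :
    map (maximalIdeal R) (Ext.mk₀ ((ModuleCat.of R M).smulShortComplex r).g) (add_zero n)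
      (r • w) = 0 := by
  refine (congrArg _ (map_smulShortComplex_f (M := ModuleCat.of R M) r w).symm).trans ?_
  exact map_g_map_f (S := (ModuleCat.of R M).smulShortComplex r) w

lemma subsingleton_of_smul_surjective {M : Type*} [AddCommGroup M] [Module R M] [Module.Finite R M]
    {r : R} (hr : r ∈ maximalIdeal R) (h : ∀ x : M, ∃ y, x = r • y) : Subsingleton M := by
  rw [← Submodule.subsingleton_iff R, ← subsingleton_iff_bot_eq_top, eq_comm]
  refine Submodule.eq_bot_of_le_smul_of_le_jacobson_bot (maximalIdeal R) ⊤
    Module.Finite.fg_top (fun x _ => ?_) (maximalIdeal_le_jacobson _)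
  obtain ⟨y, rfl⟩ := h x
  exact Submodule.smul_mem_smul hr Submodule.mem_top

lemma smul_eq_zero_of_forall {T : Type u} [AddCommGroup T] [Module R T] [Module.Finite R T]
    (hT : ∀ x : T, IsPowTorsion (maximalIdeal R) x) {r : R}
    (h : ∀ z : ColimExt (maximalIdeal R) 0 (ModuleCat.of R T), r • z = 0) (x : T) : r • x = 0 := by
  obtain ⟨s, hs⟩ := exists_pow_smul_eq_zero hT
  refine ofElem_injective (ModuleCat.of R T) hs ?_
  exact ((ofElem (ModuleCat.of R T) hs).map_smul r x).trans
    ((h _).trans (LinearMap.map_zero _).symm)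

variable [IsNoetherianRing R]

lemma isPowTorsion_of_supportDim_eq_zero {M : Type*} [AddCommGroup M] [Module R M]
    [Module.Finite R M] (h : Module.supportDim R M = 0) (x : M) :
    IsPowTorsion (maximalIdeal R) x := by
  have h1 := support_of_supportDim_eq_zero R M h
  rw [Module.support_eq_zeroLocus, PrimeSpectrum.zeroLocus_eq_iff,
    (maximalIdeal.isMaximal R).isPrime.radical] at h1
  obtain ⟨k, hk⟩ := Ideal.exists_radical_pow_le_of_fg (Module.annihilator R M)
    (IsNoetherian.noetherian _)
  rw [h1] at hk
  exact ⟨k, fun a ha => Module.mem_annihilator.1 (hk ha) x⟩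

lemma nontrivial_zero {M : Type u} [AddCommGroup M] [Module R M] [Module.Finite R M]
    (h : Module.supportDim R M = 0) :
    Nontrivial (ColimExt (maximalIdeal R) 0 (ModuleCat.of R M)) := by
  have : Nontrivial M := by
    by_contra hM
    rw [not_nontrivial_iff_subsingleton, ← Module.supportDim_eq_bot_iff_subsingleton R M, h] at hM
    exact absurd hM (by simp)
  obtain ⟨s, hs⟩ := exists_pow_smul_eq_zero (isPowTorsion_of_supportDim_eq_zero h)
  exact (ofElem_injective (ModuleCat.of R M) hs).nontrivial

lemma pow_smul_eq_zero_quotient_powTorsion {M : Type u} [AddCommGroup M] [Module R M] {n k : ℕ}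
    (hk : ∀ a ∈ maximalIdeal R ^ k,
      ∀ z : ColimExt (maximalIdeal R) (n + 1) (ModuleCat.of R M), a • z = 0) :
    ∀ a ∈ maximalIdeal R ^ k, ∀ z : ColimExt (maximalIdeal R) (n + 1)
      (ModuleCat.of R (M ⧸ powTorsion (maximalIdeal R) M)), a • z = 0 := by
  intro a ha z
  obtain ⟨w, rfl⟩ := exact_three (shortExact_powTorsion M) z
    (eq_zero_of_isPowTorsion (n + 1) _ isPowTorsion_powTorsion _)
  rw [← map_smul]
  exact (congrArg _ (hk a ha w)).trans (LinearMap.map_zero _)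

lemma supportDim_quotSMulTop {M : Type*} [AddCommGroup M] [Module R M] [Module.Finite R M]
    {r : R} (hr : r ∈ maximalIdeal R) (hreg : IsSMulRegular M r) {d : ℕ}
    (h : Module.supportDim R M = (d + 1 : ℕ)) : Module.supportDim R (QuotSMulTop r M) = d := by
  have h1 := Module.supportDim_quotSMulTop_succ_eq_supportDim hreg hr
  rw [h, Nat.cast_add, Nat.cast_one] at h1
  exact ENat.WithBot.add_one_cancel.1 h1

/-- The top local cohomology of a finite module of positive dimension is not killed by any power
of the maximal ideal. -/
lemma not_exists_pow_smul_eq_zero (d : ℕ) : ∀ (M : Type u) [AddCommGroup M] [Module R M]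
    [Module.Finite R M], Module.supportDim R M = (d + 1 : ℕ) →
    ¬ ∃ k : ℕ, ∀ a ∈ maximalIdeal R ^ k,
      ∀ z : ColimExt (maximalIdeal R) (d + 1) (ModuleCat.of R M), a • z = 0 := by
  induction d with
  | zero =>
    rintro M _ _ _ hdim ⟨k, hk⟩
    have hnt := nontrivial_quotient_powTorsion hdim
    have hk' := pow_smul_eq_zero_quotient_powTorsion hk
    rw [← supportDim_quotient_powTorsion] at hdim
    obtain ⟨r, hr, hreg, -⟩ := exists_isSMulRegular_mem_pow (R := R)
      (M := M ⧸ powTorsion (maximalIdeal R) M) powTorsion_quotient_eq_zero Set.finite_empty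
      (by simp) (k + 1)
    have hr1 : r ∈ maximalIdeal R := Ideal.pow_le_self (Nat.succ_ne_zero k) hr
    have hrk : r ∈ maximalIdeal R ^ k := Ideal.pow_le_pow_right (Nat.le_succ k) hr
    have hdim' := supportDim_quotSMulTop (Ideal.mul_mem_left _ r hr1) (hreg.mul hreg) hdim
    refine not_subsingleton (M ⧸ powTorsion (maximalIdeal R) M)
      (subsingleton_of_smul_surjective hr1 fun x => ?_)
    have h1 : r • Submodule.mkQ _ x =
        (0 : QuotSMulTop (r * r) (M ⧸ powTorsion (maximalIdeal R) M)) := by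
      refine smul_eq_zero_of_forall (isPowTorsion_of_supportDim_eq_zero hdim') (fun z => ?_) _
      obtain ⟨w, hw⟩ := exists_map_mkQ_eq_smul hk' (hreg.mul hreg) hrk z
      refine hw.symm.trans ?_
      exact (congrArg _ (eq_zero_of_isSMulRegular hr1 hreg w)).trans (LinearMap.map_zero _)
    rw [← map_smul, Submodule.mkQ_apply, Submodule.Quotient.mk_eq_zero,
      Submodule.mem_smul_pointwise_iff_exists] at h1
    obtain ⟨y, -, hy⟩ := h1
    exact ⟨y, hreg ((hy.symm).trans (mul_smul r r y))⟩
  | succ d ih =>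
    rintro M _ _ _ hdim ⟨k, hk⟩
    have hnt := nontrivial_quotient_powTorsion hdim
    have hk' := pow_smul_eq_zero_quotient_powTorsion hk
    rw [← supportDim_quotient_powTorsion] at hdim
    have := isArtinian (R := R) (d + 1) (M ⧸ powTorsion (maximalIdeal R) M)
    obtain ⟨T, hT, hT', hTr⟩ := exists_finite_primes R (ColimExt (maximalIdeal R) (d + 1)
      (ModuleCat.of R (M ⧸ powTorsion (maximalIdeal R) M)))
    obtain ⟨r, hr, hreg, hrT⟩ := exists_isSMulRegular_mem_pow (R := R)
      (M := M ⧸ powTorsion (maximalIdeal R) M) powTorsion_quotient_eq_zero hT hT' 1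
    rw [pow_one] at hr
    obtain ⟨l, hl⟩ := hTr r hrT
    refine ih (QuotSMulTop r (M ⧸ powTorsion (maximalIdeal R) M))
      (supportDim_quotSMulTop hr hreg hdim) ⟨l + k, fun a ha z => ?_⟩
    rw [pow_add] at ha
    refine Submodule.mul_induction_on ha (fun b hb c hc => ?_) (fun b c hb hc => ?_)
    · obtain ⟨w, hw⟩ := exists_map_mkQ_eq_smul hk' hreg hc z
      obtain ⟨y, hy⟩ := hl b hb w
      rw [mul_smul, ← hw]
      exact (map_smul _ b w).symm.trans ((congrArg _ hy).trans (map_mkQ_smul r y))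
    · rw [add_smul, hb, hc, add_zero]

/-- **Grothendieck's nonvanishing theorem** for the colimit of `Ext` groups. -/
lemma nontrivial {M : Type u} [AddCommGroup M] [Module R M] [Module.Finite R M] {d : ℕ}
    (h : Module.supportDim R M = d) :
    Nontrivial (ColimExt (maximalIdeal R) d (ModuleCat.of R M)) := by
  cases d with
  | zero => exact nontrivial_zero h
  | succ d =>
    by_contra hM
    rw [not_nontrivial_iff_subsingleton] at hM
    exact not_exists_pow_smul_eq_zero d M h ⟨0, fun a _ z => Subsingleton.elim _ _⟩

end ColimExt

end ColimExtNonvanishing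

/-- Corollary 2.4.1: Let `(R,m)` be a noetherian local ring and `M` a
nonzero finitely generated `R`-module.  Then `H^{dim_R M}_m(M) ≠ 0`, where
`dim_R M = dim (R / ann_R M)` is the Krull dimension of `M`. -/
theorem stmt18 (R : Type) [CommRing R] [IsLocalRing R] [IsNoetherianRing R]
    (M : Type) [AddCommGroup M] [Module R M] [Nontrivial M] [Module.Finite R M]
    (d : ℕ) (hd : ringKrullDim (R ⧸ Module.annihilator R M) = d) :
    Nontrivial (LocalCohomologyModule (maximalIdeal R) d M) := by
  have h : Module.supportDim R M = d :=
    (Module.supportDim_eq_ringKrullDim_quotient_annihilator R M).trans hd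
  by_contra hM
  rw [not_nontrivial_iff_subsingleton] at hM
  have hC := ColimExt.nontrivial h
  refine not_subsingleton (ColimExt (maximalIdeal R) d (ModuleCat.of R M))
    (subsingleton_of_forall_eq 0 fun z => ?_)
  obtain ⟨t, x, rfl⟩ := ColimExt.exists_of z
  obtain ⟨s, hs, e⟩ :=
    exists_precomp_eq_zero_of_subsingleton (maximalIdeal R) d (ModuleCat.of R M) t x
  exact (ColimExt.of_precomp hs x).symm.trans ((congrArg _ e).trans (LinearMap.map_zero _))
end
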